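/- arXiv:2106.10725 — 4 statements merged into one kernel-verified Lean document; each statement's English description precedes it below -/
import Mathlib

section
/- Consider the Lorenz system ẋ = −σ(x−y), ẏ = rx − y − xz, ż = −bz + xy with σ > 0 and b ∈ (0,4] fixed. There exists a parameter value r = r_h ∈ (1,+∞) for which the system possesses a homoclinic orbit of the saddle equilibrium S₀ = (0,0,0) if and only if 3σ > 2b + 1. -/
open Filter Topology

/-- Integrating-factor monotonicity. -/
lemma monotoneOn_exp_mul (k : ℝ) {y y' : ℝ → ℝ} {s : Set ℝ} (hs : Convex ℝ s)
    (h : ∀ t ∈ s, HasDerivAt y (y' t) t) (hk : ∀ t ∈ s, 0 ≤ y' t + k * y t) :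
    MonotoneOn (fun t => Real.exp (k * t) * y t) s := by
  have hd : ∀ t ∈ s, HasDerivAt (fun t => Real.exp (k * t) * y t)
      (Real.exp (k * t) * (y' t + k * y t)) t := by
    intro t ht
    have h1 : HasDerivAt (fun t : ℝ => Real.exp (k * t)) (Real.exp (k * t) * k) t := by
      simpa using ((hasDerivAt_id t).const_mul k).exp
    exact (h1.fun_mul (h t ht)).congr_deriv (by ring)
  refine monotoneOn_of_deriv_nonneg hs (fun t ht => (hd t ht).continuousAt.continuousWithinAt)
    (fun t ht => (hd t (interior_subset ht)).differentiableAt.differentiableWithinAt) ?_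
  intro t ht
  rw [(hd t (interior_subset ht)).deriv]
  exact mul_nonneg (Real.exp_pos _).le (hk t (interior_subset ht))

lemma antitoneOn_exp_mul (k : ℝ) {y y' : ℝ → ℝ} {s : Set ℝ} (hs : Convex ℝ s)
    (h : ∀ t ∈ s, HasDerivAt y (y' t) t) (hk : ∀ t ∈ s, y' t + k * y t ≤ 0) :
    AntitoneOn (fun t => Real.exp (k * t) * y t) s := by
  have := monotoneOn_exp_mul k (y := fun t => -y t) (y' := fun t => -y' t) hs
    (fun t ht => (h t ht).neg) (fun t ht => by have := hk t ht; linarith)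
  intro a ha c hc hac
  have := this ha hc hac
  simp only at this ⊢
  linarith

lemma monotoneOn_of_hasDerivAt {y y' : ℝ → ℝ} {s : Set ℝ} (hs : Convex ℝ s)
    (h : ∀ t ∈ s, HasDerivAt y (y' t) t) (hk : ∀ t ∈ s, 0 ≤ y' t) : MonotoneOn y s := by
  simpa using monotoneOn_exp_mul 0 hs h (by simpa using hk)

lemma antitoneOn_of_hasDerivAt {y y' : ℝ → ℝ} {s : Set ℝ} (hs : Convex ℝ s)
    (h : ∀ t ∈ s, HasDerivAt y (y' t) t) (hk : ∀ t ∈ s, y' t ≤ 0) : AntitoneOn y s := by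
  simpa using antitoneOn_exp_mul 0 hs h (by simpa using hk)

lemma exp_mul_decay {g : ℝ → ℝ} {μ : ℝ} {x v : ℝ → ℝ} (hμ : 0 < μ)
    (hx : ∀ t, HasDerivAt x (v t) t) (hv : ∀ t, HasDerivAt v (-μ * v t + g t * x t) t)
    (hg : ∀ᶠ t in atTop, 0 < g t) (hx0 : Tendsto x atTop (𝓝 0)) :
    ∃ C, ∀ᶠ t in atTop, |Real.exp (μ * t) * x t| ≤ C ∧ |Real.exp (μ * t) * v t| ≤ C := by
  obtain ⟨T, hT⟩ := eventually_atTop.1 hg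
  by_cases hc : ∃ t0 ≥ T, 0 ≤ x t0 * v t0
  · obtain ⟨t0, ht0, h0⟩ := hc
    have hm : MonotoneOn (fun t => Real.exp (μ * t) * (x t * v t)) (Set.Ici t0) := by
      refine monotoneOn_exp_mul μ (convex_Ici t0) (fun t _ => (hx t).fun_mul (hv t)) ?_
      intro t ht
      have := hT t (ht0.trans ht)
      nlinarith [sq_nonneg (v t), mul_nonneg this.le (sq_nonneg (x t))]
    have hxv : ∀ t ∈ Set.Ici t0, 0 ≤ x t * v t := by
      intro t ht
      have h1 := hm Set.self_mem_Ici ht ht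
      have h2 : 0 ≤ Real.exp (μ * t) * (x t * v t) :=
        le_trans (mul_nonneg (Real.exp_pos _).le h0) h1
      exact nonneg_of_mul_nonneg_right h2 (Real.exp_pos _)
    have hm2 : MonotoneOn (fun t => x t * x t) (Set.Ici t0) := by
      refine monotoneOn_of_hasDerivAt (convex_Ici t0) (fun t _ => (hx t).fun_mul (hx t)) ?_
      intro t ht
      have := hxv t ht
      nlinarith
    have hz : ∀ t ∈ Set.Ici t0, x t = 0 := by
      intro t ht
      have h1 : Tendsto (fun t => x t * x t) atTop (𝓝 0) := by simpa using hx0.mul hx0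
      have h2 : x t * x t ≤ 0 := by
        refine ge_of_tendsto h1 ?_
        filter_upwards [eventually_ge_atTop t] with s hs
        exact hm2 ht (le_trans ht hs) hs
      nlinarith [mul_self_nonneg (x t), mul_self_eq_zero.1 (le_antisymm h2 (mul_self_nonneg (x t)))]
    refine ⟨0, ?_⟩
    filter_upwards [eventually_gt_atTop t0] with t ht
    have hv0 : v t = 0 := by
      have : x =ᶠ[𝓝 t] fun _ => 0 := by
        filter_upwards [Ioi_mem_nhds ht] with s hs
        exact hz s (Set.mem_Ioi.1 hs).le
      exact ((hx t).congr_of_eventuallyEq this.symm).unique (hasDerivAt_const t (0 : ℝ))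
    simp [hz t ht.le, hv0]
  · push Not at hc
    have hm : AntitoneOn (fun t => Real.exp (2 * μ * t) * (v t * v t)) (Set.Ici T) := by
      refine antitoneOn_exp_mul (2 * μ) (convex_Ici T) (fun t _ => (hv t).fun_mul (hv t)) ?_
      intro t ht
      nlinarith [mul_pos (hT t ht) (neg_pos.2 (hc t ht))]
    set C := Real.exp (μ * T) * |v T| with hC
    have hvb : ∀ t ∈ Set.Ici T, |Real.exp (μ * t) * v t| ≤ C := by
      intro t ht
      have h1 := hm Set.self_mem_Ici ht ht
      simp only at h1
      refine abs_le_of_sq_le_sq ?_ (by positivity)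
      rw [hC, mul_pow, mul_pow, sq_abs, ← Real.exp_nat_mul, ← Real.exp_nat_mul]
      convert h1 using 2 <;> [(congr 1; push_cast; ring); ring; (congr 1; push_cast; ring); ring]
    have hE : ∀ t, HasDerivAt (fun t => C / μ * Real.exp (-(μ * t))) (-(C * Real.exp (-(μ * t)))) t := by
      intro t
      have h1 : HasDerivAt (fun t : ℝ => Real.exp (-(μ * t))) (Real.exp (-(μ * t)) * -μ) t := by
        simpa using ((hasDerivAt_id t).const_mul μ).neg.exp
      exact (h1.const_mul (C / μ)).congr_deriv (by field_simp)
    have hElim : Tendsto (fun t => C / μ * Real.exp (-(μ * t))) atTop (𝓝 0) := by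
      have : Tendsto (fun t : ℝ => Real.exp (-(μ * t))) atTop (𝓝 0) :=
        Real.tendsto_exp_neg_atTop_nhds_zero.comp (tendsto_id.const_mul_atTop hμ)
      simpa using this.const_mul (C / μ)
    have hvb' : ∀ t ∈ Set.Ici T, |v t| ≤ C * Real.exp (-(μ * t)) := by
      intro t ht
      have := hvb t ht
      rw [abs_mul, abs_of_pos (Real.exp_pos _)] at this
      rw [Real.exp_neg, ← div_eq_mul_inv, le_div_iff₀ (Real.exp_pos _)]
      linarith
    have key : ∀ t ∈ Set.Ici T, |x t| ≤ C / μ * Real.exp (-(μ * t)) := by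
      have h1 : AntitoneOn (fun t => x t + C / μ * Real.exp (-(μ * t))) (Set.Ici T) := by
        refine antitoneOn_of_hasDerivAt (convex_Ici T) (fun t _ => (hx t).fun_add (hE t)) ?_
        intro t ht
        have := (abs_le.1 (hvb' t ht)).2
        linarith
      have h2 : MonotoneOn (fun t => x t - C / μ * Real.exp (-(μ * t))) (Set.Ici T) := by
        refine monotoneOn_of_hasDerivAt (convex_Ici T) (fun t _ => (hx t).fun_sub (hE t)) ?_
        intro t ht
        have := (abs_le.1 (hvb' t ht)).1
        linarith
      have l1 := hx0.add hElim
      have l2 := hx0.sub hElim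
      intro t ht
      rw [abs_le]
      constructor
      · have : (0:ℝ) + 0 ≤ x t + C / μ * Real.exp (-(μ * t)) := by
          refine le_of_tendsto l1 ?_
          filter_upwards [eventually_ge_atTop t] with s hs
          exact h1 ht (le_trans ht hs) hs
        linarith
      · have : x t - C / μ * Real.exp (-(μ * t)) ≤ (0:ℝ) - 0 := by
          refine ge_of_tendsto l2 ?_
          filter_upwards [eventually_ge_atTop t] with s hs
          exact h2 ht (le_trans ht hs) hs
        linarith
    refine ⟨max C (C / μ), ?_⟩
    filter_upwards [eventually_ge_atTop T] with t ht
    refine ⟨le_max_of_le_right ?_, le_max_of_le_left (hvb t ht)⟩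
    have := key t ht
    rw [abs_mul, abs_of_pos (Real.exp_pos _), mul_comm]
    rwa [Real.exp_neg, ← div_eq_mul_inv, le_div_iff₀ (Real.exp_pos _)] at this

lemma eq_const_of_antitone_of_tendsto {f : ℝ → ℝ} {c : ℝ} (hf : Antitone f)
    (h1 : Tendsto f atTop (𝓝 c)) (h2 : Tendsto f atBot (𝓝 c)) (t : ℝ) : f t = c :=
  le_antisymm (hf.ge_of_tendsto h2 t) (hf.le_of_tendsto h1 t)

lemma deriv_eq_zero_of_forall_eq {f f' : ℝ → ℝ} {c : ℝ} (h : ∀ t, HasDerivAt f (f' t) t)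
    (hc : ∀ t, f t = c) (t : ℝ) : f' t = 0 := by
  have : f = fun _ => c := funext hc
  exact (this ▸ h t).unique (hasDerivAt_const t c)

/-- The Lorenz system in the coordinates `x`, `v = x'`, `w = z - x² / (2σ)`. -/
lemma reduced_orbit_trivial_of_lt {σ b r : ℝ} {x v w : ℝ → ℝ} (hσ : 0 < σ) (hb : 0 < b)
    (h2 : 2 * σ < b)
    (hx : ∀ t, HasDerivAt x (v t) t)
    (hv : ∀ t, HasDerivAt v
      (-(σ + 1) * v t + (σ * (r - 1) - x t ^ 2 / 2 - σ * w t) * x t) t)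
    (hw : ∀ t, HasDerivAt w (-b * w t + (1 - b / (2 * σ)) * x t ^ 2) t)
    (hxT : Tendsto x atTop (𝓝 0)) (hvT : Tendsto v atTop (𝓝 0)) (hwT : Tendsto w atTop (𝓝 0))
    (hxB : Tendsto x atBot (𝓝 0)) (hvB : Tendsto v atBot (𝓝 0)) (hwB : Tendsto w atBot (𝓝 0)) :
    ∀ t, x t = 0 ∧ v t = 0 ∧ w t = 0 := by
  set c := 1 - b / (2 * σ) with hc
  have hcneg : c < 0 := by
    rw [hc, sub_neg, lt_div_iff₀ (by positivity)]; linarith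
  set k := -(σ * b) / (2 * c) with hk
  have hkpos : 0 < k := div_pos_of_neg_of_neg (by nlinarith) (by linarith)
  have hcne := hcneg.ne
  obtain ⟨d, hd⟩ : ∃ d, d = c / b := ⟨_, rfl⟩
  obtain ⟨s, hs⟩ : ∃ s, s = σ / b := ⟨_, rfl⟩
  have hdb : c = d * b := by rw [hd]; field_simp
  have hsb : s * b = σ := by rw [hs]; field_simp
  have hkd : k * d = -σ / 2 := by rw [hk, hd]; field_simp
  have hσd : σ * d = s - 1 / 2 := by rw [hd, hs, hc]; field_simp
  have hs4 : σ / (4 * b) = s / 4 := by rw [hs]; field_simp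
  let L : ℝ → ℝ := fun t => v t ^ 2 / 2 + σ / (4 * b) * (x t ^ 2 - b * (r - 1)) ^ 2
    + k / 2 * (w t - c / b * x t ^ 2) ^ 2
  have hL : ∀ t, HasDerivAt L (-(σ + 1) * v t ^ 2 - k * b * (w t - c / b * x t ^ 2) ^ 2) t := by
    intro t
    have d1 := ((hv t).fun_pow 2).div_const 2
    have d2 := ((((hx t).fun_pow 2).sub_const (b * (r - 1))).fun_pow 2).const_mul (σ / (4 * b))
    have d3 := (((hw t).fun_sub (((hx t).fun_pow 2).const_mul (c / b))).fun_pow 2).const_mul (k / 2)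
    refine ((d1.fun_add d2).fun_add d3).congr_deriv ?_
    rw [← hd, hs4]
    push_cast
    linear_combination (-(r - 1) * x t * v t) * hsb + (-2 * x t * v t * w t + 2 * d * x t ^ 3 * v t) * hkd
      - x t ^ 3 * v t * hσd + k * (w t - d * x t ^ 2) * x t ^ 2 * hdb
  have hlim : ∀ l : Filter ℝ, Tendsto x l (𝓝 0) → Tendsto v l (𝓝 0) → Tendsto w l (𝓝 0) →
      Tendsto L l (𝓝 (σ / (4 * b) * (b * (r - 1)) ^ 2)) := by
    intro l h1 h2 h3
    have := (((h2.pow 2).div_const 2).add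
      ((((h1.pow 2).sub_const (b * (r - 1))).pow 2).const_mul (σ / (4 * b)))).add
      (((h3.sub ((h1.pow 2).const_mul (c / b))).pow 2).const_mul (k / 2))
    convert this using 2
    ring
  have hanti : Antitone L := by
    rw [← antitoneOn_univ]
    refine antitoneOn_of_hasDerivAt convex_univ (fun t _ => hL t) (fun t _ => ?_)
    have : 0 ≤ k * b * (w t - c / b * x t ^ 2) ^ 2 := by positivity
    nlinarith [sq_nonneg (v t)]
  have hzero := deriv_eq_zero_of_forall_eq hL
    (eq_const_of_antitone_of_tendsto hanti (hlim _ hxT hvT hwT) (hlim _ hxB hvB hwB))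
  have hvz : ∀ t, v t = 0 := by
    intro t
    have h1 := hzero t
    have h3 : 0 ≤ k * b * (w t - c / b * x t ^ 2) ^ 2 := by positivity
    have : v t ^ 2 = 0 := by nlinarith [sq_nonneg (v t)]
    exact pow_eq_zero_iff (two_ne_zero) |>.1 this
  have hxz : ∀ t, x t = 0 := by
    have hxa : Antitone x := by
      rw [← antitoneOn_univ]
      exact antitoneOn_of_hasDerivAt convex_univ (fun t _ => hx t) (fun t _ => (hvz t).le)
    exact eq_const_of_antitone_of_tendsto hxa hxT hxB
  intro t
  refine ⟨hxz t, hvz t, ?_⟩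
  have h1 := hzero t
  rw [hvz, hxz] at h1
  have : k * b * w t ^ 2 = 0 := by linear_combination -h1
  have : w t ^ 2 = 0 := by
    rcases mul_eq_zero.1 this with h | h
    · exact absurd h (by positivity)
    · exact h
  exact pow_eq_zero_iff (two_ne_zero) |>.1 this

lemma reduced_orbit_trivial_of_ge {σ b r : ℝ} {x v w : ℝ → ℝ} (hσ : 0 < σ) (hb : 0 < b)
    (hr : 1 < r) (h2 : b ≤ 2 * σ) (h3 : 3 * σ ≤ 2 * b + 1)
    (hx : ∀ t, HasDerivAt x (v t) t)
    (hv : ∀ t, HasDerivAt v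
      (-(σ + 1) * v t + (σ * (r - 1) - x t ^ 2 / 2 - σ * w t) * x t) t)
    (hw : ∀ t, HasDerivAt w (-b * w t + (1 - b / (2 * σ)) * x t ^ 2) t)
    (hxT : Tendsto x atTop (𝓝 0)) (hvT : Tendsto v atTop (𝓝 0)) (hwT : Tendsto w atTop (𝓝 0))
    (hxB : Tendsto x atBot (𝓝 0)) (hvB : Tendsto v atBot (𝓝 0)) (hwB : Tendsto w atBot (𝓝 0)) :
    ∀ t, x t = 0 ∧ v t = 0 ∧ w t = 0 := by
  set c := 1 - b / (2 * σ) with hc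
  have hcσ : σ * c = σ - b / 2 := by rw [hc]; field_simp
  have hc0 : 0 ≤ c := by
    rw [hc, sub_nonneg, div_le_one (by positivity)]; exact h2
  have hexpB : ∀ k : ℝ, 0 < k → ∀ f : ℝ → ℝ, Tendsto f atBot (𝓝 0) →
      Tendsto (fun t => Real.exp (k * t) * f t) atBot (𝓝 0) := by
    intro k hk f hf
    have : Tendsto (fun t : ℝ => Real.exp (k * t)) atBot (𝓝 0) :=
      Real.tendsto_exp_atBot.comp (tendsto_id.const_mul_atBot hk)
    simpa using this.mul hf
  have hwm : Monotone (fun t => Real.exp (b * t) * w t) := by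
    rw [← monotoneOn_univ]
    refine monotoneOn_exp_mul b convex_univ (fun t _ => hw t) (fun t _ => ?_)
    nlinarith [mul_nonneg hc0 (sq_nonneg (x t))]
  have hw0 : ∀ t, 0 ≤ w t := by
    intro t
    have := hwm.le_of_tendsto (hexpB b hb w hwB) t
    exact nonneg_of_mul_nonneg_right this (Real.exp_pos _)
  let j : ℝ → ℝ := fun t => v t ^ 2 / 2 - σ * (r - 1) / 2 * x t ^ 2 + x t ^ 4 / 8
    + σ / 2 * (w t * x t ^ 2) + (σ + 1) / 2 * (x t * v t)
  have hj : ∀ t, HasDerivAt j (-(σ + 1) * j t +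
      x t ^ 2 * ((3 * σ - 2 * b - 1) / 8 * x t ^ 2 - σ * b / 2 * w t)) t := by
    intro t
    have d1 := ((hv t).fun_pow 2).div_const 2
    have d2 := ((hx t).fun_pow 2).const_mul (σ * (r - 1) / 2)
    have d3 := ((hx t).fun_pow 4).div_const 8
    have d4 := ((hw t).fun_mul ((hx t).fun_pow 2)).const_mul (σ / 2)
    have d5 := ((hx t).fun_mul (hv t)).const_mul ((σ + 1) / 2)
    refine ((((d1.fun_sub d2).fun_add d3).fun_add d4).fun_add d5).congr_deriv ?_
    simp only [j]
    push_cast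
    linear_combination (x t ^ 4 / 2) * hcσ
  have hsign : ∀ t, x t ^ 2 * ((3 * σ - 2 * b - 1) / 8 * x t ^ 2 - σ * b / 2 * w t) ≤ 0 := by
    intro t
    have e1 : 0 ≤ σ * b / 2 * w t := mul_nonneg (by positivity) (hw0 t)
    have e2 : (3 * σ - 2 * b - 1) / 8 * x t ^ 2 ≤ 0 :=
      mul_nonpos_of_nonpos_of_nonneg (by linarith) (sq_nonneg _)
    exact mul_nonpos_of_nonneg_of_nonpos (sq_nonneg _) (by linarith)
  have hjm : Antitone (fun t => Real.exp ((σ + 1) * t) * j t) := by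
    rw [← antitoneOn_univ]
    refine antitoneOn_exp_mul (σ + 1) convex_univ (fun t _ => hj t) (fun t _ => ?_)
    have := hsign t
    linarith
  have hjB : Tendsto (fun t => Real.exp ((σ + 1) * t) * j t) atBot (𝓝 0) := by
    refine hexpB _ (by linarith) j ?_
    have := (((((hvB.pow 2).div_const 2).sub ((hxB.pow 2).const_mul (σ * (r - 1) / 2))).add
      ((hxB.pow 4).div_const 8)).add ((hwB.mul (hxB.pow 2)).const_mul (σ / 2))).add
      ((hxB.mul hvB).const_mul ((σ + 1) / 2))
    simpa using this
  have hjT : Tendsto (fun t => Real.exp ((σ + 1) * t) * j t) atTop (𝓝 0) := by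
    have hg : Tendsto (fun t => σ * (r - 1) - x t ^ 2 / 2 - σ * w t) atTop
        (𝓝 (σ * (r - 1) - 0 ^ 2 / 2 - σ * 0)) :=
      (((hxT.pow 2).div_const 2).const_sub _).sub (hwT.const_mul σ)
    have hgpos : ∀ᶠ t in atTop, 0 < σ * (r - 1) - x t ^ 2 / 2 - σ * w t := by
      refine hg.eventually (lt_mem_nhds ?_)
      have : 0 < σ * (r - 1) := mul_pos hσ (by linarith)
      linarith
    obtain ⟨C, hC⟩ := exp_mul_decay (by linarith) hx hv hgpos hxT
    have b1 : IsBoundedUnder (· ≤ ·) atTop (norm ∘ fun t => Real.exp ((σ + 1) * t) * x t) :=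
      ⟨C, eventually_map.2 (hC.mono fun t ht => ht.1)⟩
    have b2 : IsBoundedUnder (· ≤ ·) atTop (norm ∘ fun t => Real.exp ((σ + 1) * t) * v t) :=
      ⟨C, eventually_map.2 (hC.mono fun t ht => ht.2)⟩
    have t1 : Tendsto (fun t => -(σ * (r - 1) / 2) * x t + x t ^ 3 / 8
        + σ / 2 * (w t * x t) + (σ + 1) / 2 * v t) atTop (𝓝 0) := by
      have := (((hxT.const_mul (-(σ * (r - 1) / 2))).add ((hxT.pow 3).div_const 8)).add
        ((hwT.mul hxT).const_mul (σ / 2))).add (hvT.const_mul ((σ + 1) / 2))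
      simpa using this
    have t2 : Tendsto (fun t => v t / 2) atTop (𝓝 0) := by simpa using hvT.div_const 2
    have := (isBoundedUnder_le_mul_tendsto_zero b1 t1).add
      (isBoundedUnder_le_mul_tendsto_zero b2 t2)
    rw [add_zero] at this
    refine this.congr fun t => ?_
    simp only [j]
    ring
  have hjz : ∀ t, j t = 0 := by
    intro t
    have := eq_const_of_antitone_of_tendsto hjm hjT hjB t
    exact (mul_eq_zero.1 this).resolve_left (Real.exp_pos _).ne'
  have hD : ∀ t, x t ^ 2 * ((3 * σ - 2 * b - 1) / 8 * x t ^ 2 - σ * b / 2 * w t) = 0 := by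
    intro t
    have := deriv_eq_zero_of_forall_eq hj hjz t
    rwa [hjz, mul_zero, zero_add] at this
  have hxz : ∀ t, x t = 0 := by
    intro t
    by_contra hxt
    have e0 : 0 < x t ^ 2 := by positivity
    have e1 := (mul_eq_zero.1 (hD t)).resolve_left e0.ne'
    have e2 : 0 ≤ σ * b / 2 * w t := mul_nonneg (by positivity) (hw0 t)
    rcases h3.lt_or_eq with h | h
    · nlinarith [mul_pos (sub_pos.2 h) e0]
    · have e3 : w t = 0 := by
        have : σ * b / 2 * w t = 0 := by
          rw [h] at e1
          linarith
        exact (mul_eq_zero.1 this).resolve_left (by positivity)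
      have hcpos : 0 < c := by
        have : 0 < σ * c := by rw [hcσ]; linarith
        exact pos_of_mul_pos_right this hσ.le
      have e4 : ∀ s ≤ t, w s = 0 := by
        intro s hs
        have h5 : Real.exp (b * s) * w s ≤ Real.exp (b * t) * w t := hwm hs
        rw [e3, mul_zero] at h5
        refine le_antisymm ?_ (hw0 s)
        exact nonpos_of_mul_nonpos_right h5 (Real.exp_pos _)
      have e5 : ∀ s < t, x s = 0 := by
        intro s hs
        have : w =ᶠ[𝓝 s] fun _ => 0 := by
          filter_upwards [Iio_mem_nhds hs] with q hq
          exact e4 q (Set.mem_Iio.1 hq).le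
        have h6 := ((hw s).congr_of_eventuallyEq this.symm).unique (hasDerivAt_const s (0 : ℝ))
        rw [e4 s hs.le, mul_zero, zero_add] at h6
        exact pow_eq_zero_iff two_ne_zero |>.1 ((mul_eq_zero.1 h6).resolve_left hcpos.ne')
      have e6 : Tendsto x (𝓝[<] t) (𝓝 (x t)) := (hx t).continuousAt.continuousWithinAt
      have e7 : Tendsto x (𝓝[<] t) (𝓝 0) := by
        refine tendsto_const_nhds.congr' ?_
        filter_upwards [self_mem_nhdsWithin] with s hs
        exact (e5 s hs).symm
      exact hxt (tendsto_nhds_unique e6 e7)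
  have hvz := deriv_eq_zero_of_forall_eq hx hxz
  have hwz : ∀ t, w t = 0 := by
    have hwa : Antitone (fun t => Real.exp (b * t) * w t) := by
      rw [← antitoneOn_univ]
      refine antitoneOn_exp_mul b convex_univ (fun t _ => hw t) (fun t _ => ?_)
      simp [hxz t]
    intro t
    have := hwa.ge_of_tendsto (hexpB b hb w hwB) t
    exact le_antisymm (nonpos_of_mul_nonpos_right this (Real.exp_pos _)) (hw0 t)
  exact fun t => ⟨hxz t, hvz t, hwz t⟩

theorem no_homoclinic_of_le {σ b r : ℝ} {u : ℝ → ℝ × ℝ × ℝ} (hσ : 0 < σ) (hb : 0 < b)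
    (hr : 1 < r) (h3 : 3 * σ ≤ 2 * b + 1)
    (hu : ∀ t : ℝ, HasDerivAt u
        (-σ * ((u t).1 - (u t).2.1),
         r * (u t).1 - (u t).2.1 - (u t).1 * (u t).2.2,
         -b * (u t).2.2 + (u t).1 * (u t).2.1) t)
    (hT : Tendsto u atTop (𝓝 ((0, 0, 0) : ℝ × ℝ × ℝ)))
    (hB : Tendsto u atBot (𝓝 ((0, 0, 0) : ℝ × ℝ × ℝ))) (t : ℝ) : u t = (0, 0, 0) := by
  have hx : ∀ t, HasDerivAt (fun t => (u t).1) (-σ * ((u t).1 - (u t).2.1)) t :=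
    fun t => (hu t).fst
  have hy : ∀ t, HasDerivAt (fun t => (u t).2.1) _ t := fun t => (hu t).snd.fst
  have hz : ∀ t, HasDerivAt (fun t => (u t).2.2) _ t := fun t => (hu t).snd.snd
  let v : ℝ → ℝ := fun t => -σ * ((u t).1 - (u t).2.1)
  let w : ℝ → ℝ := fun t => (u t).2.2 - (u t).1 ^ 2 / (2 * σ)
  have hv : ∀ t, HasDerivAt v (-(σ + 1) * v t
      + (σ * (r - 1) - (u t).1 ^ 2 / 2 - σ * w t) * (u t).1) t := by
    intro t
    refine (((hx t).fun_sub (hy t)).const_mul (-σ)).congr_deriv ?_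
    simp only [v, w]
    field_simp
    ring
  have hw : ∀ t, HasDerivAt w (-b * w t + (1 - b / (2 * σ)) * (u t).1 ^ 2) t := by
    intro t
    refine ((hz t).fun_sub (((hx t).fun_pow 2).div_const (2 * σ))).congr_deriv ?_
    simp only [w]
    field_simp
    push_cast
    ring
  have hlim : ∀ l : Filter ℝ, Tendsto u l (𝓝 ((0, 0, 0) : ℝ × ℝ × ℝ)) →
      Tendsto (fun t => (u t).1) l (𝓝 0) ∧ Tendsto v l (𝓝 0) ∧ Tendsto w l (𝓝 0) := by
    intro l hl
    have l1 : Tendsto (fun t => (u t).1) l (𝓝 0) := (continuous_fst.tendsto _).comp hl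
    have l2 : Tendsto (fun t => (u t).2.1) l (𝓝 0) :=
      ((continuous_fst.comp continuous_snd).tendsto ((0, 0, 0) : ℝ × ℝ × ℝ)).comp hl
    have l3 : Tendsto (fun t => (u t).2.2) l (𝓝 0) :=
      ((continuous_snd.comp continuous_snd).tendsto ((0, 0, 0) : ℝ × ℝ × ℝ)).comp hl
    refine ⟨l1, ?_, ?_⟩
    · simpa [v] using (l1.sub l2).const_mul (-σ)
    · simpa [w] using l3.sub ((l1.pow 2).div_const (2 * σ))
  obtain ⟨T1, T2, T3⟩ := hlim _ hT
  obtain ⟨B1, B2, B3⟩ := hlim _ hB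
  have key : (u t).1 = 0 ∧ v t = 0 ∧ w t = 0 := by
    rcases lt_or_ge (2 * σ) b with h | h
    · exact reduced_orbit_trivial_of_lt hσ hb h hx hv hw T1 T2 T3 B1 B2 B3 t
    · exact reduced_orbit_trivial_of_ge hσ hb hr h h3 hx hv hw T1 T2 T3 B1 B2 B3 t
  obtain ⟨k1, k2, k3⟩ := key
  simp only [v, w, k1] at k2 k3
  have k4 : (u t).2.1 = 0 := by
    have : σ * (u t).2.1 = 0 := by linarith
    exact (mul_eq_zero.1 this).resolve_left hσ.ne'
  have k5 : (u t).2.2 = 0 := by simpa using k3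
  ext <;> simp [k1, k4, k5]

section Flow

variable {E : Type*} [NormedAddCommGroup E] [NormedSpace ℝ E]

lemma trajectory_dist_le_forward {F : E → E} {K : NNReal} (hF : LipschitzWith K F) {u w : ℝ → E}
    (hu : ∀ t, HasDerivAt u (F (u t)) t) (hw : ∀ t, HasDerivAt w (F (w t)) t) {t : ℝ}
    (ht : 0 ≤ t) : dist (u t) (w t) ≤ dist (u 0) (w 0) * Real.exp (K * t) := by
  have := dist_le_of_trajectories_ODE (v := fun _ => F) (a := 0) (b := t) (fun _ => hF)
    (fun s _ => (hu s).continuousAt.continuousWithinAt) (fun s _ => (hu s).hasDerivWithinAt)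
    (fun s _ => (hw s).continuousAt.continuousWithinAt) (fun s _ => (hw s).hasDerivWithinAt)
    le_rfl t ⟨ht, le_rfl⟩
  simpa using this

lemma hasDerivAt_reverse {u : ℝ → E} {F : E → E} (hu : ∀ t, HasDerivAt u (F (u t)) t) (t : ℝ) :
    HasDerivAt (fun t => u (-t)) (-F (u (-t))) t := by
  simpa [Function.comp_def] using (hu (-t)).scomp t (hasDerivAt_neg t)

lemma trajectory_dist_le {F : E → E} {K : NNReal} (hF : LipschitzWith K F) {u w : ℝ → E}
    (hu : ∀ t, HasDerivAt u (F (u t)) t) (hw : ∀ t, HasDerivAt w (F (w t)) t) (t : ℝ) :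
    dist (u t) (w t) ≤ dist (u 0) (w 0) * Real.exp (K * |t|) := by
  rcases le_total 0 t with ht | ht
  · rw [abs_of_nonneg ht]
    exact trajectory_dist_le_forward hF hu hw ht
  · rw [abs_of_nonpos ht]
    have := trajectory_dist_le_forward (F := fun p => -F p) hF.neg (hasDerivAt_reverse hu)
      (hasDerivAt_reverse hw) (neg_nonneg.2 ht)
    simpa using this

lemma exists_global_trajectory [CompleteSpace E] {F : E → E} {K : NNReal} (hF : LipschitzWith K F)
    {C : ℝ} (hC : ∀ p, ‖F p‖ ≤ C) (p : E) :
    ∃ u : ℝ → E, u 0 = p ∧ ∀ t, HasDerivAt u (F (u t)) t := by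
  have hloc : ∀ n : ℝ, ∃ u : ℝ → E, 0 < n →
      u 0 = p ∧ ∀ t ∈ Set.Ioo (-n) n, HasDerivAt u (F (u t)) t := by
    intro n
    by_cases hn : 0 < n
    swap
    · exact ⟨fun _ => p, fun h => absurd h hn⟩
    have hC0 : 0 ≤ C := (norm_nonneg _).trans (hC p)
    have hP : IsPicardLindelof (fun _ => F)
        (⟨0, by constructor <;> linarith⟩ : Set.Icc (-n) n) p (⟨C * n, by positivity⟩) 0
        (⟨C, hC0⟩) K := by
      refine IsPicardLindelof.of_time_independent (fun x _ => hC x) hF.lipschitzOnWith ?_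
      simp only [sub_zero, zero_sub, neg_neg, max_self, NNReal.coe_zero]
      exact le_rfl
    obtain ⟨u, hu0, hu⟩ := hP.exists_eq_forall_mem_Icc_hasDerivWithinAt₀
    exact ⟨u, fun _ => ⟨hu0, fun t ht => (hu t (Set.Ioo_subset_Icc_self ht)).hasDerivAt
      (Icc_mem_nhds ht.1 ht.2)⟩⟩
  choose γ hγ using hloc
  have hagree : ∀ n m : ℝ, 0 < n → n ≤ m → Set.EqOn (γ n) (γ m) (Set.Ioo (-n) n) := by
    intro n m hn hnm
    refine ODE_solution_unique_of_mem_Ioo (v := fun _ => F) (s := fun _ => Set.univ) (K := K)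
      (t₀ := 0) (fun t _ => hF.lipschitzOnWith) ⟨by linarith, hn⟩
      (fun t ht => ⟨(hγ n hn).2 t ht, trivial⟩) (fun t ht => ⟨(hγ m (hn.trans_le hnm)).2 t
        ⟨by linarith [ht.1], by linarith [ht.2]⟩, trivial⟩) ?_
    rw [(hγ n hn).1, (hγ m (hn.trans_le hnm)).1]
  refine ⟨fun t => γ (|t| + 1) t, ?_, fun t => ?_⟩
  · simpa using (hγ 1 one_pos).1
  · have hpos : 0 < |t| + 2 := by positivity
    have hd := (hγ (|t| + 2) hpos).2 t ⟨by linarith [neg_abs_le t], by linarith [le_abs_self t]⟩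
    have he : ∀ s, |s| < |t| + 1 → γ (|s| + 1) s = γ (|t| + 2) s := by
      intro s hs
      exact hagree (|s| + 1) (|t| + 2) (by positivity) (by linarith)
        ⟨by linarith [neg_abs_le s], by linarith [le_abs_self s]⟩
    have he' : (fun s => γ (|s| + 1) s) =ᶠ[𝓝 t] γ (|t| + 2) := by
      have : {s : ℝ | |s| < |t| + 1} ∈ 𝓝 t :=
        (isOpen_lt continuous_abs continuous_const).mem_nhds (by simp)
      filter_upwards [this] with s hs using he s hs
    have := hd.congr_of_eventuallyEq he'
    rwa [← he t (by linarith)] at this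

/-- The complete flow of a bounded Lipschitz vector field. -/
lemma exists_flow [CompleteSpace E] {F : E → E} {K : NNReal} (hF : LipschitzWith K F)
    {C : ℝ} (hC : ∀ p, ‖F p‖ ≤ C) :
    ∃ Φ : E → ℝ → E, (∀ p, Φ p 0 = p) ∧ (∀ p t, HasDerivAt (Φ p) (F (Φ p t)) t) ∧
      (∀ p q t, dist (Φ p t) (Φ q t) ≤ dist p q * Real.exp (K * |t|)) ∧
      Continuous (fun z : E × ℝ => Φ z.1 z.2) ∧
      (∀ p s t, Φ (Φ p s) t = Φ p (s + t)) ∧ (∀ p, F p = 0 → ∀ t, Φ p t = p) := by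
  choose Φ h0 hd using exists_global_trajectory hF hC
  have hdist : ∀ p q t, dist (Φ p t) (Φ q t) ≤ dist p q * Real.exp (K * |t|) := by
    intro p q t
    simpa [h0] using trajectory_dist_le hF (hd p) (hd q) t
  have huniq : ∀ (p : E) (u : ℝ → E), u 0 = p → (∀ t, HasDerivAt u (F (u t)) t) →
      ∀ t, Φ p t = u t := by
    intro p u hu hu' t
    have := trajectory_dist_le hF (hd p) hu' t
    rw [h0, hu, dist_self, zero_mul] at this
    exact dist_le_zero.1 this
  refine ⟨Φ, h0, hd, hdist, ?_, ?_, ?_⟩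
  · rw [continuous_iff_continuousAt]
    rintro ⟨p, t⟩
    rw [ContinuousAt, tendsto_iff_dist_tendsto_zero]
    have h1 : Tendsto (fun z : E × ℝ => dist z.1 p * Real.exp (K * |z.2|) + dist (Φ p z.2) (Φ p t))
        (𝓝 (p, t)) (𝓝 (dist p p * Real.exp (K * |t|) + dist (Φ p t) (Φ p t))) := by
      have hc : ContinuousAt (fun z : E × ℝ => Φ p z.2) (p, t) :=
        ContinuousAt.comp (f := fun z : E × ℝ => z.2) (hd p t).continuousAt continuousAt_snd
      have hc2 : ContinuousAt (fun z : E × ℝ => dist z.1 p * Real.exp (K * |z.2|)) (p, t) := by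
        fun_prop
      exact hc2.add (hc.dist continuousAt_const)
    simp only [dist_self, zero_mul, add_zero] at h1
    refine squeeze_zero (fun _ => dist_nonneg) (fun z => ?_) h1
    exact (dist_triangle _ (Φ p z.2) _).trans (add_le_add (hdist _ _ _) le_rfl)
  · intro p s t
    refine huniq (Φ p s) (fun t => Φ p (s + t)) (by simp) (fun t => ?_) t
    simpa using (hd p (s + t)).comp_const_add s t
  · intro p hp t
    exact huniq p (fun _ => p) rfl (fun t => by simpa [hp] using hasDerivAt_const t p) t

end Flow

lemma exists_first_zero {h : ℝ → ℝ} {a t : ℝ} (hat : a ≤ t) (hc : ContinuousOn h (Set.Icc a t))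
    (ha : 0 < h a) (ht : h t ≤ 0) :
    ∃ s, a < s ∧ s ≤ t ∧ h s = 0 ∧ ∀ r, a ≤ r → r < s → 0 < h r := by
  have hcl : IsClosed (Set.Icc a t ∩ h ⁻¹' Set.Iic 0) :=
    hc.preimage_isClosed_of_isClosed isClosed_Icc isClosed_Iic
  have hK : IsCompact (Set.Icc a t ∩ h ⁻¹' Set.Iic 0) :=
    isCompact_Icc.of_isClosed_subset hcl Set.inter_subset_left
  obtain ⟨s, ⟨hs, hs0⟩, hleast⟩ := hK.exists_isLeast ⟨t, ⟨hat, le_rfl⟩, ht⟩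
  have hpos : ∀ r, a ≤ r → r < s → 0 < h r := by
    intro r hr hrs
    by_contra hn
    exact absurd (hleast ⟨⟨hr, hrs.le.trans hs.2⟩, not_lt.1 hn⟩) (not_le.2 hrs)
  have has : a < s := by
    rcases hs.1.lt_or_eq with h1 | h1
    · exact h1
    · rw [← h1] at hs0
      exact absurd hs0 (not_le.2 ha)
  refine ⟨s, has, hs.2, le_antisymm hs0 ?_, hpos⟩
  have hcs : Tendsto h (𝓝[Set.Ico a s] s) (𝓝 (h s)) :=
    (hc s hs).mono_left (nhdsWithin_mono _ fun r hr => ⟨hr.1, hr.2.le.trans hs.2⟩)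
  have : (𝓝[Set.Ico a s] s).NeBot := by
    rw [nhdsWithin_Ico_eq_nhdsLT has]
    infer_instance
  refine ge_of_tendsto hcs ?_
  filter_upwards [self_mem_nhdsWithin] with r hr using (hpos r hr.1 hr.2).le

lemma exists_last_zero {h : ℝ → ℝ} {a t : ℝ} (hat : a ≤ t) (hc : ContinuousOn h (Set.Icc a t))
    (ha : h a ≤ 0) (ht : 0 < h t) :
    ∃ s, a ≤ s ∧ s < t ∧ h s = 0 ∧ ∀ r, s < r → r ≤ t → 0 < h r := by
  obtain ⟨s, h1, h2, h3, h4⟩ := exists_first_zero (h := fun r => h (-r)) (a := -t) (t := -a)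
    (by linarith) (hc.comp continuous_neg.continuousOn
      fun r hr => ⟨by linarith [hr.2], by linarith [hr.1]⟩) (by simpa using ht) (by simpa using ha)
  refine ⟨-s, by linarith, by linarith, h3, fun r hr hrt => ?_⟩
  simpa using h4 (-r) (by linarith) (by linarith)

lemma nonpos_of_deriv_nonpos_of_pos {h h' : ℝ → ℝ} {a : ℝ}
    (hd : ∀ t ≥ a, HasDerivAt h (h' t) t) (h0 : h a ≤ 0) (hk : ∀ t ≥ a, 0 < h t → h' t ≤ 0)
    {t : ℝ} (ht : a ≤ t) : h t ≤ 0 := by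
  by_contra hn
  obtain ⟨s, h1, h2, h3, h4⟩ := exists_last_zero ht
    (fun r hr => (hd r hr.1).continuousAt.continuousWithinAt) h0 (not_le.1 hn)
  have hanti : AntitoneOn h (Set.Icc s t) := by
    refine antitoneOn_of_deriv_nonpos (convex_Icc s t)
      (fun r hr => (hd r (h1.trans hr.1)).continuousAt.continuousWithinAt) ?_ ?_
    · intro r hr
      rw [interior_Icc] at hr
      exact (hd r (h1.trans hr.1.le)).differentiableAt.differentiableWithinAt
    · intro r hr
      rw [interior_Icc] at hr
      rw [(hd r (h1.trans hr.1.le)).deriv]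
      exact hk r (h1.trans hr.1.le) (h4 r hr.1 hr.2.le)
  have := hanti ⟨le_rfl, h2.le⟩ ⟨h2.le, le_rfl⟩ h2.le
  linarith

/-- `X`, `V`, `W` solve the rescaled Lorenz system with parameter `e` at all times in `I`. -/
structure ScaledSol (μ κ b e : ℝ) (X V W : ℝ → ℝ) (I : Set ℝ) : Prop where
  hX : ∀ t ∈ I, HasDerivAt X (V t) t
  hV : ∀ t ∈ I, HasDerivAt V (-(e * μ) * V t + (1 + e * μ - X t ^ 2 - W t) * X t) t
  hW : ∀ t ∈ I, HasDerivAt W (e * (κ * X t ^ 2 - b * W t)) t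

lemma ScaledSol.mono {μ κ b e : ℝ} {X V W : ℝ → ℝ} {I I' : Set ℝ}
    (h : ScaledSol μ κ b e X V W I) (hI : I' ⊆ I) : ScaledSol μ κ b e X V W I' :=
  ⟨fun t ht => h.hX t (hI ht), fun t ht => h.hV t (hI ht), fun t ht => h.hW t (hI ht)⟩

/-- The extended phase space: three coordinates and the parameter. -/
abbrev ScaledState := ℝ × ℝ × ℝ × ℝ

/-- The rescaled Lorenz vector field on the extended phase space. -/
def scaledField (μ κ b : ℝ) (p : ScaledState) : ScaledState :=
  (p.2.1, -(p.2.2.2 * μ) * p.2.1 + (1 + p.2.2.2 * μ - p.1 ^ 2 - p.2.2.1) * p.1,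
    p.2.2.2 * (κ * p.1 ^ 2 - b * p.2.2.1), 0)

lemma exists_cutoff_flow (μ κ b R : ℝ) :
    ∃ (Φ : ScaledState → ℝ → ScaledState) (K : ℝ) (χ : ScaledState → ℝ), 0 ≤ K ∧
      (∀ p, Φ p 0 = p) ∧ (∀ p t, HasDerivAt (Φ p) (χ (Φ p t) • scaledField μ κ b (Φ p t)) t) ∧
      (∀ p q t, dist (Φ p t) (Φ q t) ≤ dist p q * Real.exp (K * |t|)) ∧
      Continuous (fun z : ScaledState × ℝ => Φ z.1 z.2) ∧
      (∀ p s t, Φ (Φ p s) t = Φ p (s + t)) ∧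
      (∀ p, scaledField μ κ b p = 0 → ∀ t, Φ p t = p) ∧
      (∀ p, 0 ≤ χ p) ∧ (∀ p, ‖p‖ ≤ R → χ p = 1) := by
  let χ : ContDiffBump (0 : ScaledState) :=
    ⟨max R 1, max R 1 + 1, lt_of_lt_of_le one_pos (le_max_right _ _), by linarith⟩
  have hsm : ContDiff ℝ 1 (fun p => χ p • scaledField μ κ b p) := by
    have h1 : ContDiff ℝ 1 (χ : ScaledState → ℝ) := χ.contDiff
    have h2 : ContDiff ℝ 1 (scaledField μ κ b) := by
      unfold scaledField
      fun_prop
    exact h1.smul h2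
  have hsupp : HasCompactSupport (fun p => χ p • scaledField μ κ b p) :=
    χ.hasCompactSupport.smul_right
  obtain ⟨K, hK⟩ := hsm.lipschitzWith_of_hasCompactSupport hsupp one_ne_zero
  obtain ⟨C, hC⟩ := hsm.continuous.bounded_above_of_compact_support hsupp
  obtain ⟨Φ, h1, h2, h3, h4, h5, h6⟩ := exists_flow hK hC
  refine ⟨Φ, K, χ, K.2, h1, h2, h3, h4, h5, fun p hp => h6 p (by simp [hp]),
    fun p => χ.nonneg, fun p hp => χ.one_of_mem_closedBall ?_⟩
  rw [mem_closedBall_zero_iff]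
  exact hp.trans (le_max_left _ _)

/-- A global flow on the extended phase space which agrees with the rescaled Lorenz flow as long as
the orbit stays in a ball of radius `R`, a ball that traps the orbits used in the shooting argument
for parameters in `[e₁, e₂]`. -/
structure TrappedFlow (μ κ b e₁ e₂ : ℝ) where
  Φ : ScaledState → ℝ → ScaledState
  K : ℝ
  R : ℝ
  K_nonneg : 0 ≤ K
  zero : ∀ p, Φ p 0 = p
  dist_le : ∀ p q t, dist (Φ p t) (Φ q t) ≤ dist p q * Real.exp (K * |t|)
  cont : Continuous (fun z : ScaledState × ℝ => Φ z.1 z.2)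
  add : ∀ p s t, Φ (Φ p s) t = Φ p (s + t)
  fixed : ∀ e t, Φ (0, 0, 0, e) t = (0, 0, 0, e)
  param : ∀ p t, (Φ p t).2.2.2 = p.2.2.2
  sol : ∀ p I, (∀ t ∈ I, ‖Φ p t‖ ≤ R) → ScaledSol μ κ b p.2.2.2 (fun t => (Φ p t).1)
    (fun t => (Φ p t).2.1) (fun t => (Φ p t).2.2.1) I
  trapped : ∀ ε e, 0 ≤ ε → ε ≤ 1 → e₁ ≤ e → e ≤ e₂ → ∀ t ≥ 0, ‖Φ (ε, ε, 0, e) t‖ ≤ R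

/-- The quadratic form used to trap orbits. -/
noncomputable def trapForm (σ e X V W : ℝ) : ℝ :=
  2 * e ^ 2 * σ ^ 2 * X ^ 2 + 2 * (V + e * σ * X) ^ 2
    + (W + X ^ 2 - (1 + e * (σ + 1) + e ^ 2 * σ * (σ + 1))) ^ 2

lemma norm_le_of_trapForm_le {σ e₁ e₂ : ℝ} (hσ : 0 < σ) (he₁ : 0 < e₁) {M : ℝ} (hM : 1 ≤ M) :
    ∃ R, ∀ e X V W, e₁ ≤ e → e ≤ e₂ → trapForm σ e X V W ≤ M →
      ‖((X, V, W, e) : ScaledState)‖ ≤ R := by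
  set q := 1 + e₂ * (σ + 1) + e₂ ^ 2 * σ * (σ + 1) with hq
  set B := M / (e₁ * σ) with hB
  refine ⟨(M + e₂ * σ * B) + (M + q + B ^ 2) + B + e₂, ?_⟩
  intro e X V W h1 h2 h
  have he : 0 < e := he₁.trans_le h1
  have he2 : 0 < e₂ := he.trans_le h2
  have hB0 : 0 < B := by positivity
  unfold trapForm at h
  set qe := 1 + e * (σ + 1) + e ^ 2 * σ * (σ + 1) with hqe
  have hqe0 : 0 < qe := by positivity
  have hqq : qe ≤ q := by
    rw [hqe, hq]
    gcongr
  have hMM : M ≤ M ^ 2 := by nlinarith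
  have t1 : 0 ≤ 2 * e ^ 2 * σ ^ 2 * X ^ 2 := by positivity
  have t2 : 0 ≤ 2 * (V + e * σ * X) ^ 2 := by positivity
  have t3 : 0 ≤ (W + X ^ 2 - qe) ^ 2 := by positivity
  have a1 : |e * σ * X| ≤ M := by
    refine abs_le_of_sq_le_sq ?_ (by linarith)
    nlinarith
  have a2 : |V + e * σ * X| ≤ M := by
    refine abs_le_of_sq_le_sq ?_ (by linarith)
    nlinarith
  have a3 : |W + X ^ 2 - qe| ≤ M := by
    refine abs_le_of_sq_le_sq ?_ (by linarith)
    nlinarith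
  have hX : |X| ≤ B := by
    rw [hB, le_div_iff₀ (by positivity)]
    rw [abs_mul, abs_of_pos (by positivity : 0 < e * σ)] at a1
    calc |X| * (e₁ * σ) ≤ |X| * (e * σ) := by gcongr
      _ ≤ M := by linarith
  have hX2 : X ^ 2 ≤ B ^ 2 := sq_le_sq' (by linarith [(abs_le.1 hX).1]) (abs_le.1 hX).2
  have hV : |V| ≤ M + e₂ * σ * B := by
    have : |e * σ * X| ≤ e₂ * σ * B := by
      rw [abs_mul, abs_of_pos (by positivity : 0 < e * σ)]
      gcongr
    calc |V| = |(V + e * σ * X) - e * σ * X| := by ring_nf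
      _ ≤ |V + e * σ * X| + |e * σ * X| := abs_sub _ _
      _ ≤ _ := by linarith
  have hW : |W| ≤ M + q + B ^ 2 := by
    rw [abs_le] at a3 ⊢
    constructor <;> nlinarith [sq_nonneg X]
  have p1 : 0 ≤ M + e₂ * σ * B := (abs_nonneg _).trans hV
  have p2 : 0 ≤ M + q + B ^ 2 := (abs_nonneg _).trans hW
  simp only [Prod.norm_def, Real.norm_eq_abs, sup_le_iff]
  refine ⟨by linarith, by linarith, by linarith, ?_⟩
  rw [abs_of_pos he]
  linarith

lemma trap_rate_nonneg {σ b m M q T U z : ℝ} (hb : 0 ≤ b) (hm : 0 < m) (m1 : m ≤ σ) (m2 : m ≤ 1)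
    (m3 : m ≤ b / 2) (hT : 0 ≤ T) (hM : b * q ^ 2 / 2 ≤ m * M)
    (h : M < T + 2 * U ^ 2 + (z - q) ^ 2) :
    0 ≤ σ * T + 2 * U ^ 2 + b * z ^ 2 - b * q * z := by
  have j1 : m * T ≤ σ * T := by gcongr
  have j2 : m * (2 * U ^ 2) ≤ 1 * (2 * U ^ 2) := by gcongr
  have j3 : m * (z - q) ^ 2 ≤ b / 2 * (z - q) ^ 2 := by gcongr
  have j4 : m * M ≤ m * (T + 2 * U ^ 2 + (z - q) ^ 2) := by gcongr
  have j5 : 0 ≤ b * z ^ 2 := by positivity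
  linarith

lemma exists_trappedFlow {σ b e₁ e₂ : ℝ} (hσ : 0 < σ) (hb : 0 < b) (he₁ : 0 < e₁) :
    Nonempty (TrappedFlow (σ + 1) (2 * σ - b) b e₁ e₂) := by
  set q := 1 + e₂ * (σ + 1) + e₂ ^ 2 * σ * (σ + 1) with hq
  set m := min (min σ 1) (b / 2) with hm
  have hm0 : 0 < m := by positivity
  set M := 1 + b * q ^ 2 / (2 * m) + (2 * e₂ ^ 2 * σ ^ 2 + 2 * (1 + e₂ * σ) ^ 2 + (1 + q) ^ 2)
    with hM
  have hM1 : 1 ≤ M := by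
    have : 0 ≤ b * q ^ 2 / (2 * m) := by positivity
    have : 0 ≤ 2 * e₂ ^ 2 * σ ^ 2 + 2 * (1 + e₂ * σ) ^ 2 + (1 + q) ^ 2 := by positivity
    linarith
  obtain ⟨R, hR⟩ := norm_le_of_trapForm_le (e₂ := e₂) hσ he₁ hM1
  obtain ⟨Φ, K, χ, hK, h0, hd, hdist, hcont, hadd, hfix, hχ0, hχ1⟩ :=
    exists_cutoff_flow (σ + 1) (2 * σ - b) b R
  have dX : ∀ p t, HasDerivAt (fun t => (Φ p t).1) (χ (Φ p t) * (Φ p t).2.1) t :=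
    fun p t => (hd p t).fst
  have dV : ∀ p t, HasDerivAt (fun t => (Φ p t).2.1) _ t := fun p t => (hd p t).snd.fst
  have dW : ∀ p t, HasDerivAt (fun t => (Φ p t).2.2.1) _ t := fun p t => (hd p t).snd.snd.fst
  have de : ∀ p t, HasDerivAt (fun t => (Φ p t).2.2.2) (χ (Φ p t) * 0) t :=
    fun p t => (hd p t).snd.snd.snd
  have hpar : ∀ p t, (Φ p t).2.2.2 = p.2.2.2 := by
    intro p t
    have := is_const_of_deriv_eq_zero (f := fun t => (Φ p t).2.2.2)
      (fun t => (de p t).differentiableAt) (fun t => by rw [(de p t).deriv, mul_zero]) t 0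
    simpa [h0] using this
  refine ⟨⟨Φ, K, R, hK, h0, hdist, hcont, hadd, fun e t => hfix _ (by simp [scaledField]) t,
    hpar, ?_, ?_⟩⟩
  · intro p I hI
    refine ⟨fun t ht => ?_, fun t ht => ?_, fun t ht => ?_⟩
    · simpa [hχ1 _ (hI t ht)] using dX p t
    · refine (dV p t).congr_deriv ?_
      simp [hχ1 _ (hI t ht), scaledField, hpar]
    · refine (dW p t).congr_deriv ?_
      simp [hχ1 _ (hI t ht), scaledField, hpar]
  · intro ε e hε0 hε1 h1 h2
    set p : ScaledState := (ε, ε, 0, e) with hp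
    have he : 0 < e := he₁.trans_le h1
    have he2 : 0 < e₂ := he.trans_le h2
    set qe := 1 + e * (σ + 1) + e ^ 2 * σ * (σ + 1) with hqe
    have hqe0 : 0 < qe := by positivity
    have hqq : qe ≤ q := by
      rw [hqe, hq]
      gcongr
    have key : ∀ t ≥ 0, trapForm σ e (Φ p t).1 (Φ p t).2.1 (Φ p t).2.2.1 - M ≤ 0 := by
      intro t ht
      have hG : ∀ t ≥ 0, HasDerivAt
          (fun t => trapForm σ e (Φ p t).1 (Φ p t).2.1 (Φ p t).2.2.1 - M)
          (-(2 * e * χ (Φ p t)) * (2 * e ^ 2 * σ ^ 3 * (Φ p t).1 ^ 2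
            + 2 * ((Φ p t).2.1 + e * σ * (Φ p t).1) ^ 2
            + b * ((Φ p t).2.2.1 + (Φ p t).1 ^ 2) ^ 2
            - b * qe * ((Φ p t).2.2.1 + (Φ p t).1 ^ 2))) t := by
        intro t _
        have g1 := ((dX p t).fun_pow 2).const_mul (2 * e ^ 2 * σ ^ 2)
        have g2 := (((dV p t).fun_add ((dX p t).const_mul (e * σ))).fun_pow 2).const_mul 2
        have g3 := (((dW p t).fun_add ((dX p t).fun_pow 2)).sub_const qe).fun_pow 2
        refine (((g1.fun_add g2).fun_add g3).sub_const M).congr_deriv ?_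
        simp only [scaledField, hpar, hp, smul_eq_mul, Prod.smul_fst, Prod.smul_snd, hqe]
        push_cast
        ring
      refine nonpos_of_deriv_nonpos_of_pos hG ?_ ?_ ht
      · rw [h0, hp, trapForm]
        have i1 : 2 * e ^ 2 * σ ^ 2 * ε ^ 2 ≤ 2 * e₂ ^ 2 * σ ^ 2 * 1 ^ 2 := by gcongr
        have i2 : 2 * (ε + e * σ * ε) ^ 2 ≤ 2 * (1 + e₂ * σ * 1) ^ 2 := by gcongr
        have i3 : (0 + ε ^ 2 - qe) ^ 2 ≤ (1 + q) ^ 2 := by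
          refine sq_le_sq' ?_ ?_ <;> nlinarith
        have i4 : 0 ≤ b * q ^ 2 / (2 * m) := by positivity
        rw [hM]
        simp only [← hqe]
        linarith
      · intro s _ hs
        simp only [trapForm, ← hqe] at hs
        set X := (Φ p s).1
        set V := (Φ p s).2.1
        set W := (Φ p s).2.2.1
        have m1 : m ≤ σ := (min_le_left _ _).trans (min_le_left _ _)
        have m2 : m ≤ 1 := (min_le_left _ _).trans (min_le_right _ _)
        have m3 : m ≤ b / 2 := min_le_right _ _
        have hMq : b * qe ^ 2 / 2 ≤ m * M := by
          have i1 : b * qe ^ 2 ≤ b * q ^ 2 := by gcongr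
          have i2 : m * (b * q ^ 2 / (2 * m)) = b * q ^ 2 / 2 := by field_simp
          have i3 : 0 ≤ m * (2 * e₂ ^ 2 * σ ^ 2 + 2 * (1 + e₂ * σ) ^ 2 + (1 + q) ^ 2) := by
            positivity
          rw [hM, mul_add, mul_add, i2]
          linarith
        refine mul_nonpos_of_nonpos_of_nonneg ?_ ?_
        · have := hχ0 (Φ p s)
          have : 0 ≤ 2 * e * χ (Φ p s) := by positivity
          linarith
        · have := trap_rate_nonneg (T := 2 * e ^ 2 * σ ^ 2 * X ^ 2) (U := V + e * σ * X)
            (z := W + X ^ 2) hb.le hm0 m1 m2 m3 (by positivity) hMq (by linarith)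
          linarith
    intro t ht
    have := hR e _ _ _ h1 h2 (sub_nonpos.1 (key t ht))
    have h4 : (Φ p t).2.2.2 = e := by rw [hpar]
    rwa [← h4] at this

/-- Bounded backward solutions of `y' + k y ≥ 0` are nonnegative. -/
lemma nonneg_of_bounded_past {y y' : ℝ → ℝ} {k t₀ B : ℝ} (hk : 0 < k)
    (hd : ∀ t ≤ t₀, HasDerivAt y (y' t) t) (h : ∀ t ≤ t₀, 0 ≤ y' t + k * y t)
    (hB : ∀ t ≤ t₀, |y t| ≤ B) : ∀ t ≤ t₀, 0 ≤ y t := by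
  intro t ht
  have hm := monotoneOn_exp_mul k (convex_Iic t₀) hd h
  have hlim : Tendsto (fun s => Real.exp (k * s) * y s) atBot (𝓝 0) := by
    have h1 : Tendsto (fun s : ℝ => Real.exp (k * s) * B) atBot (𝓝 0) := by
      simpa using (Real.tendsto_exp_atBot.comp (tendsto_id.const_mul_atBot hk)).mul_const B
    refine squeeze_zero_norm' ?_ h1
    filter_upwards [eventually_le_atBot t₀] with s hs
    rw [norm_mul, Real.norm_eq_abs, Real.norm_eq_abs, abs_of_pos (Real.exp_pos _)]
    exact mul_le_mul_of_nonneg_left (hB s hs) (Real.exp_pos _).le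
  have : 0 ≤ Real.exp (k * t) * y t := by
    refine le_of_tendsto hlim ?_
    filter_upwards [eventually_le_atBot t] with s hs
    exact hm (Set.mem_Iic.2 (hs.trans ht)) ht hs
  exact nonneg_of_mul_nonneg_right this (Real.exp_pos _)

lemma deriv_eq_zero_of_eq_on_Iic {f : ℝ → ℝ} {f' t c : ℝ} (hf : HasDerivAt f f' t)
    (h : ∀ s ≤ t, f s = c) : f' = 0 := by
  have h1 : HasDerivWithinAt f 0 (Set.Iic t) t :=
    (hasDerivWithinAt_const t _ c).congr (fun s hs => h s hs) (h t le_rfl)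
  exact (uniqueDiffWithinAt_Iic t).eq_deriv _ hf.hasDerivWithinAt h1

lemma rest_of_const_past {μ κ b e c : ℝ} {X V W : ℝ → ℝ}
    (hS : ScaledSol μ κ b e X V W (Set.Iic 0)) (hX : ∀ t ≤ 0, X t = c) :
    V 0 = 0 ∧ (1 + e * μ - c ^ 2 - W 0) * c = 0 := by
  have hV : ∀ t ≤ 0, V t = 0 := fun t ht =>
    deriv_eq_zero_of_eq_on_Iic (hS.hX t ht) fun s hs => hX s (hs.trans ht)
  have := deriv_eq_zero_of_eq_on_Iic (hS.hV 0 (by simp)) hV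
  rw [hV 0 le_rfl, hX 0 le_rfl] at this
  exact ⟨hV 0 le_rfl, by linarith⟩

/-- A bounded half-orbit in the past of which `X` stays above its equilibrium value is constant. -/
lemma eq_of_past_ge {μ κ b e X₁ B : ℝ} {X V W : ℝ → ℝ} (hμ : 0 < μ) (hκ : 0 < κ) (hb : 0 < b)
    (he : 0 < e) (hX₁ : 0 < X₁) (hX₁e : X₁ ^ 2 * (b + κ) = (1 + e * μ) * b)
    (hS : ScaledSol μ κ b e X V W (Set.Iic 0))
    (hBX : ∀ t ≤ 0, |X t| ≤ B) (hBV : ∀ t ≤ 0, |V t| ≤ B) (hBW : ∀ t ≤ 0, |W t| ≤ B)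
    (hge : ∀ t ≤ 0, X₁ ≤ X t) : ∀ t ≤ 0, X t = X₁ := by
  have step : ∀ ξ t₀, t₀ ≤ 0 → X₁ ≤ ξ → (∀ t ≤ t₀, ξ ≤ X t) → ∀ t ≤ t₀,
      V t ≤ -(ξ * (ξ ^ 2 + κ * ξ ^ 2 / b - (1 + e * μ)) / (e * μ)) := by
    intro ξ t₀ ht₀ hξ hXξ
    have hξ0 : 0 < ξ := hX₁.trans_le hξ
    set η := ξ ^ 2 + κ * ξ ^ 2 / b - (1 + e * μ) with hη
    have hη0 : 0 ≤ η := by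
      have h1 : X₁ ^ 2 * (b + κ) ≤ ξ ^ 2 * (b + κ) := by gcongr
      have h2 : η = (ξ ^ 2 * (b + κ) - (1 + e * μ) * b) / b := by rw [hη]; field_simp
      rw [h2]
      exact div_nonneg (by linarith) hb.le
    have hW : ∀ t ≤ t₀, κ * ξ ^ 2 / b ≤ W t := by
      intro t ht
      have := nonneg_of_bounded_past (y := fun t => W t - κ * ξ ^ 2 / b)
        (B := B + |κ * ξ ^ 2 / b|) (mul_pos he hb)
        (fun t ht => (hS.hW t (ht.trans ht₀)).sub_const _) ?_ ?_ t ht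
      · simpa using this
      · intro t ht
        have h1 : ξ ^ 2 ≤ X t ^ 2 := by
          have := hXξ t ht
          gcongr
        have h2 : e * b * (κ * ξ ^ 2 / b) = e * κ * ξ ^ 2 := by field_simp
        have h3 : e * κ * ξ ^ 2 ≤ e * κ * X t ^ 2 := by gcongr
        simp only [mul_sub, h2]
        linarith
      · intro t ht
        exact (abs_sub _ _).trans (by gcongr; exact hBW t (ht.trans ht₀))
    intro t ht
    have := nonneg_of_bounded_past (y := fun t => -V t - ξ * η / (e * μ))
      (B := B + |ξ * η / (e * μ)|) (mul_pos he hμ)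
      (fun t ht => (hS.hV t (ht.trans ht₀)).fun_neg.sub_const _) ?_ ?_ t ht
    · linarith
    · intro t ht
      have h1 : ξ ^ 2 ≤ X t ^ 2 := by
        have := hXξ t ht
        gcongr
      have h2 : e * μ * (ξ * η / (e * μ)) = ξ * η := by field_simp
      have h3 : η ≤ X t ^ 2 + W t - (1 + e * μ) := by linarith [hW t ht]
      have h4 : ξ * η ≤ X t * (X t ^ 2 + W t - (1 + e * μ)) :=
        mul_le_mul (hXξ t ht) h3 hη0 (hξ0.le.trans (hXξ t ht))
      simp only [mul_sub, h2]
      linarith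
    · intro t ht
      exact (abs_sub _ _).trans (by rw [abs_neg]; gcongr; exact hBV t (ht.trans ht₀))
  have hanti : AntitoneOn X (Set.Iic 0) := by
    refine antitoneOn_of_hasDerivAt (convex_Iic 0) hS.hX fun t ht => ?_
    have := step X₁ 0 le_rfl le_rfl hge t ht
    have h2 : X₁ ^ 2 + κ * X₁ ^ 2 / b - (1 + e * μ) = 0 := by
      field_simp
      linarith
    rw [h2] at this
    simpa using this
  intro t₀ ht₀
  by_contra hne
  have hlt : X₁ < X t₀ := lt_of_le_of_ne (hge t₀ ht₀) (Ne.symm hne)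
  have hpast : ∀ t ≤ t₀, X t₀ ≤ X t := fun t ht =>
    hanti (Set.mem_Iic.2 (ht.trans ht₀)) ht₀ ht
  have hV := step (X t₀) t₀ ht₀ hlt.le hpast
  set c := X t₀ * (X t₀ ^ 2 + κ * X t₀ ^ 2 / b - (1 + e * μ)) / (e * μ) with hc
  have hc0 : 0 < c := by
    have h1 : X₁ ^ 2 * (b + κ) < X t₀ ^ 2 * (b + κ) := by gcongr
    have h2 : X t₀ ^ 2 + κ * X t₀ ^ 2 / b - (1 + e * μ)
        = (X t₀ ^ 2 * (b + κ) - (1 + e * μ) * b) / b := by field_simp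
    have h3 : 0 < X t₀ ^ 2 + κ * X t₀ ^ 2 / b - (1 + e * μ) := by
      rw [h2]
      exact div_pos (by linarith) hb
    have h4 : 0 < X t₀ := hX₁.trans hlt
    positivity
  have hlin : AntitoneOn (fun t => X t + c * t) (Set.Iic t₀) := by
    refine antitoneOn_of_hasDerivAt (y' := fun t => V t + c * 1) (convex_Iic t₀)
      (fun t ht => (hS.hX t (le_trans ht ht₀)).fun_add ((hasDerivAt_id t).const_mul c)) ?_
    intro t ht
    linarith [hV t ht]
  set T := (B + 1) / c with hT
  have hB0 : 0 ≤ B := (abs_nonneg _).trans (hBX 0 le_rfl)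
  have hT0 : 0 ≤ T := by positivity
  have h1 := hlin (Set.mem_Iic.2 (by linarith : t₀ - T ≤ t₀)) Set.self_mem_Iic (by linarith)
  have h2 := (abs_le.1 (hBX (t₀ - T) (by linarith))).2
  have h3 : c * T = B + 1 := by rw [hT]; field_simp
  simp only [mul_sub, h3] at h1
  linarith

/-- A bounded half-orbit in the past of which `X` stays between a positive constant and its
equilibrium value is constant. -/
lemma eq_of_past_le {μ κ b e X₁ δ B : ℝ} {X V W : ℝ → ℝ} (hμ : 0 < μ) (hκ : 0 < κ) (hb : 0 < b)
    (he : 0 < e) (hδ : 0 < δ) (hX₁e : X₁ ^ 2 * (b + κ) = (1 + e * μ) * b)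
    (hS : ScaledSol μ κ b e X V W (Set.Iic 0))
    (hBV : ∀ t ≤ 0, |V t| ≤ B) (hBW : ∀ t ≤ 0, |W t| ≤ B)
    (hge : ∀ t ≤ 0, δ ≤ X t) (hle : ∀ t ≤ 0, X t ≤ X₁) : ∀ t ≤ 0, X t = X₁ := by
  have step : ∀ ξ t₀, t₀ ≤ 0 → ξ ≤ X₁ → (∀ t ≤ t₀, X t ≤ ξ) → ∀ t ≤ t₀,
      δ * (1 + e * μ - ξ ^ 2 - κ * ξ ^ 2 / b) / (e * μ) ≤ V t := by
    intro ξ t₀ ht₀ hξ hXξ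
    have hξ0 : 0 < ξ := (hδ.trans_le (hge t₀ ht₀)).trans_le (hXξ t₀ le_rfl)
    set η := 1 + e * μ - ξ ^ 2 - κ * ξ ^ 2 / b with hη
    have hη0 : 0 ≤ η := by
      have h1 : ξ ^ 2 * (b + κ) ≤ X₁ ^ 2 * (b + κ) := by gcongr
      have h2 : η = ((1 + e * μ) * b - ξ ^ 2 * (b + κ)) / b := by rw [hη]; field_simp; ring
      rw [h2]
      exact div_nonneg (by linarith) hb.le
    have hsq : ∀ t ≤ t₀, X t ^ 2 ≤ ξ ^ 2 := by
      intro t ht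
      have h1 := hXξ t ht
      have h2 := hδ.le.trans (hge t (ht.trans ht₀))
      gcongr
    have hW : ∀ t ≤ t₀, W t ≤ κ * ξ ^ 2 / b := by
      intro t ht
      have := nonneg_of_bounded_past (y := fun t => -W t - -(κ * ξ ^ 2 / b))
        (B := B + |κ * ξ ^ 2 / b|) (mul_pos he hb)
        (fun t ht => (hS.hW t (ht.trans ht₀)).fun_neg.sub_const _) ?_ ?_ t ht
      · linarith
      · intro t ht
        have h2 : e * b * (κ * ξ ^ 2 / b) = e * κ * ξ ^ 2 := by field_simp
        have h3 : e * κ * X t ^ 2 ≤ e * κ * ξ ^ 2 := by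
          have := hsq t ht
          gcongr
        simp only [mul_sub, mul_neg, h2]
        linarith
      · intro t ht
        refine (abs_sub _ _).trans ?_
        rw [abs_neg, abs_neg]
        gcongr
        exact hBW t (ht.trans ht₀)
    intro t ht
    have := nonneg_of_bounded_past (y := fun t => V t - δ * η / (e * μ))
      (B := B + |δ * η / (e * μ)|) (mul_pos he hμ)
      (fun t ht => (hS.hV t (ht.trans ht₀)).sub_const _) ?_ ?_ t ht
    · linarith
    · intro t ht
      have h2 : e * μ * (δ * η / (e * μ)) = δ * η := by field_simp
      have h3 : η ≤ 1 + e * μ - X t ^ 2 - W t := by linarith [hW t ht, hsq t ht]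
      have h4 : δ * η ≤ X t * (1 + e * μ - X t ^ 2 - W t) :=
        mul_le_mul (hge t (ht.trans ht₀)) h3 hη0 (hδ.le.trans (hge t (ht.trans ht₀)))
      simp only [mul_sub, h2]
      linarith
    · intro t ht
      exact (abs_sub _ _).trans (by gcongr; exact hBV t (ht.trans ht₀))
  have hmono : MonotoneOn X (Set.Iic 0) := by
    refine monotoneOn_of_hasDerivAt (convex_Iic 0) hS.hX fun t ht => ?_
    have := step X₁ 0 le_rfl le_rfl hle t ht
    have h2 : 1 + e * μ - X₁ ^ 2 - κ * X₁ ^ 2 / b = 0 := by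
      field_simp
      linarith
    rw [h2] at this
    simpa using this
  intro t₀ ht₀
  by_contra hne
  have hlt : X t₀ < X₁ := lt_of_le_of_ne (hle t₀ ht₀) hne
  have hpast : ∀ t ≤ t₀, X t ≤ X t₀ := fun t ht =>
    hmono (Set.mem_Iic.2 (ht.trans ht₀)) ht₀ ht
  have hV := step (X t₀) t₀ ht₀ hlt.le hpast
  have hXt₀ : 0 < X t₀ := hδ.trans_le (hge t₀ ht₀)
  set c := δ * (1 + e * μ - X t₀ ^ 2 - κ * X t₀ ^ 2 / b) / (e * μ) with hc
  have hc0 : 0 < c := by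
    have h1 : X t₀ ^ 2 * (b + κ) < X₁ ^ 2 * (b + κ) := by gcongr
    have h2 : 1 + e * μ - X t₀ ^ 2 - κ * X t₀ ^ 2 / b
        = ((1 + e * μ) * b - X t₀ ^ 2 * (b + κ)) / b := by field_simp; ring
    have h3 : 0 < 1 + e * μ - X t₀ ^ 2 - κ * X t₀ ^ 2 / b := by
      rw [h2]
      exact div_pos (by linarith) hb
    positivity
  have hlin : MonotoneOn (fun t => X t - c * t) (Set.Iic t₀) := by
    refine monotoneOn_of_hasDerivAt (y' := fun t => V t - c * 1) (convex_Iic t₀)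
      (fun t ht => (hS.hX t (le_trans ht ht₀)).fun_sub ((hasDerivAt_id t).const_mul c)) ?_
    intro t ht
    linarith [hV t ht]
  set T := X t₀ / c with hT
  have hT0 : 0 ≤ T := by positivity
  have h1 := hlin (Set.mem_Iic.2 (by linarith : t₀ - T ≤ t₀)) Set.self_mem_Iic (by linarith)
  have h2 := hge (t₀ - T) (by linarith)
  have h3 : c * T = X t₀ := by rw [hT]; field_simp
  simp only [mul_sub, h3] at h1
  linarith

/-- The energy-like function used in the shooting argument. -/
noncomputable def shootingEnergy (μ e X V W : ℝ) : ℝ :=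
  V ^ 2 / 2 - (1 + e * μ) / 2 * X ^ 2 + X ^ 4 / 4 + W * X ^ 2 / 2 + e * μ / 2 * (X * V)

lemma ScaledSol.hasDerivAt_energy {μ κ b e : ℝ} {X V W : ℝ → ℝ} {I : Set ℝ}
    (hS : ScaledSol μ κ b e X V W I) {t : ℝ} (ht : t ∈ I) :
    HasDerivAt (fun t => shootingEnergy μ e (X t) (V t) (W t))
      (-(e * μ) * shootingEnergy μ e (X t) (V t) (W t)
        + e / 2 * X t ^ 2 * ((κ - μ / 2) * X t ^ 2 - b * W t)) t := by
  have dX := hS.hX t ht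
  have dV := hS.hV t ht
  have dW := hS.hW t ht
  refine ((((((dV.fun_pow 2).div_const 2).fun_sub ((dX.fun_pow 2).const_mul ((1 + e * μ) / 2))).fun_add
    ((dX.fun_pow 4).div_const 4)).fun_add ((dW.fun_mul (dX.fun_pow 2)).div_const 2)).fun_add
    ((dX.fun_mul dV).const_mul (e * μ / 2))).congr_deriv ?_
  unfold shootingEnergy
  push_cast
  ring

lemma energy_neg_of_turning {μ e X V W : ℝ} (hX : X ≠ 0) (hV : V = 0)
    (hg : 0 ≤ 1 + e * μ - X ^ 2 - W) : shootingEnergy μ e X V W < 0 := by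
  unfold shootingEnergy
  rw [hV]
  have h1 : 0 < X ^ 4 := by positivity
  have h2 := mul_nonneg hg (sq_nonneg X)
  nlinarith

/-- On the way up to the equilibrium value of `X`, the shooting orbit keeps rising. -/
lemma rising_of_le {μ κ b e ε X₁ T : ℝ} {X V W : ℝ → ℝ} (hκ : 0 < κ) (hb : 0 < b)
    (he : 0 < e) (hε : 0 < ε) (hX₁e : X₁ ^ 2 * (b + κ) = (1 + e * μ) * b)
    (hS : ScaledSol μ κ b e X V W (Set.Icc 0 T))
    (hX0 : X 0 = ε) (hV0 : V 0 = ε) (hW0 : W 0 = 0) (hle : ∀ t ∈ Set.Icc 0 T, X t ≤ X₁) :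
    ∀ t ∈ Set.Icc 0 T, 0 < V t ∧ ε ≤ X t := by
  have hXge : ∀ s ∈ Set.Icc 0 T, (∀ r ∈ Set.Icc 0 s, 0 ≤ V r) → ∀ r ∈ Set.Icc 0 s, ε ≤ X r := by
    intro s hs hV r hr
    have hm : MonotoneOn X (Set.Icc 0 s) := monotoneOn_of_hasDerivAt (convex_Icc 0 s)
      (fun t ht => hS.hX t ⟨ht.1, ht.2.trans hs.2⟩) hV
    have := hm ⟨le_rfl, hs.1⟩ hr hr.1
    rwa [hX0] at this
  have hVpos : ∀ t ∈ Set.Icc 0 T, 0 < V t := by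
    intro t ht
    by_contra hn
    obtain ⟨s, h1, h2, h3, h4⟩ := exists_first_zero ht.1
      (fun r hr => (hS.hV r ⟨hr.1, hr.2.trans ht.2⟩).continuousAt.continuousWithinAt)
      (by rw [hV0]; exact hε) (not_lt.1 hn)
    have hsub : ∀ r ∈ Set.Icc 0 s, r ∈ Set.Icc 0 T := fun r hr => ⟨hr.1, hr.2.trans (h2.trans ht.2)⟩
    have hVr : ∀ r ∈ Set.Icc 0 s, 0 ≤ V r := by
      intro r hr
      rcases hr.2.lt_or_eq with h | h
      · exact (h4 r hr.1 h).le
      · rw [h, h3]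
    have hXr := hXge s (hsub s ⟨h1.le, le_rfl⟩) hVr
    have hWr : ∀ r ∈ Set.Icc 0 s, W r ≤ κ * X₁ ^ 2 / b := by
      intro r hr
      have hm := antitoneOn_exp_mul (y := fun t => W t - κ * X₁ ^ 2 / b) (e * b) (convex_Icc 0 s)
        (fun t ht => (hS.hW t (hsub t ht)).sub_const _) ?_ ⟨le_rfl, h1.le⟩ hr hr.1
      · simp only [hW0, mul_zero, Real.exp_zero] at hm
        have h5 : 0 ≤ κ * X₁ ^ 2 / b := by positivity
        have := nonpos_of_mul_nonpos_right (hm.trans (by linarith)) (Real.exp_pos _)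
        linarith
      · intro t ht
        have i1 := hε.le.trans (hXr t ht)
        have i2 := hle t (hsub t ht)
        have i3 : e * κ * X t ^ 2 ≤ e * κ * X₁ ^ 2 := by gcongr
        have i4 : e * b * (κ * X₁ ^ 2 / b) = e * κ * X₁ ^ 2 := by field_simp
        simp only [mul_sub, i4]
        linarith
    have hm := monotoneOn_exp_mul (e * μ) (convex_Icc 0 s) (fun t ht => hS.hV t (hsub t ht)) ?_
      ⟨le_rfl, h1.le⟩ ⟨h1.le, le_rfl⟩ h1.le
    · simp only [hV0, h3, mul_zero, Real.exp_zero] at hm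
      linarith
    · intro t ht
      have i1 := hε.le.trans (hXr t ht)
      have i2 := hle t (hsub t ht)
      have i3 : X t ^ 2 ≤ X₁ ^ 2 := by gcongr
      have i4 : X₁ ^ 2 + κ * X₁ ^ 2 / b = 1 + e * μ := by
        field_simp
        linarith
      have i5 : 0 ≤ (1 + e * μ - X t ^ 2 - W t) * X t :=
        mul_nonneg (by linarith [hWr t ht]) i1
      linarith
  intro t ht
  exact ⟨hVpos t ht, hXge t ht (fun r hr => (hVpos r ⟨hr.1, hr.2.trans ht.2⟩).le) t ⟨ht.1, le_rfl⟩⟩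

/-- A uniform bound on the time needed to leave a neighbourhood of the saddle. -/
lemma time_le_of_le {μ κ b e e₂ ε δ X₁ T : ℝ} {X V W : ℝ → ℝ} (hμ : 0 < μ) (hκ : 0 < κ)
    (hb : 0 < b) (he : 0 < e) (he₂ : e ≤ e₂) (hε : 0 < ε) (hδ : 0 < δ) (hT : 0 ≤ T)
    (hX₁e : X₁ ^ 2 * (b + κ) = (1 + e * μ) * b) (hδ₁ : 2 * δ ≤ X₁)
    (hS : ScaledSol μ κ b e X V W (Set.Icc 0 T))
    (hX0 : X 0 = ε) (hV0 : V 0 = ε) (hW0 : W 0 = 0) (hle : ∀ t ∈ Set.Icc 0 T, X t ≤ δ) :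
    T ≤ δ / (ε * min 1 (3 / (4 * (e₂ * μ)))) := by
  have he₂0 : 0 < e₂ := he.trans_le he₂
  set v := ε * min 1 (3 / (4 * (e₂ * μ))) with hv
  have hv0 : 0 < v := by positivity
  have hr := rising_of_le hκ hb he hε hX₁e hS hX0 hV0 hW0 (fun t ht => (hle t ht).trans (by linarith))
  have hsq : ∀ t ∈ Set.Icc 0 T, X t ^ 2 ≤ δ ^ 2 := by
    intro t ht
    have i1 := hε.le.trans (hr t ht).2
    have i2 := hle t ht
    gcongr
  have hW : ∀ r ∈ Set.Icc 0 T, W r ≤ κ * δ ^ 2 / b := by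
    intro r hr
    have hm := antitoneOn_exp_mul (y := fun t => W t - κ * δ ^ 2 / b) (e * b) (convex_Icc 0 T)
      (fun t ht => (hS.hW t ht).sub_const _) ?_ ⟨le_rfl, hT⟩ hr hr.1
    · simp only [hW0, mul_zero, Real.exp_zero] at hm
      have h5 : 0 ≤ κ * δ ^ 2 / b := by positivity
      have := nonpos_of_mul_nonpos_right (hm.trans (by linarith)) (Real.exp_pos _)
      linarith
    · intro t ht
      have i3 : e * κ * X t ^ 2 ≤ e * κ * δ ^ 2 := by
        have := hsq t ht
        gcongr
      have i4 : e * b * (κ * δ ^ 2 / b) = e * κ * δ ^ 2 := by field_simp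
      simp only [mul_sub, i4]
      linarith
  have hg : ∀ t ∈ Set.Icc 0 T, 3 / 4 ≤ 1 + e * μ - X t ^ 2 - W t := by
    intro t ht
    have i1 := hW t ht
    have i2 := hsq t ht
    have i3 : δ ^ 2 + κ * δ ^ 2 / b = δ ^ 2 * (b + κ) / b := by field_simp
    have i4 : δ ^ 2 * (b + κ) / b ≤ (1 + e * μ) / 4 := by
      rw [div_le_iff₀ hb]
      have : (2 * δ) ^ 2 * (b + κ) ≤ X₁ ^ 2 * (b + κ) := by gcongr
      linarith
    have i5 : 0 < e * μ := by positivity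
    linarith
  have hVv : ∀ t ∈ Set.Icc 0 T, v ≤ V t := by
    intro t ht
    have hm := monotoneOn_exp_mul (y := fun t => V t - v) (e * μ) (convex_Icc 0 T)
      (fun t ht => (hS.hV t ht).sub_const _) ?_ ⟨le_rfl, hT⟩ ht ht.1
    · simp only [hV0, mul_zero, Real.exp_zero] at hm
      have h5 : v ≤ ε := by
        rw [hv]
        exact mul_le_of_le_one_right hε.le (min_le_left _ _)
      have := nonneg_of_mul_nonneg_right (le_trans (by linarith) hm) (Real.exp_pos _)
      linarith
    · intro t ht
      have i1 : 3 / 4 * ε ≤ (1 + e * μ - X t ^ 2 - W t) * X t := by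
        have := hg t ht
        have := (hr t ht).2
        gcongr
      have i2 : e * μ * v ≤ 3 / 4 * ε := by
        calc e * μ * v ≤ e₂ * μ * (ε * (3 / (4 * (e₂ * μ)))) := by
              rw [hv]
              gcongr
              exact min_le_right _ _
          _ = 3 / 4 * ε := by field_simp
      simp only [mul_sub]
      linarith
  have hlin : MonotoneOn (fun t => X t - v * t) (Set.Icc 0 T) := by
    refine monotoneOn_of_hasDerivAt (y' := fun t => V t - v * 1) (convex_Icc 0 T)
      (fun t ht => (hS.hX t ht).fun_sub ((hasDerivAt_id t).const_mul v)) ?_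
    intro t ht
    linarith [hVv t ht]
  have h1 := hlin ⟨le_rfl, hT⟩ ⟨hT, le_rfl⟩ hT
  have h2 := hle T ⟨hT, le_rfl⟩
  simp only [hX0] at h1
  rw [le_div_iff₀ hv0]
  linarith

lemma deriv_nonneg_of_pos_right {f : ℝ → ℝ} {f' s t : ℝ} (hst : s < t) (hf : HasDerivAt f f' s)
    (h0 : f s = 0) (hpos : ∀ r, s < r → r ≤ t → 0 < f r) : 0 ≤ f' := by
  have h1 : Tendsto (slope f s) (𝓝[>] s) (𝓝 f') :=
    (hasDerivAt_iff_tendsto_slope.1 hf).mono_left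
      (nhdsWithin_mono _ fun r hr => ne_of_gt hr)
  refine ge_of_tendsto h1 ?_
  filter_upwards [Ioc_mem_nhdsGT hst] with r hr
  rw [slope_def_field, h0, sub_zero]
  exact div_nonneg (hpos r hr.1 hr.2).le (by linarith [hr.1])

lemma deriv_nonpos_of_pos_left {f : ℝ → ℝ} {f' s t : ℝ} (hst : s < t) (hf : HasDerivAt f f' t)
    (h0 : f t = 0) (hpos : ∀ r, s ≤ r → r < t → 0 < f r) : f' ≤ 0 := by
  have h1 : Tendsto (slope f t) (𝓝[<] t) (𝓝 f') :=
    (hasDerivAt_iff_tendsto_slope.1 hf).mono_left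
      (nhdsWithin_mono _ fun r hr => ne_of_lt hr)
  refine le_of_tendsto h1 ?_
  filter_upwards [Ico_mem_nhdsLT hst] with r hr
  rw [slope_def_field, h0, sub_zero]
  exact div_nonpos_of_nonneg_of_nonpos (hpos r hr.1 hr.2).le (by linarith [hr.2])

/-- The solution rises, has a single nondegenerate maximum of `X`, and then `X` becomes negative. -/
def Falls (μ e : ℝ) (X V W : ℝ → ℝ) : Prop :=
  ∃ T, 0 ≤ T ∧ X T < 0 ∧ ∀ t ∈ Set.Icc 0 T, V t = 0 → (1 + e * μ - X t ^ 2 - W t) * X t < 0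

lemma Falls.structure {μ κ b e ε : ℝ} {X V W : ℝ → ℝ} (hε : 0 < ε)
    (hS : ScaledSol μ κ b e X V W (Set.Ici 0)) (hX0 : X 0 = ε) (hV0 : V 0 = ε)
    (h : Falls μ e X V W) :
    ∃ τ T, 0 < τ ∧ τ ≤ T ∧ X T = 0 ∧ V τ = 0 ∧ (∀ t ∈ Set.Ico 0 T, 0 < X t) ∧
      (∀ t ∈ Set.Icc 0 τ, 0 ≤ V t) ∧ (∀ t ∈ Set.Icc τ T, V t ≤ 0) := by
  obtain ⟨S, hS0, hXS, hturn⟩ := h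
  obtain ⟨T, h1, h2, h3, h4⟩ := exists_first_zero hS0
    (fun r hr => (hS.hX r hr.1).continuousAt.continuousWithinAt) (by rw [hX0]; exact hε) hXS.le
  have hex : ∃ t ∈ Set.Icc 0 T, V t ≤ 0 := by
    by_contra hn
    push Not at hn
    have hm : MonotoneOn X (Set.Icc 0 T) := monotoneOn_of_hasDerivAt (convex_Icc 0 T)
      (fun t ht => hS.hX t ht.1) (fun t ht => (hn t ht).le)
    have := hm ⟨le_rfl, h1.le⟩ ⟨h1.le, le_rfl⟩ h1.le
    linarith
  obtain ⟨t, ht, hVt⟩ := hex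
  obtain ⟨τ, k1, k2, k3, k4⟩ := exists_first_zero ht.1
    (fun r hr => (hS.hV r hr.1).continuousAt.continuousWithinAt) (by rw [hV0]; exact hε) hVt
  refine ⟨τ, T, k1, k2.trans ht.2, h3, k3, fun r hr => h4 r hr.1 hr.2, ?_, ?_⟩
  · intro r hr
    rcases hr.2.lt_or_eq with h | h
    · exact (k4 r hr.1 h).le
    · rw [h, k3]
  · intro r hr
    by_contra hn
    obtain ⟨s, l1, l2, l3, l4⟩ := exists_last_zero hr.1
      (fun q hq => (hS.hV q (k1.le.trans hq.1)).continuousAt.continuousWithinAt) k3.le (not_le.1 hn)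
    have hs0 : 0 ≤ s := k1.le.trans l1
    have m1 := deriv_nonneg_of_pos_right l2 (hS.hV s hs0) l3 l4
    have m2 := hturn s ⟨hs0, (l2.le.trans hr.2).trans h2⟩ l3
    rw [l3, mul_zero, zero_add] at m1
    linarith

lemma energy_nonneg_of_structure {μ κ b e ε τ T : ℝ} {X V W : ℝ → ℝ} (hμ : 0 < μ) (hb : 0 < b)
    (he : 0 < e) (hε : 0 < ε) (ha : 0 < κ - μ / 2)
    (hS : ScaledSol μ κ b e X V W (Set.Ici 0)) (hX0 : X 0 = ε) (hV0 : V 0 = ε) (hW0 : W 0 = 0)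
    (hτ : 0 < τ) (hτT : τ ≤ T) (hXT : X T = 0) (hXpos : ∀ t ∈ Set.Ico 0 T, 0 < X t)
    (hup : ∀ t ∈ Set.Icc 0 τ, 0 ≤ V t) (hdown : ∀ t ∈ Set.Icc τ T, V t ≤ 0) :
    ∀ t ∈ Set.Icc 0 T, 0 ≤ shootingEnergy μ e (X t) (V t) (W t) := by
  have hκ : 0 < κ := by linarith
  have hT0 : 0 ≤ T := hτ.le.trans hτT
  set J : ℝ → ℝ := fun t => shootingEnergy μ e (X t) (V t) (W t) with hJ
  have hXnn : ∀ t ∈ Set.Icc 0 T, 0 ≤ X t := by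
    intro t ht
    rcases ht.2.lt_or_eq with h | h
    · exact (hXpos t ⟨ht.1, h⟩).le
    · rw [h, hXT]
  have hJ0 : 0 < J 0 := by
    simp only [hJ, shootingEnergy, hX0, hV0, hW0]
    have : 0 < ε ^ 4 := by positivity
    nlinarith
  have hJT : 0 ≤ J T := by
    simp only [hJ, shootingEnergy, hXT]
    have := sq_nonneg (V T)
    nlinarith
  set D : ℝ → ℝ := fun t => (κ - μ / 2) * X t ^ 2 - b * W t with hD
  have dD : ∀ t ∈ Set.Ici (0 : ℝ), HasDerivAt D
      (X t * (2 * (κ - μ / 2) * V t - b * e * μ / 2 * X t) - e * b * D t) t := by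
    intro t ht
    refine ((((hS.hX t ht).fun_pow 2).const_mul (κ - μ / 2)).fun_sub
      ((hS.hW t ht).const_mul b)).congr_deriv ?_
    simp only [hD]
    push_cast
    ring
  have hD0 : 0 < D 0 := by
    simp only [hD, hX0, hW0]
    have : 0 < (κ - μ / 2) * ε ^ 2 := by positivity
    linarith
  have hJup : ∀ s ∈ Set.Icc 0 T, (∀ t ∈ Set.Icc 0 s, 0 ≤ D t) → ∀ t ∈ Set.Icc 0 s, 0 ≤ J t := by
    intro s hs hDs t ht
    have hm := monotoneOn_exp_mul (e * μ) (convex_Icc 0 s)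
      (fun t ht => hS.hasDerivAt_energy (t := t) ht.1) ?_ ⟨le_rfl, hs.1⟩ ht ht.1
    · simp only [mul_zero, Real.exp_zero, one_mul] at hm
      exact nonneg_of_mul_nonneg_right (hJ0.le.trans hm) (Real.exp_pos _)
    · intro t ht
      have : 0 ≤ e / 2 * X t ^ 2 * D t := mul_nonneg (by positivity) (hDs t ht)
      simp only [hD] at this
      linarith
  by_cases hcase : ∀ t ∈ Set.Icc 0 T, 0 ≤ D t
  · exact hJup T ⟨hT0, le_rfl⟩ hcase
  push Not at hcase
  obtain ⟨t₂, ht₂, hDt₂⟩ := hcase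
  obtain ⟨t₁, k1, k2, k3, k4⟩ := exists_first_zero ht₂.1
    (fun r hr => (dD r hr.1).continuousAt.continuousWithinAt) hD0 hDt₂.le
  have ht₁T : t₁ < T := by
    rcases k2.lt_or_eq with h | h
    · exact h.trans_le ht₂.2
    · rw [h] at k3
      linarith
  have hXt₁ : 0 < X t₁ := hXpos t₁ ⟨k1.le, ht₁T⟩
  have hslope₁ : 2 * (κ - μ / 2) * V t₁ - b * e * μ / 2 * X t₁ ≤ 0 := by
    have := deriv_nonpos_of_pos_left k1 (dD t₁ k1.le) k3 k4
    rw [k3, mul_zero, sub_zero] at this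
    exact nonpos_of_mul_nonpos_right this hXt₁
  -- On the rising part of the orbit the slope `V / X` decreases.
  have hratio : AntitoneOn (fun t => V t / X t) (Set.Icc 0 τ) := by
    have hXup : ∀ t ∈ Set.Icc 0 τ, 0 < X t := by
      intro t ht
      have hm : MonotoneOn X (Set.Icc 0 τ) := monotoneOn_of_hasDerivAt (convex_Icc 0 τ)
        (fun t ht => hS.hX t ht.1) hup
      have := hm ⟨le_rfl, hτ.le⟩ ht ht.1
      linarith
    have hY : ∀ t ∈ Set.Icc 0 τ, 0 ≤ κ * X t ^ 2 - b * W t := by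
      intro t ht
      have hm := monotoneOn_exp_mul (e * b) (y := fun t => κ * X t ^ 2 - b * W t)
        (convex_Icc 0 τ) (fun t ht => (((hS.hX t ht.1).fun_pow 2).const_mul κ).fun_sub
          ((hS.hW t ht.1).const_mul b)) ?_ ⟨le_rfl, hτ.le⟩ ht ht.1
      · simp only [mul_zero, Real.exp_zero, one_mul, hX0, hW0] at hm
        refine nonneg_of_mul_nonneg_right (le_trans ?_ hm) (Real.exp_pos (e * b * t))
        have : 0 < κ * ε ^ 2 := by positivity
        linarith
      · intro t ht
        have : 0 ≤ 2 * κ * (X t * V t) :=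
          mul_nonneg (by positivity) (mul_nonneg (hXup t ht).le (hup t ht))
        push_cast
        nlinarith
    have hP : ∀ t ∈ Set.Icc 0 τ, X t * (-(e * μ) * V t + (1 + e * μ - X t ^ 2 - W t) * X t)
        - V t * V t ≤ 0 := by
      intro t ht
      have hm := antitoneOn_exp_mul (e * μ) (y := fun t =>
        X t * (-(e * μ) * V t + (1 + e * μ - X t ^ 2 - W t) * X t) - V t * V t)
        (convex_Icc 0 τ) (fun t ht => ((hS.hX t ht.1).fun_mul
          (((hS.hV t ht.1).const_mul (-(e * μ))).fun_add
            (((((hS.hX t ht.1).fun_pow 2).const_sub (1 + e * μ)).fun_sub (hS.hW t ht.1)).fun_mul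
              (hS.hX t ht.1)))).fun_sub ((hS.hV t ht.1).fun_mul (hS.hV t ht.1)))
        ?_ ⟨le_rfl, hτ.le⟩ ht ht.1
      · simp only [mul_zero, Real.exp_zero, one_mul, hX0, hW0, hV0] at hm
        refine nonpos_of_mul_nonpos_right (hm.trans ?_) (Real.exp_pos (e * μ * t))
        have : 0 < ε ^ 4 := by positivity
        nlinarith
      · intro t ht
        have i1 : 0 ≤ X t ^ 2 * (2 * (X t * V t) + e * (κ * X t ^ 2 - b * W t)) :=
          mul_nonneg (sq_nonneg _) (add_nonneg
            (mul_nonneg zero_le_two (mul_nonneg (hXup t ht).le (hup t ht)))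
            (mul_nonneg he.le (hY t ht)))
        push_cast
        linarith
    refine antitoneOn_of_hasDerivAt (convex_Icc 0 τ)
      (fun t ht => (hS.hV t ht.1).fun_div (hS.hX t ht.1) (hXup t ht).ne') ?_
    intro t ht
    refine div_nonpos_of_nonpos_of_nonneg ?_ (sq_nonneg _)
    linarith [hP t ht]
  have hslope : ∀ t ∈ Set.Icc t₁ T, 2 * (κ - μ / 2) * V t - b * e * μ / 2 * X t ≤ 0 := by
    intro t ht
    have hX := hXnn t ⟨k1.le.trans ht.1, ht.2⟩
    have hbX : 0 ≤ b * e * μ / 2 * X t := by positivity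
    rcases le_total τ t with h | h
    · have h5 := hdown t ⟨h, ht.2⟩
      have : 2 * (κ - μ / 2) * V t ≤ 0 := mul_nonpos_of_nonneg_of_nonpos (by linarith) h5
      linarith
    · rcases ht.2.lt_or_eq with hlt | heq
      · have hXt := hXpos t ⟨k1.le.trans ht.1, hlt⟩
        have h6 : V t / X t ≤ V t₁ / X t₁ :=
          hratio ⟨k1.le, ht.1.trans h⟩ ⟨k1.le.trans ht.1, h⟩ ht.1
        have h7 : V t₁ / X t₁ ≤ b * e * μ / (4 * (κ - μ / 2)) := by
          rw [div_le_div_iff₀ hXt₁ (by linarith)]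
          linarith
        have h8 := h6.trans h7
        rw [div_le_div_iff₀ hXt (by linarith)] at h8
        linarith
      · have h5 := hdown t ⟨by linarith, ht.2⟩
        have : 2 * (κ - μ / 2) * V t ≤ 0 := mul_nonpos_of_nonneg_of_nonpos (by linarith) h5
        linarith
  have hDneg : ∀ t ∈ Set.Icc t₁ T, D t ≤ 0 := by
    intro t ht
    have hm := antitoneOn_exp_mul (e * b) (convex_Icc t₁ T)
      (fun t ht => dD t (k1.le.trans ht.1)) ?_ ⟨le_rfl, ht₁T.le⟩ ht ht.1
    · simp only [k3, mul_zero] at hm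
      exact nonpos_of_mul_nonpos_right hm (Real.exp_pos _)
    · intro t ht
      have := mul_nonpos_of_nonneg_of_nonpos (hXnn t ⟨k1.le.trans ht.1, ht.2⟩) (hslope t ht)
      linarith
  intro t ht
  rcases le_total t t₁ with h | h
  · refine hJup t₁ ⟨k1.le, ht₁T.le⟩ ?_ t ⟨ht.1, h⟩
    intro r hr
    rcases hr.2.lt_or_eq with h | h
    · exact (k4 r hr.1 h).le
    · rw [h, k3]
  · have hm := antitoneOn_exp_mul (e * μ) (convex_Icc t₁ T)
      (fun t ht => hS.hasDerivAt_energy (t := t) (k1.le.trans ht.1)) ?_ ⟨h, ht.2⟩ ⟨ht₁T.le, le_rfl⟩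
      ht.2
    · have : 0 ≤ Real.exp (e * μ * T) * J T := mul_nonneg (Real.exp_pos _).le hJT
      exact nonneg_of_mul_nonneg_right (this.trans hm) (Real.exp_pos _)
    · intro t ht
      have : e / 2 * X t ^ 2 * D t ≤ 0 :=
        mul_nonpos_of_nonneg_of_nonpos (by positivity) (hDneg t ht)
      simp only [hD] at this
      linarith

lemma falls_of_energy_pos {μ κ b e T : ℝ} {X V W : ℝ → ℝ}
    (hS : ScaledSol μ κ b e X V W (Set.Ici 0)) (hT : 0 < T) (hXT : X T = 0)
    (hXpos : ∀ t ∈ Set.Ico 0 T, 0 < X t)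
    (hJ : ∀ t ∈ Set.Icc 0 T, 0 < shootingEnergy μ e (X t) (V t) (W t)) : Falls μ e X V W := by
  have hVT : V T < 0 := by
    have h1 := deriv_nonpos_of_pos_left hT (hS.hX T hT.le) hXT fun r h1 h2 => hXpos r ⟨h1, h2⟩
    refine lt_of_le_of_ne h1 fun h2 => ?_
    have := hJ T ⟨hT.le, le_rfl⟩
    simp [shootingEnergy, hXT, h2] at this
  have hev : ∀ᶠ t in 𝓝 T, V t < 0 := (hS.hV T hT.le).continuousAt.eventually_lt_const hVT
  obtain ⟨η, hη, hVη⟩ := Metric.eventually_nhds_iff.1 hev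
  have hV' : ∀ t ∈ Set.Icc T (T + η / 2), V t < 0 := by
    intro t ht
    refine hVη ?_
    rw [Real.dist_eq, abs_of_nonneg (by linarith [ht.1])]
    linarith [ht.2]
  have hanti : StrictAntiOn X (Set.Icc T (T + η / 2)) := by
    refine strictAntiOn_of_deriv_neg (convex_Icc _ _)
      (fun t ht => (hS.hX t (hT.le.trans ht.1)).continuousAt.continuousWithinAt) fun t ht => ?_
    rw [interior_Icc] at ht
    rw [(hS.hX t (hT.le.trans ht.1.le)).deriv]
    exact hV' t ⟨ht.1.le, ht.2.le⟩
  refine ⟨T + η / 2, by linarith, ?_, fun t ht hVt => ?_⟩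
  · have := hanti ⟨le_rfl, by linarith⟩ ⟨by linarith, le_rfl⟩ (by linarith : T < T + η / 2)
    linarith
  · have htT : t < T := by
      by_contra hn
      linarith [hV' t ⟨not_lt.1 hn, ht.2⟩]
    have hX := hXpos t ⟨ht.1, htT⟩
    refine mul_neg_of_neg_of_pos ?_ hX
    by_contra hn
    linarith [energy_neg_of_turning hX.ne' hVt (not_lt.1 hn), hJ t ⟨ht.1, htT.le⟩]

lemma energy_nonpos_of_slow {μ e X V W : ℝ} (hX : 0 ≤ X) (h1 : -(X / 2) ≤ V) (h2 : V ≤ X / 2)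
    (hm : 0 ≤ e * μ) (h : X ^ 2 + 2 * W ≤ 3 / 2) : shootingEnergy μ e X V W ≤ 0 := by
  unfold shootingEnergy
  have i1 : V ^ 2 ≤ (X / 2) ^ 2 := sq_le_sq' h1 h2
  have i2 : e * μ / 2 * (X * V) ≤ e * μ / 2 * (X * (X / 2)) := by gcongr
  have i3 : X ^ 2 * (X ^ 2 + 2 * W) ≤ X ^ 2 * (3 / 2) := by gcongr
  have i4 := mul_nonneg hm (sq_nonneg X)
  nlinarith

section Shooting

variable {μ κ b e ε : ℝ} {X V W : ℝ → ℝ}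

lemma ScaledSol.W_nonneg {T : ℝ} (hκ : 0 < κ) (he : 0 < e)
    (hS : ScaledSol μ κ b e X V W (Set.Ici 0)) (hW0 : W 0 = 0) (hT : 0 ≤ T) : 0 ≤ W T := by
  have hm := monotoneOn_exp_mul (e * b) (convex_Icc 0 T) (fun t ht => hS.hW t ht.1) ?_
    ⟨le_rfl, hT⟩ ⟨hT, le_rfl⟩ hT
  · simp only [hW0, mul_zero] at hm
    exact nonneg_of_mul_nonneg_right hm (Real.exp_pos _)
  · intro t ht
    have : 0 ≤ e * κ * X t ^ 2 := by positivity
    linarith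

lemma ScaledSol.V_le {T : ℝ} (hμ : 0 < μ) (hκ : 0 < κ) (he : 0 < e) (hε : 0 < ε)
    (hS : ScaledSol μ κ b e X V W (Set.Ici 0)) (hX0 : X 0 = ε) (hV0 : V 0 = ε) (hW0 : W 0 = 0)
    (hX : ∀ t ∈ Set.Icc 0 T, 0 ≤ X t) : ∀ t ∈ Set.Icc 0 T, V t ≤ 2 * X t := by
  intro t ht
  have hm := antitoneOn_exp_mul (y := fun t => V t - 2 * X t) (2 + e * μ) (convex_Icc 0 T)
    (fun t ht => (hS.hV t ht.1).fun_sub ((hS.hX t ht.1).const_mul 2)) ?_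
    ⟨le_rfl, ht.1.trans ht.2⟩ ht ht.1
  · simp only [mul_zero, Real.exp_zero, one_mul, hX0, hV0] at hm
    have := nonpos_of_mul_nonpos_right (hm.trans (by linarith)) (Real.exp_pos _)
    linarith
  · intro t ht
    have h1 := hX t ht
    have h2 := hS.W_nonneg hκ he hW0 ht.1
    have h3 : 0 ≤ X t * (X t ^ 2 + W t) := by positivity
    have h4 : 0 ≤ e * μ * X t := by positivity
    linarith

/-- As long as `W` is dominated by `X ^ 2`, the energy is at least a multiple of `X ^ 4`. -/
lemma ScaledSol.energy_ge {T : ℝ} (hμ : 0 < μ) (hκ : 0 < κ) (he : 0 < e) (hε : 0 < ε)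
    (ha : 0 < κ - μ / 2) (heμ : e * μ ≤ 1 / 50) (hea : e * (κ - μ / 2) ≤ 10)
    (hS : ScaledSol μ κ b e X V W (Set.Ici 0)) (hX0 : X 0 = ε) (hV0 : V 0 = ε) (hW0 : W 0 = 0)
    (hX : ∀ t ∈ Set.Icc 0 T, 0 ≤ X t)
    (hW : ∀ t ∈ Set.Icc 0 T, b * W t ≤ (κ - μ / 2) / 2 * X t ^ 2) :
    ∀ t ∈ Set.Icc 0 T,
      e * (κ - μ / 2) / 40 * X t ^ 4 ≤ shootingEnergy μ e (X t) (V t) (W t) := by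
  intro t ht
  have hm := monotoneOn_exp_mul
    (y := fun t => shootingEnergy μ e (X t) (V t) (W t) - e * (κ - μ / 2) / 40 * X t ^ 4)
    (e * μ) (convex_Icc 0 T)
    (fun t ht => (hS.hasDerivAt_energy (t := t) ht.1).fun_sub
      (((hS.hX t ht.1).fun_pow 4).const_mul (e * (κ - μ / 2) / 40))) ?_
    ⟨le_rfl, ht.1.trans ht.2⟩ ht ht.1
  · simp only [mul_zero, Real.exp_zero, one_mul] at hm
    have h0 : 0 ≤ shootingEnergy μ e (X 0) (V 0) (W 0) - e * (κ - μ / 2) / 40 * X 0 ^ 4 := by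
      simp only [hX0, hV0, hW0, shootingEnergy]
      have : e * (κ - μ / 2) / 40 * ε ^ 4 ≤ 10 / 40 * ε ^ 4 := by gcongr
      linarith
    have := nonneg_of_mul_nonneg_right (h0.trans hm) (Real.exp_pos _)
    linarith
  · intro t ht
    have hXt := hX t ht
    have i1 := hS.V_le hμ hκ he hε hX0 hV0 hW0 hX t ht
    have i2 : X t ^ 3 * V t ≤ X t ^ 3 * (2 * X t) := by gcongr
    have i3 : e / 2 * X t ^ 2 * (b * W t) ≤ e / 2 * X t ^ 2 * ((κ - μ / 2) / 2 * X t ^ 2) := by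
      have := hW t ht
      gcongr
    have i4 : e * (κ - μ / 2) / 40 * (4 * (X t ^ 3 * V t))
        ≤ e * (κ - μ / 2) / 40 * (4 * (X t ^ 3 * (2 * X t))) := by gcongr
    have i5 : e * μ * (e * (κ - μ / 2) / 40 * X t ^ 4)
        ≤ 1 / 50 * (e * (κ - μ / 2) / 40 * X t ^ 4) := by gcongr
    have i6 : 0 ≤ e * (κ - μ / 2) / 40 * X t ^ 4 := by positivity
    push_cast
    linarith

lemma ScaledSol.first_phase (hμ : 0 < μ) (hκ : 0 < κ) (hb : 0 < b) (he : 0 < e) (hε : 0 < ε)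
    (hε1 : ε ≤ 1) (ha : 0 < κ - μ / 2) (heμ : e * μ ≤ 1 / 50) (heκ : e * κ ≤ 1 / 10)
    (hbκ : e * (b * κ) ≤ (κ - μ / 2) / 2)
    (hS : ScaledSol μ κ b e X V W (Set.Ici 0)) (hX0 : X 0 = ε) (hV0 : V 0 = ε) (hW0 : W 0 = 0) :
    ∃ t₁, 0 < t₁ ∧ X t₁ = 11 / 10 ∧ ∀ t ∈ Set.Icc 0 t₁,
      0 < X t ∧ X t ≤ 11 / 10 ∧ W t ≤ e * κ * X t ^ 2 := by
  have hXge : ∀ s, (∀ t ∈ Set.Icc 0 s, X t / 2 ≤ V t) → ∀ t ∈ Set.Icc 0 s, ε ≤ X t := by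
    intro s hs t ht
    have hm := monotoneOn_exp_mul (-(1 / 2)) (convex_Icc 0 s) (fun t ht => hS.hX t ht.1)
      (fun t ht => by linarith [hs t ht]) ⟨le_rfl, ht.1.trans ht.2⟩ ht ht.1
    simp only [mul_zero, Real.exp_zero, one_mul, hX0] at hm
    have hXp : ∀ t ∈ Set.Icc 0 s, 0 ≤ X t := by
      intro t ht
      have hm := monotoneOn_exp_mul (-(1 / 2)) (convex_Icc 0 s) (fun t ht => hS.hX t ht.1)
        (fun t ht => by linarith [hs t ht]) ⟨le_rfl, ht.1.trans ht.2⟩ ht ht.1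
      simp only [mul_zero, Real.exp_zero, one_mul, hX0] at hm
      exact nonneg_of_mul_nonneg_right (hε.le.trans hm) (Real.exp_pos _)
    have hm2 := monotoneOn_of_hasDerivAt (convex_Icc 0 s) (fun t ht => hS.hX t ht.1)
      (fun t ht => by linarith [hs t ht, hXp t ht]) ⟨le_rfl, ht.1.trans ht.2⟩ ht ht.1
    rwa [hX0] at hm2
  have hWle : ∀ s, (∀ t ∈ Set.Icc 0 s, X t / 2 ≤ V t) →
      ∀ t ∈ Set.Icc 0 s, W t ≤ e * κ * X t ^ 2 := by
    intro s hs t ht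
    have hm := antitoneOn_of_hasDerivAt (y := fun t => W t - e * κ * X t ^ 2) (convex_Icc 0 s)
      (fun t ht => (hS.hW t ht.1).fun_sub (((hS.hX t ht.1).fun_pow 2).const_mul (e * κ)))
      ?_ ⟨le_rfl, ht.1.trans ht.2⟩ ht ht.1
    · simp only [hX0, hW0] at hm
      have : 0 ≤ e * κ * ε ^ 2 := by positivity
      linarith
    · intro t ht
      have i1 := hS.W_nonneg hκ he hW0 ht.1
      have i2 := hε.le.trans (hXge s hs t ht)
      have i3 : e * κ * (X t * (X t / 2)) ≤ e * κ * (X t * V t) := by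
        have := hs t ht
        gcongr
      have i4 : 0 ≤ e * (b * W t) := by positivity
      push_cast
      linarith
  have key : ∀ T, (∀ t ∈ Set.Icc 0 T, X t ≤ 11 / 10) → ∀ t ∈ Set.Icc 0 T, X t / 2 ≤ V t := by
    intro T hT t ht
    by_contra hn
    obtain ⟨s, h1, h2, h3, h4⟩ := exists_first_zero (h := fun t => V t - X t / 2) ht.1
      (fun r hr => ((hS.hV r hr.1).fun_sub ((hS.hX r hr.1).div_const 2)).continuousAt.continuousWithinAt)
      (by rw [hV0, hX0]; linarith) (by linarith [not_le.1 hn])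
    have hs : ∀ t ∈ Set.Icc 0 s, X t / 2 ≤ V t := by
      intro t ht
      rcases ht.2.lt_or_eq with h | h
      · linarith [h4 t ht.1 h]
      · rw [h]
        linarith
    have hXs := hXge s hs
    have hss : s ∈ Set.Icc 0 s := ⟨h1.le, le_rfl⟩
    have hJ := hS.energy_ge (T := s) (b := b) hμ hκ he hε ha heμ (by nlinarith) hX0 hV0 hW0
      (fun t ht => hε.le.trans (hXs t ht)) ?_ s hss
    · have i1 : X s ^ 2 ≤ (11 / 10) ^ 2 := by
        have := hT s ⟨h1.le, h2.trans ht.2⟩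
        have := hε.le.trans (hXs s hss)
        gcongr
      have i2 : e * κ * X s ^ 2 ≤ 1 / 10 * (11 / 10) ^ 2 := by gcongr
      have i3 := hε.trans_le (hXs s hss)
      have := energy_nonpos_of_slow (μ := μ) (e := e) i3.le (by linarith) (by linarith : V s ≤ X s / 2)
        (by positivity) (by linarith [hWle s hs s hss] : X s ^ 2 + 2 * W s ≤ 3 / 2)
      have : 0 < e * (κ - μ / 2) / 40 * X s ^ 4 := by positivity
      linarith
    · intro t ht
      have i1 : b * W t ≤ b * (e * κ * X t ^ 2) := by
        have := hWle s hs t ht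
        gcongr
      have i2 := mul_le_mul_of_nonneg_right hbκ (sq_nonneg (X t))
      linarith
  have hex : ∃ t, 0 ≤ t ∧ 11 / 10 ≤ X t := by
    by_contra hn
    push Not at hn
    have hT : (0 : ℝ) ≤ 4 / ε := by positivity
    have hk := key (4 / ε) fun t ht => (hn t ht.1).le
    have hm := monotoneOn_of_hasDerivAt (y := fun t => X t - ε / 2 * t) (convex_Icc 0 (4 / ε))
      (fun t ht => (hS.hX t ht.1).fun_sub ((hasDerivAt_id t).const_mul (ε / 2)))
      (fun t ht => by linarith [hk t ht, hXge _ hk t ht]) ⟨le_rfl, hT⟩ ⟨hT, le_rfl⟩ hT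
    have h2 : ε / 2 * (4 / ε) = 2 := by field_simp; norm_num
    simp only [hX0, h2] at hm
    linarith [hn _ hT]
  obtain ⟨t, ht0, ht⟩ := hex
  obtain ⟨t₁, h1, h2, h3, h4⟩ := exists_first_zero (h := fun t => 11 / 10 - X t) ht0
    (fun r hr => ((hS.hX r hr.1).const_sub _).continuousAt.continuousWithinAt)
    (by rw [hX0]; linarith) (by linarith)
  have hle : ∀ t ∈ Set.Icc 0 t₁, X t ≤ 11 / 10 := by
    intro t ht
    rcases ht.2.lt_or_eq with h | h
    · linarith [h4 t ht.1 h]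
    · rw [h]
      linarith
  have hk := key t₁ hle
  exact ⟨t₁, h1, by linarith, fun t ht =>
    ⟨hε.trans_le (hXge _ hk t ht), hle t ht, hWle _ hk t ht⟩⟩

end Shooting

section Shooting

variable {μ κ b e ε : ℝ} {X V W : ℝ → ℝ}

lemma ScaledSol.second_phase {t₁ : ℝ} (hμ : 0 < μ) (hκ : 0 < κ) (hb : 0 < b) (he : 0 < e)
    (heμ : e * μ ≤ 1 / 50) (hS : ScaledSol μ κ b e X V W (Set.Ici 0)) (hW0 : W 0 = 0)
    (ht₁ : 0 < t₁) (hX₁ : X t₁ = 11 / 10) (hV₁ : V t₁ ≤ 2 * X t₁)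
    (hW₁ : W t₁ ≤ e * κ * X t₁ ^ 2) :
    ∃ t₂, t₁ < t₂ ∧ X t₂ = 21 / 20 ∧ V t₂ ≤ 0 ∧ ∀ t ∈ Set.Icc t₁ t₂,
      21 / 20 ≤ X t ∧ W t ≤ e * (1500000 * κ) := by
  have hbound : ∀ s, (∀ t ∈ Set.Icc t₁ s, 21 / 20 ≤ X t) → ∀ t ∈ Set.Icc t₁ s,
      X t ≤ 11 / 10 + 23 / 10 * (t - t₁) - 1 / 25 * (t - t₁) ^ 2 := by
    intro s hs t ht
    have h0 : t₁ ∈ Set.Icc t₁ s := ⟨le_rfl, ht.1.trans ht.2⟩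
    have hZ : ∀ t ∈ Set.Icc t₁ s, V t ≤ 23 / 10 - 2 / 25 * (t - t₁) := by
      intro t ht
      have hm := antitoneOn_of_hasDerivAt (y := fun t => V t + e * μ * X t + 2 / 25 * t)
        (convex_Icc t₁ s) (fun t ht => ((hS.hV t (ht₁.le.trans ht.1)).fun_add
          ((hS.hX t (ht₁.le.trans ht.1)).const_mul (e * μ))).fun_add
          ((hasDerivAt_id t).const_mul (2 / 25))) ?_ h0 ht ht.1
      · simp only [hX₁] at hm
        have : 0 ≤ e * μ * X t := mul_nonneg (by positivity) (by linarith [hs t ht])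
        linarith
      · intro t ht
        have i1 := hs t ht
        have i2 := hS.W_nonneg hκ he hW0 (ht₁.le.trans ht.1)
        have i3 : (21 / 20 : ℝ) ^ 2 ≤ X t ^ 2 := by gcongr
        have i4 : 21 / 20 * (2 / 25) ≤ X t * (X t ^ 2 + W t - (1 + e * μ)) := by
          apply mul_le_mul i1 _ (by norm_num) (by linarith)
          linarith
        linarith
    have hm := antitoneOn_of_hasDerivAt
      (y := fun t => X t - (23 / 10 * (t - t₁) - 1 / 25 * (t - t₁) ^ 2))
      (convex_Icc t₁ s) (fun t ht => (hS.hX t (ht₁.le.trans ht.1)).fun_sub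
        ((((hasDerivAt_id t).sub_const t₁).const_mul (23 / 10)).fun_sub
          ((((hasDerivAt_id t).sub_const t₁).fun_pow 2).const_mul (1 / 25)))) ?_ h0 ht ht.1
    · simp only [hX₁] at hm
      linarith
    · intro t ht
      have := hZ t ht
      simp only [id_eq]
      push_cast
      linarith
  have hex : ∃ t, t₁ ≤ t ∧ t ≤ t₁ + 60 ∧ X t < 21 / 20 := by
    by_contra hn
    push Not at hn
    have := hbound (t₁ + 60) (fun t ht => hn t ht.1 ht.2) (t₁ + 60) ⟨by linarith, le_rfl⟩
    have := hn (t₁ + 60) (by linarith) le_rfl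
    norm_num at *
    linarith
  obtain ⟨t, k1, k2, k3⟩ := hex
  obtain ⟨t₂, h1, h2, h3, h4⟩ := exists_first_zero (h := fun t => X t - 21 / 20) k1
    (fun r hr => ((hS.hX r (ht₁.le.trans hr.1)).sub_const _).continuousAt.continuousWithinAt)
    (by rw [hX₁]; norm_num) (by linarith)
  have hge : ∀ t ∈ Set.Icc t₁ t₂, 21 / 20 ≤ X t := by
    intro t ht
    rcases ht.2.lt_or_eq with h | h
    · linarith [h4 t ht.1 h]
    · rw [h]
      linarith
  have hVt₂ := deriv_nonpos_of_pos_left h1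
    ((hS.hX t₂ (ht₁.le.trans h1.le)).sub_const (21 / 20)) h3 h4
  refine ⟨t₂, h1, by linarith, hVt₂, fun t ht => ⟨hge t ht, ?_⟩⟩
  have hm := antitoneOn_of_hasDerivAt (y := fun t => W t - e * κ * 20000 * t)
    (convex_Icc t₁ t₂) (fun t ht => (hS.hW t (ht₁.le.trans ht.1)).fun_sub
      ((hasDerivAt_id t).const_mul (e * κ * 20000))) ?_ ⟨le_rfl, h1.le⟩ ht ht.1
  · simp only at hm
    have i1 : e * κ * 20000 * (t - t₁) ≤ e * κ * 20000 * 60 := by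
      have : t - t₁ ≤ 60 := by linarith [ht.2]
      gcongr
    rw [hX₁] at hW₁
    have : 0 < e * κ := by positivity
    linarith
  · intro t ht
    have i1 := hS.W_nonneg hκ he hW0 (ht₁.le.trans ht.1)
    have i2 := hbound t₂ hge t ht
    have i3 : X t ≤ 140 := by nlinarith [ht.1, ht.2, sq_nonneg (t - t₁)]
    have i4 : X t ^ 2 ≤ 140 ^ 2 := by
      have := hge t ht
      gcongr
    have i5 : e * κ * X t ^ 2 ≤ e * κ * 20000 := by
      gcongr
      linarith
    have i6 : 0 ≤ e * (b * W t) := by positivity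
    linarith

/-- For a small parameter every shooting orbit falls through `X = 0`. -/
lemma ScaledSol.falls_of_small (hμ : 0 < μ) (hb : 0 < b) (he : 0 < e) (hε : 0 < ε)
    (hε1 : ε ≤ 1) (ha : 0 < κ - μ / 2) (heμ : e * μ ≤ 1 / 50)
    (heκ : e * (2000000 * κ) ≤ 1 / 10) (hbκ : e * (b * (2000000 * κ)) ≤ (κ - μ / 2) / 100)
    (hS : ScaledSol μ κ b e X V W (Set.Ici 0)) (hX0 : X 0 = ε) (hV0 : V 0 = ε) (hW0 : W 0 = 0) :
    Falls μ e X V W := by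
  have hκ : 0 < κ := by linarith
  have heκ0 : 0 < e * κ := by positivity
  have hbκ0 : 0 < e * (b * κ) := by positivity
  have hea : e * (κ - μ / 2) ≤ 10 := by
    have : 0 < e * μ := by positivity
    linarith
  obtain ⟨t₁, ht₁, hX₁, hP⟩ := hS.first_phase hμ hκ hb he hε hε1 ha heμ (by linarith)
    (by linarith) hX0 hV0 hW0
  have hV₁ := hS.V_le hμ hκ he hε hX0 hV0 hW0 (fun t ht => (hP t ht).1.le) t₁ ⟨ht₁.le, le_rfl⟩
  obtain ⟨t₂, h12, hX₂, hV₂, hQ⟩ := hS.second_phase hμ hκ hb he heμ hW0 ht₁ hX₁ hV₁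
    (hP t₁ ⟨ht₁.le, le_rfl⟩).2.2
  have ht₂ : 0 < t₂ := ht₁.trans h12
  have hXpos : ∀ t ∈ Set.Icc 0 t₂, 0 < X t := by
    intro t ht
    rcases le_total t t₁ with h | h
    · exact (hP t ⟨ht.1, h⟩).1
    · linarith [(hQ t ⟨h, ht.2⟩).1]
  have hJ₁ := hS.energy_ge hμ hκ he hε ha heμ hea hX0 hV0 hW0 (fun t ht => (hXpos t ht).le) (by
    intro t ht
    rcases le_total t t₁ with h | h
    · have i1 : b * W t ≤ b * (e * κ * X t ^ 2) := by
        have := (hP t ⟨ht.1, h⟩).2.2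
        gcongr
      have i2 : e * (b * κ) ≤ (κ - μ / 2) / 2 := by linarith
      have i3 := mul_le_mul_of_nonneg_right i2 (sq_nonneg (X t))
      linarith
    · obtain ⟨j1, j2⟩ := hQ t ⟨h, ht.2⟩
      have i1 : b * W t ≤ b * (e * (1500000 * κ)) := by gcongr
      have i2 : (21 / 20 : ℝ) ^ 2 ≤ X t ^ 2 := by gcongr
      have i3 : (κ - μ / 2) / 2 * (21 / 20 : ℝ) ^ 2 ≤ (κ - μ / 2) / 2 * X t ^ 2 := by gcongr
      linarith)
  set q := e ^ 2 * (b * (2000000 * κ)) with hq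
  have hq0 : 0 < q := by positivity
  have hqa : q ≤ e * (κ - μ / 2) / 100 := by
    have := mul_le_mul_of_nonneg_left hbκ he.le
    linarith
  set J : ℝ → ℝ := fun t => shootingEnergy μ e (X t) (V t) (W t) with hJdef
  set N : ℝ → ℝ := fun t => J t - q * X t ^ 2 with hN
  have hea0 : 0 < e * (κ - μ / 2) := by positivity
  have hN₂ : 0 < N t₂ := by
    have h1 := hJ₁ t₂ ⟨ht₂.le, le_rfl⟩
    simp only [hN, hJdef, hX₂] at h1 ⊢
    norm_num at h1 ⊢
    linarith
  -- While `V ≤ -X / 2`, the modified energy decays at most exponentially.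
  have hphase : ∀ s, (∀ t ∈ Set.Icc t₂ s, 0 ≤ X t ∧ V t ≤ -(X t / 2)) → ∀ t ∈ Set.Icc t₂ s,
      X t ≤ 21 / 20 ∧ W t ≤ e * (2000000 * κ) ∧
        Real.exp (e * μ * t₂) * N t₂ ≤ Real.exp (e * μ * t) * N t := by
    intro s hs
    have hXle : ∀ t ∈ Set.Icc t₂ s, X t ≤ 21 / 20 := by
      intro t ht
      have hm := antitoneOn_of_hasDerivAt (convex_Icc t₂ s)
        (fun t ht => hS.hX t (ht₂.le.trans ht.1))
        (fun t ht => by linarith [(hs t ht).1, (hs t ht).2]) ⟨le_rfl, ht.1.trans ht.2⟩ ht ht.1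
      linarith
    have hWle : ∀ t ∈ Set.Icc t₂ s, W t ≤ e * (2000000 * κ) := by
      intro t ht
      have hm := antitoneOn_of_hasDerivAt (y := fun t => W t + e * κ * X t ^ 2) (convex_Icc t₂ s)
        (fun t ht => (hS.hW t (ht₂.le.trans ht.1)).fun_add
          (((hS.hX t (ht₂.le.trans ht.1)).fun_pow 2).const_mul (e * κ))) ?_
        ⟨le_rfl, ht.1.trans ht.2⟩ ht ht.1
      · simp only [hX₂] at hm
        have i1 := (hQ t₂ ⟨h12.le, le_rfl⟩).2
        have i2 : 0 ≤ e * κ * X t ^ 2 := by positivity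
        linarith
      · intro t ht
        obtain ⟨i0, i3⟩ := hs t ht
        have i1 := hS.W_nonneg hκ he hW0 (ht₂.le.trans ht.1)
        have i2 : 0 ≤ e * (b * W t) := by positivity
        have i4 : e * κ * (X t * V t) ≤ e * κ * (X t * -(X t / 2)) := by gcongr
        push_cast
        linarith
    refine fun t ht => ⟨hXle t ht, hWle t ht, ?_⟩
    refine monotoneOn_exp_mul (y := N) (e * μ) (convex_Icc t₂ s)
      (fun t ht => (hS.hasDerivAt_energy (t := t) (ht₂.le.trans ht.1)).fun_sub
        (((hS.hX t (ht₂.le.trans ht.1)).fun_pow 2).const_mul q)) ?_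
      ⟨le_rfl, ht.1.trans ht.2⟩ ht ht.1
    intro t ht
    obtain ⟨i0, i3⟩ := hs t ht
    have i4 : q * (X t * V t) ≤ q * (X t * -(X t / 2)) := by gcongr
    have i5 : e / 2 * X t ^ 2 * (b * W t) ≤ e / 2 * X t ^ 2 * (b * (e * (2000000 * κ))) := by
      have := hWle t ht
      gcongr
    have i6 : e / 2 * X t ^ 2 * (b * (e * (2000000 * κ))) = q * X t ^ 2 / 2 := by
      rw [hq]
      ring
    have i7 : 0 ≤ e / 2 * X t ^ 2 * ((κ - μ / 2) * X t ^ 2) := by positivity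
    have i8 : e * μ * (q * X t ^ 2) ≤ 1 / 50 * (q * X t ^ 2) := by gcongr
    have i9 : 0 ≤ q * X t ^ 2 := by positivity
    simp only [hN, hJdef]
    push_cast
    linarith
  have hfast : ∀ s, t₂ ≤ s → (∀ t ∈ Set.Ico t₂ s, 0 < X t) →
      ∀ t ∈ Set.Ico t₂ s, V t ≤ -(X t / 2) := by
    intro s hs hX t ht
    by_contra hn
    have hslow : ∀ r, 0 < X r → X r ≤ 21 / 20 → W r ≤ e * (2000000 * κ) → 0 < J r →
        V r ≤ X r / 2 → V r < -(X r / 2) := by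
      intro r r1 r2 r3 r4 r5
      by_contra hn
      have i1 : X r ^ 2 ≤ (21 / 20) ^ 2 := by gcongr
      have := energy_nonpos_of_slow (μ := μ) (e := e) r1.le (not_lt.1 hn) r5 (by positivity)
        (by linarith : X r ^ 2 + 2 * W r ≤ 3 / 2)
      simp only [hJdef] at r4
      linarith
    have hstart : V t₂ < -(X t₂ / 2) := by
      refine hslow t₂ (by linarith) hX₂.le (by linarith [(hQ t₂ ⟨h12.le, le_rfl⟩).2]) ?_
        (by linarith)
      have : 0 < q * X t₂ ^ 2 := by rw [hX₂]; positivity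
      simp only [hN] at hN₂
      linarith
    obtain ⟨r, h1, h2, h3, h4⟩ := exists_first_zero (h := fun t => -V t - X t / 2) ht.1
      (fun r hr => ((hS.hV r (ht₂.le.trans hr.1)).fun_neg.fun_sub
        ((hS.hX r (ht₂.le.trans hr.1)).div_const 2)).continuousAt.continuousWithinAt)
      (by linarith) (by linarith [not_le.1 hn])
    have hXr : ∀ t ∈ Set.Icc t₂ r, 0 < X t := fun t' h' => hX t' ⟨h'.1, by linarith [h'.2, ht.2]⟩
    obtain ⟨k1, k2, k3⟩ := hphase r (fun t' h' => ⟨(hXr t' h').le, by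
      rcases h'.2.lt_or_eq with h | h
      · linarith [h4 t' h'.1 h]
      · rw [h]
        linarith⟩) r ⟨h1.le, le_rfl⟩
    have hXrr := hXr r ⟨h1.le, le_rfl⟩
    have hNr : 0 < N r := by
      have : 0 < Real.exp (e * μ * t₂) * N t₂ := mul_pos (Real.exp_pos _) hN₂
      exact pos_of_mul_pos_right (this.trans_le k3) (Real.exp_pos _).le
    have := hslow r hXrr k1 k2 (by
      have : 0 < q * X r ^ 2 := by positivity
      simp only [hN] at hNr
      linarith) (by linarith)
    linarith
  have hreach : ∃ t, t₂ ≤ t ∧ X t ≤ 0 := by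
    by_contra hn
    push Not at hn
    have hV : ∀ t, t₂ ≤ t → V t ≤ -(X t / 2) := fun t ht =>
      hfast (t + 1) (by linarith) (fun r hr => hn r hr.1) t ⟨ht, by linarith⟩
    have hph := fun t (ht : t₂ ≤ t) =>
      hphase t (fun r hr => ⟨(hn r hr.1).le, hV r hr.1⟩) t ⟨ht, le_rfl⟩
    have hX₃ : ∀ t, t₂ + 1 ≤ t → X t ≤ 7 / 10 := by
      intro t ht
      have h1 := antitoneOn_exp_mul (1 / 2) (convex_Icc t₂ (t₂ + 1))
        (fun t ht => hS.hX t (ht₂.le.trans ht.1)) (fun t ht => by linarith [hV t ht.1])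
        ⟨le_rfl, by linarith⟩ ⟨by linarith, le_rfl⟩ (by linarith : t₂ ≤ t₂ + 1)
      have h2 := antitoneOn_of_hasDerivAt (convex_Icc (t₂ + 1) t)
        (fun t ht => hS.hX t (by have := ht.1; simp; linarith))
        (fun t ht => by
          have := ht.1
          linarith [hV t (by linarith), hn t (by linarith)]) ⟨le_rfl, ht⟩ ⟨ht, le_rfl⟩ ht
      simp only [hX₂, mul_add, Real.exp_add] at h1
      rw [mul_assoc] at h1
      have h3 := le_of_mul_le_mul_left h1 (Real.exp_pos _)
      have h4 := Real.add_one_le_exp (1 / 2 * 1 : ℝ)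
      have h5 := hn (t₂ + 1) (by linarith)
      nlinarith
    set t₃ := t₂ + 1 with ht₃
    have hVm : ∀ t, t₃ ≤ t → Real.exp (e * μ * t₃) * V t₃ ≤ Real.exp (e * μ * t) * V t := by
      intro t ht
      refine monotoneOn_exp_mul (e * μ) (convex_Icc t₃ t)
        (fun t ht => hS.hV t (by have := ht.1; simp; linarith)) ?_ ⟨le_rfl, ht⟩ ⟨ht, le_rfl⟩ ht
      intro r hr
      have hr2 : t₂ ≤ r := by linarith [hr.1]
      have i1 := hn r hr2
      have i2 := hX₃ r hr.1
      have i3 : X r ^ 2 ≤ (7 / 10) ^ 2 := by gcongr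
      have i4 := (hph r hr2).2.1
      have i5 : 0 ≤ (1 + e * μ - X r ^ 2 - W r) * X r := by
        refine mul_nonneg ?_ i1.le
        have : 0 < e * μ := by positivity
        linarith
      linarith
    set c := Real.exp (e * μ * t₂) * N t₂ with hc
    have hc0 : 0 < c := mul_pos (Real.exp_pos _) hN₂
    set C := (Real.exp (e * μ * t₃) * V t₃) ^ 2 with hC
    have hupper : ∀ t, t₃ ≤ t → Real.exp (e * μ * t) * c ≤ C := by
      intro t ht
      have ht2 : t₂ ≤ t := by linarith
      have i1 := hn t ht2
      have i2 := hX₃ t ht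
      have i3 : X t ^ 2 ≤ (7 / 10) ^ 2 := by gcongr
      obtain ⟨-, i4, i5⟩ := hph t ht2
      have i6 := hV t ht2
      have hNV : N t ≤ V t ^ 2 := by
        have j1 : X t ^ 2 * (X t ^ 2 + 2 * W t) ≤ X t ^ 2 * 2 := by
          gcongr
          linarith
        have j2 : 0 ≤ e * μ * (X t * -V t) :=
          mul_nonneg (by positivity) (mul_nonneg i1.le (by linarith))
        have j3 : 0 ≤ q * X t ^ 2 := by positivity
        have j4 : 0 ≤ e * μ * X t ^ 2 := by positivity
        have j5 := sq_nonneg (V t)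
        simp only [hN, hJdef, shootingEnergy]
        linarith
      have i7 : (Real.exp (e * μ * t) * V t) ^ 2 ≤ C := by
        refine sq_le_sq.2 ?_
        have j0 : Real.exp (e * μ * t) * V t ≤ 0 :=
          mul_nonpos_of_nonneg_of_nonpos (Real.exp_pos _).le (by linarith)
        rw [abs_of_nonpos j0, abs_of_nonpos ((hVm t ht).trans j0)]
        exact neg_le_neg (hVm t ht)
      refine le_trans ?_ i7
      calc Real.exp (e * μ * t) * c ≤ Real.exp (e * μ * t) * (Real.exp (e * μ * t) * N t) := by
            gcongr
        _ ≤ Real.exp (e * μ * t) * (Real.exp (e * μ * t) * V t ^ 2) := by gcongr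
        _ = _ := by ring
    have hemu : 0 < e * μ := by positivity
    have hlim : Tendsto (fun t : ℝ => Real.exp (e * μ * t) * c) atTop atTop :=
      (Real.tendsto_exp_atTop.comp (tendsto_id.const_mul_atTop hemu)).atTop_mul_const hc0
    obtain ⟨t, ht, ht'⟩ := ((hlim.eventually_gt_atTop C).and (eventually_ge_atTop t₃)).exists
    linarith [hupper t ht']
  obtain ⟨t, k1, k2⟩ := hreach
  obtain ⟨T, h1, h2, h3, h4⟩ := exists_first_zero k1
    (fun r hr => (hS.hX r (ht₂.le.trans hr.1)).continuousAt.continuousWithinAt)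
    (by linarith) k2
  have hXT : ∀ t ∈ Set.Ico t₂ T, 0 < X t := fun t ht => h4 t ht.1 ht.2
  have hVfast : ∀ t ∈ Set.Icc t₂ T, 0 ≤ X t ∧ V t ≤ -(X t / 2) := by
    intro t ht
    rcases ht.2.lt_or_eq with h | h
    · exact ⟨(hXT t ⟨ht.1, h⟩).le, hfast T h1.le hXT t ⟨ht.1, h⟩⟩
    · rw [h, h3]
      refine ⟨le_rfl, ?_⟩
      have := deriv_nonpos_of_pos_left h1 (hS.hX T (ht₂.le.trans h1.le)) h3 h4
      linarith
  refine falls_of_energy_pos hS (ht₂.trans h1) h3 ?_ ?_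
  · intro t ht
    rcases le_total t t₂ with h | h
    · exact hXpos t ⟨ht.1, h⟩
    · exact hXT t ⟨h, ht.2⟩
  · intro t ht
    rcases le_total t t₂ with h | h
    · have i1 := hXpos t ⟨ht.1, h⟩
      have : 0 < e * (κ - μ / 2) / 40 * X t ^ 4 := by positivity
      exact this.trans_le (hJ₁ t ⟨ht.1, h⟩)
    · have k3 := (hphase T hVfast t ⟨h, ht.2⟩).2.2
      have hNr : 0 < N t := by
        have : 0 < Real.exp (e * μ * t₂) * N t₂ := mul_pos (Real.exp_pos _) hN₂
        exact pos_of_mul_pos_right (this.trans_le k3) (Real.exp_pos _).le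
      have : 0 ≤ q * X t ^ 2 := by positivity
      simp only [hN, hJdef] at hNr
      linarith

end Shooting

/-- For a large parameter the shooting orbits never reach `X = 0`. -/
lemma ScaledSol.not_falls_of_large {μ κ b e ε S : ℝ} {X V W : ℝ → ℝ} (hμ : 0 < μ) (hκ : 0 < κ)
    (hb : 0 < b) (he : 0 < e) (hε : 0 < ε) (hSe : S * (b + κ) = (1 + e * μ) * b)
    (hlarge : 4 * κ * S ≤ e ^ 2 * μ * b ^ 2) (hεS : ε ^ 2 < 2 * S)
    (hεe : ε ^ 2 * (b + 2 * κ) < 2 * b * (e * μ))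
    (hS : ScaledSol μ κ b e X V W (Set.Ici 0)) (hX0 : X 0 = ε) (hV0 : V 0 = ε) (hW0 : W 0 = 0) :
    ¬ Falls μ e X V W := by
  have hS0 : 0 < S := by
    have : 0 < S * (b + κ) := by rw [hSe]; positivity
    exact pos_of_mul_pos_left this (by linarith)
  set L : ℝ → ℝ := fun t => V t ^ 2 / 2 + (b + κ) / (4 * b) * (X t ^ 2 - S) ^ 2
    + b / (4 * κ) * (W t - κ / b * X t ^ 2) ^ 2 with hL
  have dL : ∀ t ∈ Set.Ici (0 : ℝ), HasDerivAt L
      (-(e * μ) * V t ^ 2 - 2 * X t * V t * (W t - κ / b * X t ^ 2)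
        - e * b ^ 2 / (2 * κ) * (W t - κ / b * X t ^ 2) ^ 2) t := by
    intro t ht
    have dX2 := (hS.hX t ht).fun_pow 2
    refine ((((hS.hV t ht).fun_pow 2).div_const 2).fun_add
      (((dX2.sub_const S).fun_pow 2).const_mul ((b + κ) / (4 * b)))).fun_add
      ((((hS.hW t ht).fun_sub (dX2.const_mul (κ / b))).fun_pow 2).const_mul
        (b / (4 * κ))) |>.congr_deriv ?_
    have hSv : S = (1 + e * μ) * b / (b + κ) := by
      field_simp
      linarith
    rw [hSv]
    push_cast
    field_simp
    ring
  have hpos : ∀ t, 0 ≤ t → 0 < X t ^ 2 * (2 * S - X t ^ 2) := by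
    intro t ht
    by_contra hn
    obtain ⟨s, h1, h2, h3, h4⟩ := exists_first_zero (h := fun t => X t ^ 2 * (2 * S - X t ^ 2)) ht
      (fun r hr => by
        have := (hS.hX r hr.1).continuousAt.continuousWithinAt (s := Set.Icc 0 t)
        exact (this.pow 2).mul ((this.pow 2).const_sub _))
      (by rw [hX0]; exact mul_pos (by positivity) (by linarith)) (not_lt.1 hn)
    have hle : ∀ r ∈ Set.Icc 0 s, X r ^ 2 ≤ 2 * S := by
      intro r hr
      by_contra hn
      have i1 : X r ^ 2 * (2 * S - X r ^ 2) < 0 :=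
        mul_neg_of_pos_of_neg (by linarith) (by linarith)
      rcases hr.2.lt_or_eq with h | h
      · linarith [h4 r hr.1 h]
      · rw [h] at i1
        linarith
    have hanti := antitoneOn_of_hasDerivAt (convex_Icc 0 s) (fun t ht => dL t ht.1) (by
      intro r hr
      set Q := W r - κ / b * X r ^ 2
      have i1 : 4 * κ * X r ^ 2 ≤ 2 * (e ^ 2 * μ * b ^ 2) := by
        have := mul_le_mul_of_nonneg_left (hle r hr) (by positivity : 0 ≤ 4 * κ)
        linarith
      have i2 : -(e * μ) * V r ^ 2 - 2 * X r * V r * Q - e * b ^ 2 / (2 * κ) * Q ^ 2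
          = (-(e * μ * V r + X r * Q) ^ 2
            - (2 * (e ^ 2 * μ * b ^ 2) - 4 * κ * X r ^ 2) / (4 * κ) * Q ^ 2) / (e * μ) := by
        field_simp
        ring
      rw [i2]
      refine div_nonpos_of_nonpos_of_nonneg ?_ (by positivity)
      have i3 : 0 ≤ (2 * (e ^ 2 * μ * b ^ 2) - 4 * κ * X r ^ 2) / (4 * κ) * Q ^ 2 :=
        mul_nonneg (div_nonneg (by linarith) (by positivity)) (sq_nonneg _)
      have i4 := sq_nonneg (e * μ * V r + X r * Q)
      linarith) ⟨le_rfl, h1.le⟩ ⟨h1.le, le_rfl⟩ h1.le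
    have hLs : (b + κ) / (4 * b) * S ^ 2 ≤ L s := by
      have j1 : (X s ^ 2 - S) ^ 2 = S ^ 2 := by linarith
      have j2 : 0 ≤ b / (4 * κ) * (W s - κ / b * X s ^ 2) ^ 2 := by positivity
      have j3 := sq_nonneg (V s)
      simp only [hL, j1]
      linarith
    have hL0 : L 0 < (b + κ) / (4 * b) * S ^ 2 := by
      have j1 : L 0 - (b + κ) / (4 * b) * S ^ 2
          = ε ^ 2 * (ε ^ 2 * (b + 2 * κ) + 2 * b - 2 * (S * (b + κ))) / (4 * b) := by
        simp only [hL, hX0, hV0, hW0]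
        field_simp
        ring
      have j2 : ε ^ 2 * (ε ^ 2 * (b + 2 * κ) + 2 * b - 2 * (S * (b + κ))) / (4 * b) < 0 := by
        refine div_neg_of_neg_of_pos (mul_neg_of_pos_of_neg (by positivity) ?_) (by positivity)
        rw [hSe]
        linarith
      linarith
    linarith
  rintro ⟨T, hT0, hXT, -⟩
  obtain ⟨s, h1, h2, h3, -⟩ := exists_first_zero hT0
    (fun r hr => (hS.hX r hr.1).continuousAt.continuousWithinAt) (by rw [hX0]; exact hε) hXT.le
  have := hpos s h1.le
  simp [h3] at this

/-- A bounded orbit of which `X` converges to a value below its nonzero equilibrium value converges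
to the saddle. -/
lemma TrappedFlow.tendsto_saddle {μ κ b e₁ e₂ X₁ ℓ : ℝ} (F : TrappedFlow μ κ b e₁ e₂)
    (hμ : 0 < μ) (hκ : 0 < κ) (hb : 0 < b) (p : ScaledState) (he : 0 < p.2.2.2)
    (hX₁e : X₁ ^ 2 * (b + κ) = (1 + p.2.2.2 * μ) * b) (l : Filter ℝ)
    (hl : ∀ s, Tendsto (fun t => t + s) l l) (hR : ∀ᶠ t in l, ‖F.Φ p t‖ ≤ F.R)
    (hlim : Tendsto (fun t => (F.Φ p t).1) l (𝓝 ℓ)) (hℓ : 0 ≤ ℓ) (hℓX : ℓ < X₁) :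
    Tendsto (F.Φ p) l (𝓝 (0, 0, 0, p.2.2.2)) := by
  refine (isCompact_closedBall (0 : ScaledState) F.R).tendsto_nhds_of_unique_mapClusterPt
    (hR.mono fun t ht => mem_closedBall_zero_iff.2 ht) fun q hq hcl => ?_
  obtain ⟨U, hU, hUq⟩ := mapClusterPt_iff_ultrafilter.1 hcl
  have hflow : ∀ s, Tendsto (fun t => F.Φ p (t + s)) U (𝓝 (F.Φ q s)) := by
    intro s
    have h1 : Continuous fun z : ScaledState => F.Φ z s :=
      F.cont.comp (continuous_id.prodMk continuous_const)
    have h2 := (h1.tendsto q).comp hUq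
    refine h2.congr fun t => ?_
    exact F.add p t s
  have hX : ∀ s, (F.Φ q s).1 = ℓ := fun s =>
    tendsto_nhds_unique ((continuous_fst.tendsto _).comp (hflow s)) ((hlim.comp (hl s)).mono_left hU)
  have hnorm : ∀ s, ‖F.Φ q s‖ ≤ F.R := fun s =>
    le_of_tendsto (hflow s).norm (((hl s).eventually hR).filter_mono hU)
  have hpar : q.2.2.2 = p.2.2.2 := by
    have h1 : Tendsto (fun t => (F.Φ p t).2.2.2) U (𝓝 q.2.2.2) :=
      ((continuous_snd.comp (continuous_snd.comp continuous_snd)).tendsto q).comp hUq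
    simp only [F.param] at h1
    exact tendsto_nhds_unique h1 tendsto_const_nhds
  have hS := F.sol q Set.univ fun t _ => hnorm t
  rw [hpar] at hS
  have hV : ∀ t, (F.Φ q t).2.1 = 0 := by
    intro t
    have := deriv_eq_zero_of_eq_on_Iic (hS.hX t trivial) fun s _ => hX s
    exact this
  have hBV : ∀ t, |(F.Φ q t).2.1| ≤ F.R := fun t =>
    ((norm_fst_le _).trans (norm_snd_le _)).trans (hnorm t)
  have hBW : ∀ t, |(F.Φ q t).2.2.1| ≤ F.R := fun t =>
    (((norm_fst_le _).trans (norm_snd_le _)).trans (norm_snd_le _)).trans (hnorm t)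
  have hℓ0 : ℓ = 0 := by
    by_contra hne
    have := eq_of_past_le hμ hκ hb he (lt_of_le_of_ne hℓ (Ne.symm hne)) hX₁e
      (hS.mono (Set.subset_univ _)) (fun t _ => hBV t) (fun t _ => hBW t)
      (fun t _ => (hX t).ge) (fun t _ => by rw [hX t]; exact hℓX.le) 0 le_rfl
    rw [hX 0] at this
    exact hℓX.ne this
  have hW1 := nonneg_of_bounded_past (mul_pos he hb) (t₀ := 0)
    (fun t _ => hS.hW t trivial) (fun t _ => by simp only [hX t, hℓ0]; linarith)
    (fun t _ => hBW t) 0 le_rfl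
  have hW2 := nonneg_of_bounded_past (mul_pos he hb) (t₀ := 0)
    (fun t _ => (hS.hW t trivial).fun_neg) (fun t _ => by simp only [hX t, hℓ0]; linarith)
    (fun t _ => by rw [abs_neg]; exact hBW t) 0 le_rfl
  have hX0 := hX 0
  have hV0 := hV 0
  rw [F.zero] at hW1 hW2 hX0 hV0
  refine Prod.ext (by rw [hX0, hℓ0]) (Prod.ext hV0 (Prod.ext ?_ hpar))
  exact le_antisymm (by linarith) hW1

/-- The positive equilibrium value of `X`. -/
noncomputable def eqX (μ κ b e : ℝ) : ℝ := √((1 + e * μ) * b / (b + κ))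

lemma eqX_pos {μ κ b e : ℝ} (hμ : 0 < μ) (hκ : 0 < κ) (hb : 0 < b) (he : 0 ≤ e) :
    0 < eqX μ κ b e := Real.sqrt_pos.2 (by positivity)

lemma eqX_sq {μ κ b e : ℝ} (hμ : 0 < μ) (hκ : 0 < κ) (hb : 0 < b) (he : 0 ≤ e) :
    eqX μ κ b e ^ 2 * (b + κ) = (1 + e * μ) * b := by
  rw [eqX, Real.sq_sqrt (by positivity)]
  field_simp

lemma eqX_zero_le {μ κ b e : ℝ} (hμ : 0 < μ) (hκ : 0 < κ) (hb : 0 < b) (he : 0 ≤ e) :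
    eqX μ κ b 0 ≤ eqX μ κ b e := by
  unfold eqX
  gcongr

lemma continuous_eqX (μ κ b : ℝ) : Continuous (eqX μ κ b) := by
  unfold eqX
  fun_prop

/-- The shooting energy as a function on the extended phase space. -/
noncomputable def stateEnergy (μ : ℝ) (z : ScaledState) : ℝ :=
  shootingEnergy μ z.2.2.2 z.1 z.2.1 z.2.2.1

lemma continuous_stateEnergy (μ : ℝ) : Continuous (stateEnergy μ) := by
  unfold stateEnergy shootingEnergy
  fun_prop

/-- The successive crossing times of a falling shooting orbit. -/
lemma Falls.exists_times {μ κ b e ε δ X₁ : ℝ} {X V W : ℝ → ℝ} (hμ : 0 < μ) (hb : 0 < b)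
    (he : 0 < e) (hε : 0 < ε) (ha : 0 < κ - μ / 2) (hX₁e : X₁ ^ 2 * (b + κ) = (1 + e * μ) * b)
    (hεδ : ε < δ) (hδX : 2 * δ ≤ X₁)
    (hS : ScaledSol μ κ b e X V W (Set.Ici 0)) (hX0 : X 0 = ε) (hV0 : V 0 = ε) (hW0 : W 0 = 0)
    (h : Falls μ e X V W) :
    ∃ a τ₀ τ₁ s T, 0 < a ∧ a ≤ τ₀ ∧ τ₀ ≤ τ₁ ∧ τ₁ ≤ s ∧ s ≤ T ∧ X a = δ ∧ X T = 0 ∧ V T ≤ 0 ∧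
      (∀ t ∈ Set.Icc 0 T, 0 ≤ X t ∧ 0 ≤ shootingEnergy μ e (X t) (V t) (W t)) ∧
      (∀ t ∈ Set.Icc 0 a, X t ≤ δ ∧ 0 ≤ V t) ∧
      (∀ t ∈ Set.Icc a τ₀, δ ≤ X t ∧ X t ≤ X₁) ∧
      (∀ t ∈ Set.Icc τ₀ τ₁, X₁ ≤ X t) ∧
      (∀ t ∈ Set.Icc τ₁ s, δ ≤ X t ∧ X t ≤ X₁) ∧
      (∀ t ∈ Set.Icc s T, X t ≤ X₁ / 2 ∧ V t ≤ 0) := by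
  have hκ : 0 < κ := by linarith
  obtain ⟨τ, T, hτ, hτT, hXT, hVτ, hXpos, hup, hdown⟩ := h.structure hε hS hX0 hV0
  have hJ := energy_nonneg_of_structure hμ hb he hε ha hS hX0 hV0 hW0 hτ hτT hXT hXpos hup hdown
  have hT0 : 0 < T := hτ.trans_le hτT
  have hXnn : ∀ t ∈ Set.Icc 0 T, 0 ≤ X t := by
    intro t ht
    rcases ht.2.lt_or_eq with h | h
    · exact (hXpos t ⟨ht.1, h⟩).le
    · rw [h, hXT]
  have hmono : MonotoneOn X (Set.Icc 0 τ) :=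
    monotoneOn_of_hasDerivAt (convex_Icc 0 τ) (fun t ht => hS.hX t ht.1) hup
  have hanti : AntitoneOn X (Set.Icc τ T) :=
    antitoneOn_of_hasDerivAt (convex_Icc τ T) (fun t ht => hS.hX t (hτ.le.trans ht.1)) hdown
  have hXτ : X₁ < X τ := by
    by_contra hn
    have := rising_of_le hκ hb he hε hX₁e (hS.mono fun t ht => ht.1) hX0 hV0 hW0
      (fun t ht => (hmono ht ⟨hτ.le, le_rfl⟩ ht.2).trans (not_lt.1 hn)) τ ⟨hτ.le, le_rfl⟩
    linarith [this.1]
  have hcont : ∀ c, ∀ t ≥ (0 : ℝ), ContinuousAt (fun t => c - X t) t := fun c t ht =>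
    ((hS.hX t ht).const_sub c).continuousAt
  have hcont' : ∀ c, ∀ t ≥ (0 : ℝ), ContinuousAt (fun t => X t - c) t := fun c t ht =>
    ((hS.hX t ht).sub_const c).continuousAt
  obtain ⟨a, a1, a2, a3, -⟩ := exists_first_zero (h := fun t => δ - X t) hτ.le
    (fun r hr => (hcont δ r hr.1).continuousWithinAt) (by rw [hX0]; linarith)
    (by linarith)
  obtain ⟨τ₀, b1, b2, b3, -⟩ := exists_first_zero (h := fun t => X₁ - X t) a2
    (fun r hr => (hcont X₁ r (a1.le.trans hr.1)).continuousWithinAt)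
    (by linarith) (by linarith)
  obtain ⟨τ₁, c1, c2, c3, -⟩ := exists_first_zero (h := fun t => X t - X₁) hτT
    (fun r hr => (hcont' X₁ r (hτ.le.trans hr.1)).continuousWithinAt)
    (by linarith) (by rw [hXT]; linarith)
  obtain ⟨s, d1, d2, d3, -⟩ := exists_first_zero (h := fun t => X t - X₁ / 2) c2
    (fun r hr => (hcont' (X₁ / 2) r ((hτ.trans c1).le.trans hr.1)).continuousWithinAt)
    (by linarith) (by rw [hXT]; linarith)
  have ha' : X a = δ := by linarith
  have hb' : X τ₀ = X₁ := by linarith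
  have hc' : X τ₁ = X₁ := by linarith
  have hd' : X s = X₁ / 2 := by linarith
  refine ⟨a, τ₀, τ₁, s, T, a1, b1.le, b2.trans c1.le, d1.le, d2, ha', hXT,
    hdown T ⟨hτT, le_rfl⟩, fun t ht => ⟨hXnn t ht, hJ t ht⟩, ?_, ?_, ?_, ?_, ?_⟩
  · intro t ht
    refine ⟨?_, hup t ⟨ht.1, ht.2.trans a2⟩⟩
    rw [← ha']
    exact hmono ⟨ht.1, ht.2.trans a2⟩ ⟨a1.le, a2⟩ ht.2
  · intro t ht
    have h1 : t ∈ Set.Icc 0 τ := ⟨a1.le.trans ht.1, ht.2.trans b2⟩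
    rw [← ha', ← hb']
    exact ⟨hmono ⟨a1.le, a2⟩ h1 ht.1, hmono h1 ⟨(a1.trans b1).le, b2⟩ ht.2⟩
  · intro t ht
    rcases le_total t τ with h | h
    · rw [← hb']
      exact hmono ⟨(a1.trans b1).le, b2⟩ ⟨(a1.trans b1).le.trans ht.1, h⟩ ht.1
    · rw [← hc']
      exact hanti ⟨h, ht.2.trans c2⟩ ⟨c1.le, c2⟩ ht.2
  · intro t ht
    have h1 : t ∈ Set.Icc τ T := ⟨c1.le.trans ht.1, ht.2.trans d2⟩
    have h2 := hanti h1 ⟨c1.le.trans d1.le, d2⟩ ht.2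
    have h3 := hanti ⟨c1.le, c2⟩ h1 ht.1
    exact ⟨by linarith, by linarith⟩
  · intro t ht
    have h1 : t ∈ Set.Icc τ T := ⟨(c1.trans d1).le.trans ht.1, ht.2⟩
    rw [← hd']
    exact ⟨hanti ⟨(c1.trans d1).le, d2⟩ h1 ht.1, hdown t h1⟩

lemma Ultrafilter.tendsto_or_atTop {ι : Type*} (U : Ultrafilter ι) {f : ι → ℝ} (hf : ∀ n, 0 ≤ f n) :
    (∃ L, 0 ≤ L ∧ Tendsto f U (𝓝 L)) ∨ Tendsto f U atTop := by
  by_cases h : ∃ B, ∀ᶠ n in (U : Filter ι), f n ≤ B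
  · left
    obtain ⟨B, hB⟩ := h
    have h1 : ((U.map f : Ultrafilter ℝ) : Filter ℝ) ≤ 𝓟 (Set.Icc 0 B) := by
      rw [le_principal_iff]
      exact hB.mono fun n hn => ⟨hf n, hn⟩
    obtain ⟨L, hL, hL'⟩ := isCompact_Icc.ultrafilter_le_nhds _ h1
    exact ⟨L, hL.1, hL'⟩
  · right
    push Not at h
    refine tendsto_atTop.2 fun B => ?_
    exact (h B).mono fun n hn => hn.le

section Limits

variable {μ κ b e₁ e₂ : ℝ} (F : TrappedFlow μ κ b e₁ e₂)

lemma TrappedFlow.tendsto_shift {ι : Type*} {l : Filter ι} {p : ι → ScaledState} {c s : ι → ℝ}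
    {q : ScaledState} {t : ℝ} (hq : Tendsto (fun n => F.Φ (p n) (c n)) l (𝓝 q))
    (hs : Tendsto s l (𝓝 t)) :
    Tendsto (fun n => F.Φ (p n) (c n + s n)) l (𝓝 (F.Φ q t)) := by
  refine ((F.cont.tendsto (q, t)).comp (hq.prodMk_nhds hs)).congr fun n => ?_
  exact F.add _ _ _

lemma TrappedFlow.exists_past {ι : Type*} (U : Ultrafilter ι) {p : ι → ScaledState}
    {l c : ι → ℝ} {C : Set ScaledState} (hC : IsClosed C) (hCR : ∀ z ∈ C, ‖z‖ ≤ F.R)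
    (hlc : ∀ n, l n ≤ c n) (h : ∀ᶠ n in (U : Filter ι), ∀ t ∈ Set.Icc (l n) (c n), F.Φ (p n) t ∈ C)
    (hlim : Tendsto (fun n => c n - l n) U atTop) :
    ∃ q, ∀ t ≤ 0, F.Φ q t ∈ C := by
  have h1 : ((U.map fun n => F.Φ (p n) (c n) : Ultrafilter ScaledState) : Filter ScaledState) ≤
      𝓟 (Metric.closedBall 0 F.R) := by
    rw [le_principal_iff]
    exact h.mono fun n hn => mem_closedBall_zero_iff.2 (hCR _ (hn _ ⟨hlc n, le_rfl⟩))
  obtain ⟨q, -, hq⟩ := (isCompact_closedBall (0 : ScaledState) F.R).ultrafilter_le_nhds _ h1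
  refine ⟨q, fun t ht => hC.mem_of_tendsto (F.tendsto_shift (s := fun _ => t) hq tendsto_const_nhds) ?_⟩
  filter_upwards [h, hlim.eventually_ge_atTop (-t)] with n hn hn'
  exact hn _ ⟨by linarith, by linarith⟩

lemma TrappedFlow.energy_neg_of_const_past (hμ : 0 < μ) (hκ : 0 < κ) (hb : 0 < b) (he₁ : 0 < e₁)
    {q : ScaledState} (hR : ∀ t ≤ 0, ‖F.Φ q t‖ ≤ F.R)
    (he : e₁ ≤ q.2.2.2) (hX : ∀ t ≤ 0, (F.Φ q t).1 = eqX μ κ b q.2.2.2) :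
    stateEnergy μ q < 0 := by
  have he0 : 0 < q.2.2.2 := he₁.trans_le he
  have hS := F.sol q (Set.Iic 0) fun t ht => hR t ht
  obtain ⟨h1, h2⟩ := rest_of_const_past hS hX
  have h3 := hX 0 le_rfl
  have hp := eqX_pos hμ hκ hb he0.le
  rw [F.zero] at h1 h2 h3
  refine energy_neg_of_turning (by rw [h3]; exact hp.ne') h1 ?_
  rw [h3]
  rcases mul_eq_zero.1 h2 with h | h
  · exact h.ge
  · exact absurd h hp.ne'

lemma TrappedFlow.not_past_ge (hμ : 0 < μ) (hκ : 0 < κ) (hb : 0 < b) (he₁ : 0 < e₁)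
    {q : ScaledState} :
    ¬ ∀ t ≤ 0, F.Φ q t ∈ {z : ScaledState | ‖z‖ ≤ F.R ∧ e₁ ≤ z.2.2.2 ∧ 0 ≤ stateEnergy μ z ∧
      eqX μ κ b z.2.2.2 ≤ z.1} := by
  intro h
  simp only [Set.mem_ofPred_eq, F.param] at h
  obtain ⟨-, he, hJ, -⟩ := h 0 le_rfl
  have he0 : 0 < q.2.2.2 := he₁.trans_le he
  have hS := F.sol q (Set.Iic 0) fun t ht => (h t ht).1
  have hX := eq_of_past_ge hμ hκ hb he0 (eqX_pos hμ hκ hb he0.le) (eqX_sq hμ hκ hb he0.le) hS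
    (fun t ht => (norm_fst_le _).trans (h t ht).1)
    (fun t ht => ((norm_fst_le _).trans (norm_snd_le _)).trans (h t ht).1)
    (fun t ht => (((norm_fst_le _).trans (norm_snd_le _)).trans (norm_snd_le _)).trans (h t ht).1)
    (fun t ht => (h t ht).2.2.2)
  have := F.energy_neg_of_const_past hμ hκ hb he₁ (fun t ht => (h t ht).1) he hX
  rw [F.zero] at hJ
  linarith

lemma TrappedFlow.not_past_le (hμ : 0 < μ) (hκ : 0 < κ) (hb : 0 < b) (he₁ : 0 < e₁)
    {q : ScaledState} {δ : ℝ} (hδ : 0 < δ) :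
    ¬ ∀ t ≤ 0, F.Φ q t ∈ {z : ScaledState | ‖z‖ ≤ F.R ∧ e₁ ≤ z.2.2.2 ∧ 0 ≤ stateEnergy μ z ∧
      δ ≤ z.1 ∧ z.1 ≤ eqX μ κ b z.2.2.2} := by
  intro h
  simp only [Set.mem_ofPred_eq, F.param] at h
  obtain ⟨-, he, hJ, -⟩ := h 0 le_rfl
  have he0 : 0 < q.2.2.2 := he₁.trans_le he
  have hS := F.sol q (Set.Iic 0) fun t ht => (h t ht).1
  have hX := eq_of_past_le hμ hκ hb he0 hδ (eqX_sq hμ hκ hb he0.le) hS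
    (fun t ht => ((norm_fst_le _).trans (norm_snd_le _)).trans (h t ht).1)
    (fun t ht => (((norm_fst_le _).trans (norm_snd_le _)).trans (norm_snd_le _)).trans (h t ht).1)
    (fun t ht => (h t ht).2.2.2.1) (fun t ht => (h t ht).2.2.2.2)
  have := F.energy_neg_of_const_past hμ hκ hb he₁ (fun t ht => (h t ht).1) he hX
  rw [F.zero] at hJ
  linarith

lemma isClosed_past_ge (R : ℝ) :
    IsClosed {z : ScaledState | ‖z‖ ≤ R ∧ e₁ ≤ z.2.2.2 ∧ 0 ≤ stateEnergy μ z ∧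
      eqX μ κ b z.2.2.2 ≤ z.1} := by
  have h1 := continuous_stateEnergy μ
  have h2 := continuous_eqX μ κ b
  refine (isClosed_le (by fun_prop) (by fun_prop)).and ((isClosed_le (by fun_prop) (by fun_prop)).and
    ((isClosed_le (by fun_prop) (by fun_prop)).and (isClosed_le (by fun_prop) (by fun_prop))))

end Limits

/-- An orbit on the invariant line `X = V = 0` at some time stays on it. -/
lemma eq_zero_of_eq_zero_later {μ κ b e R T : ℝ} {X V W : ℝ → ℝ} (heμ : 0 ≤ e * μ)
    (hT : 0 ≤ T) (hS : ScaledSol μ κ b e X V W (Set.Icc 0 T))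
    (hXR : ∀ t ∈ Set.Icc 0 T, |X t| ≤ R) (hWR : ∀ t ∈ Set.Icc 0 T, |W t| ≤ R)
    (hX : X T = 0) (hV : V T = 0) : X 0 = 0 := by
  have hm := monotoneOn_exp_mul (y := fun t => X t ^ 2 + V t ^ 2)
    (2 + 3 * (e * μ) + R ^ 2 + R) (convex_Icc 0 T)
    (fun t ht => ((hS.hX t ht).fun_pow 2).fun_add ((hS.hV t ht).fun_pow 2)) ?_
    ⟨le_rfl, hT⟩ ⟨hT, le_rfl⟩ hT
  · simp only [hX, hV, mul_zero, Real.exp_zero, one_mul] at hm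
    nlinarith [sq_nonneg (X 0), sq_nonneg (V 0)]
  · intro t ht
    have h1 := abs_le.1 (hXR t ht)
    have h2 := abs_le.1 (hWR t ht)
    have h3 : X t ^ 2 ≤ R ^ 2 := sq_le_sq' h1.1 h1.2
    push_cast
    set g := 2 + e * μ - X t ^ 2 - W t with hg
    set C := 2 + e * μ + R ^ 2 + R with hC
    have hgC : |g| ≤ C := by
      rw [abs_le]
      constructor <;> nlinarith [sq_nonneg (X t), sq_nonneg R]
    have h4 : -(C * (X t ^ 2 + V t ^ 2)) ≤ 2 * (g * (X t * V t)) := by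
      have i1 := abs_le.1 hgC
      have i2 : 0 ≤ (C + g) * (X t + V t) ^ 2 := mul_nonneg (by linarith) (sq_nonneg _)
      have i3 : 0 ≤ (C - g) * (X t - V t) ^ 2 := mul_nonneg (by linarith) (sq_nonneg _)
      linarith
    have h5 : 0 ≤ e * μ * X t ^ 2 := mul_nonneg heμ (sq_nonneg _)
    have : 2 * X t ^ (2 - 1) * V t + 2 * V t ^ (2 - 1) *
        (-(e * μ) * V t + (1 + e * μ - X t ^ 2 - W t) * X t) +
        (2 + 3 * (e * μ) + R ^ 2 + R) * (X t ^ 2 + V t ^ 2) =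
        2 * (g * (X t * V t)) + C * (X t ^ 2 + V t ^ 2) + 2 * (e * μ * X t ^ 2) := by
      rw [hg, hC]
      norm_num
      ring
    rw [this]
    linarith

/-- The initial point of a shooting orbit. -/
def shot (ε e : ℝ) : ScaledState := (ε, ε, 0, e)

section Limits

variable {μ κ b e₁ e₂ : ℝ} (F : TrappedFlow μ κ b e₁ e₂)

/-- The shooting orbit with the given data falls. -/
def TrappedFlow.FallsFrom (ε e : ℝ) : Prop :=
  Falls μ e (fun t => (F.Φ (shot ε e) t).1) (fun t => (F.Φ (shot ε e) t).2.1)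
    (fun t => (F.Φ (shot ε e) t).2.2.1)

lemma TrappedFlow.sol_shot {ε e : ℝ} (hε : 0 ≤ ε) (hε1 : ε ≤ 1) (he : e ∈ Set.Icc e₁ e₂) :
    ScaledSol μ κ b e (fun t => (F.Φ (shot ε e) t).1) (fun t => (F.Φ (shot ε e) t).2.1)
      (fun t => (F.Φ (shot ε e) t).2.2.1) (Set.Ici 0) :=
  F.sol (shot ε e) (Set.Ici 0) fun t ht => F.trapped ε e hε hε1 he.1 he.2 t ht

lemma isClosed_past_le (R δ : ℝ) :
    IsClosed {z : ScaledState | ‖z‖ ≤ R ∧ e₁ ≤ z.2.2.2 ∧ 0 ≤ stateEnergy μ z ∧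
      δ ≤ z.1 ∧ z.1 ≤ eqX μ κ b z.2.2.2} := by
  have h1 := continuous_stateEnergy μ
  have h2 := continuous_eqX μ κ b
  refine (isClosed_le (by fun_prop) (by fun_prop)).and ((isClosed_le (by fun_prop) (by fun_prop)).and
    ((isClosed_le (by fun_prop) (by fun_prop)).and ((isClosed_le (by fun_prop) (by fun_prop)).and
      (isClosed_le (by fun_prop) (by fun_prop)))))

lemma TrappedFlow.tendsto_duration {ι : Type*} (U : Ultrafilter ι) {p : ι → ScaledState}
    {l c : ι → ℝ} {C : Set ScaledState} (hC : IsClosed C) (hCR : ∀ z ∈ C, ‖z‖ ≤ F.R)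
    (hlc : ∀ n, l n ≤ c n) (h : ∀ n, ∀ t ∈ Set.Icc (l n) (c n), F.Φ (p n) t ∈ C)
    (hnot : ∀ q, ¬ ∀ t ≤ 0, F.Φ q t ∈ C) :
    ∃ L, 0 ≤ L ∧ Tendsto (fun n => c n - l n) U (𝓝 L) := by
  rcases Ultrafilter.tendsto_or_atTop U (f := fun n => c n - l n)
    (fun n => sub_nonneg.2 (hlc n)) with h1 | h1
  · exact h1
  · obtain ⟨q, hq⟩ := F.exists_past U hC hCR hlc (Eventually.of_forall h) h1
    exact absurd hq (hnot q)

lemma TrappedFlow.tendsto_atBot_saddle (hμ : 0 < μ) (hκ : 0 < κ) (hb : 0 < b) {q : ScaledState}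
    {δ : ℝ} (he : 0 < q.2.2.2) (hR : ∀ t, ‖F.Φ q t‖ ≤ F.R) (hδ : δ < eqX μ κ b q.2.2.2)
    (h : ∀ t ≤ 0, 0 ≤ (F.Φ q t).1 ∧ (F.Φ q t).1 ≤ δ ∧ 0 ≤ (F.Φ q t).2.1) :
    Tendsto (F.Φ q) atBot (𝓝 (0, 0, 0, q.2.2.2)) := by
  have hS := F.sol q (Set.Iic 0) fun t _ => hR t
  have hm : MonotoneOn (fun t => (F.Φ q t).1) (Set.Iic 0) :=
    monotoneOn_of_hasDerivAt (convex_Iic 0) hS.hX fun t ht => (h t ht).2.2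
  have hm' : Monotone fun t => (F.Φ q (min t 0)).1 := fun s t hst =>
    hm (min_le_right s 0) (min_le_right t 0) (min_le_min_right 0 hst)
  have hb' : BddBelow (Set.range fun t => (F.Φ q (min t 0)).1) := by
    refine ⟨0, ?_⟩
    rintro _ ⟨t, rfl⟩
    exact (h _ (min_le_right t 0)).1
  have hl := tendsto_atBot_ciInf hm' hb'
  refine F.tendsto_saddle hμ hκ hb q he (eqX_sq hμ hκ hb he.le) atBot
    (fun s => tendsto_atBot_add_const_right _ s tendsto_id) (Eventually.of_forall hR)
    (hl.congr' ?_) (le_ciInf fun t => (h _ (min_le_right t 0)).1)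
    ((ciInf_le hb' 0).trans_lt ((h _ (min_le_right 0 0)).2.1.trans_lt hδ))
  filter_upwards [eventually_le_atBot 0] with t ht
  rw [min_eq_left ht]

lemma TrappedFlow.tendsto_atTop_saddle (hμ : 0 < μ) (hκ : 0 < κ) (hb : 0 < b) {q : ScaledState}
    {γ : ℝ} (he : 0 < q.2.2.2) (hR : ∀ t, ‖F.Φ q t‖ ≤ F.R)
    (h : ∀ t ≥ γ, 0 ≤ (F.Φ q t).1 ∧ (F.Φ q t).1 ≤ eqX μ κ b q.2.2.2 / 2 ∧ (F.Φ q t).2.1 ≤ 0) :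
    Tendsto (F.Φ q) atTop (𝓝 (0, 0, 0, q.2.2.2)) := by
  have hS := F.sol q (Set.Ici γ) fun t _ => hR t
  have hm : AntitoneOn (fun t => (F.Φ q t).1) (Set.Ici γ) :=
    antitoneOn_of_hasDerivAt (convex_Ici γ) hS.hX fun t ht => (h t ht).2.2
  have hm' : Antitone fun t => (F.Φ q (max t γ)).1 := fun s t hst =>
    hm (le_max_right s γ) (le_max_right t γ) (max_le_max_right γ hst)
  have hb' : BddBelow (Set.range fun t => (F.Φ q (max t γ)).1) := by
    refine ⟨0, ?_⟩
    rintro _ ⟨t, rfl⟩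
    exact (h _ (le_max_right t γ)).1
  have hl := tendsto_atTop_ciInf hm' hb'
  have hp := eqX_pos hμ hκ hb he.le
  refine F.tendsto_saddle hμ hκ hb q he (eqX_sq hμ hκ hb he.le) atTop
    (fun s => tendsto_atTop_add_const_right _ s tendsto_id) (Eventually.of_forall hR)
    (hl.congr' ?_) (le_ciInf fun t => (h _ (le_max_right t γ)).1)
    ((ciInf_le hb' γ).trans_lt ((h _ (le_max_right γ γ)).2.1.trans_lt (by linarith)))
  filter_upwards [eventually_ge_atTop γ] with t ht
  rw [max_eq_left ht]

/-- The set of states which are not degenerate turning points. -/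
def regularStates (μ : ℝ) : Set ScaledState :=
  {z | z.2.1 ≠ 0 ∨ (1 + z.2.2.2 * μ - z.1 ^ 2 - z.2.2.1) * z.1 < 0}

lemma isOpen_regularStates (μ : ℝ) : IsOpen (regularStates μ) :=
  IsOpen.union (s₁ := {z : ScaledState | z.2.1 ≠ 0})
    (s₂ := {z | (1 + z.2.2.2 * μ - z.1 ^ 2 - z.2.2.1) * z.1 < 0})
    (isOpen_ne_fun (by fun_prop) continuous_const) (isOpen_lt (by fun_prop) (by fun_prop))

/-- Shooting orbits whose rising parts end close to a falling limit orbit fall as well. -/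
lemma TrappedFlow.eventually_fallsFrom {ι : Type*} {l : Filter ι} (hμ : 0 < μ) (hκ : 0 < κ)
    (hb : 0 < b) (he₁ : 0 < e₁) {ε e a : ι → ℝ} {q : ScaledState} {T : ℝ}
    (hε : ∀ n, 0 < ε n) (hε1 : ∀ n, ε n ≤ 1) (he : ∀ n, e n ∈ Set.Icc e₁ e₂) (ha : ∀ n, 0 ≤ a n)
    (hq : Tendsto (fun n => F.Φ (shot (ε n) (e n)) (a n)) l (𝓝 q))
    (hrise : ∀ᶠ n in l, ∀ t ∈ Set.Icc 0 (a n), (F.Φ (shot (ε n) (e n)) t).1 ≤ eqX μ κ b (e n))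
    (hT : 0 ≤ T) (hXT : (F.Φ q T).1 < 0) (hreg : ∀ t ∈ Set.Icc 0 T, F.Φ q t ∈ regularStates μ) :
    ∀ᶠ n in l, F.FallsFrom (ε n) (e n) := by
  have h1 : ∀ᶠ z in 𝓝 q, ∀ t ∈ Set.Icc 0 T, F.Φ z t ∈ regularStates μ := by
    refine isCompact_Icc.eventually_forall_of_forall_eventually fun t ht => ?_
    exact F.cont.continuousAt.eventually ((isOpen_regularStates μ).mem_nhds (hreg t ht))
  have h2 : ∀ᶠ z in 𝓝 q, (F.Φ z T).1 < 0 := by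
    have hc : Continuous fun z => (F.Φ z T).1 :=
      continuous_fst.comp (F.cont.comp (continuous_id.prodMk continuous_const))
    exact hc.continuousAt.eventually_lt_const hXT
  filter_upwards [hq.eventually h1, hq.eventually h2, hrise] with n k1 k2 k3
  rw [F.add] at k2
  refine ⟨a n + T, add_nonneg (ha n) hT, k2, fun t ht hV => ?_⟩
  have he0 : 0 < e n := he₁.trans_le (he n).1
  rcases le_total t (a n) with h | h
  · have hS := (F.sol_shot (hε n).le (hε1 n) (he n)).mono (I' := Set.Icc 0 (a n)) fun t ht => ht.1
    have := rising_of_le hκ hb he0 (hε n) (eqX_sq hμ hκ hb he0.le) hS (by simp [F.zero, shot])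
      (by simp [F.zero, shot]) (by simp [F.zero, shot]) k3 t ⟨ht.1, h⟩
    exact absurd hV this.1.ne'
  · have := k1 (t - a n) ⟨by linarith, by linarith [ht.2]⟩
    rw [F.add, add_sub_cancel] at this
    rcases this with h' | h'
    · exact absurd hV h'
    · simpa only [F.param, shot] using h'

/-- An orbit of nonnegative energy which reaches `X = 0` after finite time crosses it without having
degenerate turning points. -/
lemma TrappedFlow.exists_crossing (hμ : 0 < μ) {q : ScaledState} {T : ℝ} (he : 0 < q.2.2.2)
    (hR : ∀ t, ‖F.Φ q t‖ ≤ F.R) (hT : 0 ≤ T) (hq : q.1 ≠ 0)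
    (h : ∀ t ∈ Set.Icc 0 T, 0 ≤ (F.Φ q t).1 ∧ 0 ≤ stateEnergy μ (F.Φ q t))
    (hXT : (F.Φ q T).1 = 0) (hVT : (F.Φ q T).2.1 ≤ 0) :
    ∃ T', 0 ≤ T' ∧ (F.Φ q T').1 < 0 ∧ ∀ t ∈ Set.Icc 0 T', F.Φ q t ∈ regularStates μ := by
  have hS := F.sol q Set.univ fun t _ => hR t
  have hne : ∀ t ≥ 0, (F.Φ q t).1 = 0 → (F.Φ q t).2.1 ≠ 0 := by
    intro t ht hX hV
    have := eq_zero_of_eq_zero_later (mul_pos he hμ).le ht (hS.mono (Set.subset_univ _))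
      (fun s _ => (norm_fst_le _).trans (hR s))
      (fun s _ => (((norm_fst_le _).trans (norm_snd_le _)).trans (norm_snd_le _)).trans (hR s)) hX hV
    rw [F.zero] at this
    exact hq this
  have hV : (F.Φ q T).2.1 < 0 := lt_of_le_of_ne hVT (hne T hT hXT)
  have hev : ∀ᶠ t in 𝓝 T, (F.Φ q t).2.1 < 0 :=
    (hS.hV T (Set.mem_univ _)).continuousAt.eventually_lt_const hV
  obtain ⟨η, hη, hVη⟩ := Metric.eventually_nhds_iff.1 hev
  have hV' : ∀ t ∈ Set.Icc T (T + η / 2), (F.Φ q t).2.1 < 0 := by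
    intro t ht
    refine hVη ?_
    rw [Real.dist_eq, abs_of_nonneg (by linarith [ht.1])]
    linarith [ht.2]
  have hanti : StrictAntiOn (fun t => (F.Φ q t).1) (Set.Icc T (T + η / 2)) := by
    refine strictAntiOn_of_deriv_neg (convex_Icc _ _)
      (fun t _ => (hS.hX t (Set.mem_univ _)).continuousAt.continuousWithinAt) fun t ht => ?_
    rw [interior_Icc] at ht
    rw [(hS.hX t (Set.mem_univ _)).deriv]
    exact hV' t ⟨ht.1.le, ht.2.le⟩
  refine ⟨T + η / 2, by linarith, ?_, fun t ht => ?_⟩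
  · have := hanti ⟨le_rfl, by linarith⟩ ⟨by linarith, le_rfl⟩ (by linarith : T < T + η / 2)
    simp only [hXT] at this
    exact this
  · by_cases hVt : (F.Φ q t).2.1 = 0
    · have htT : t < T := by
        by_contra hn
        linarith [hV' t ⟨not_lt.1 hn, ht.2⟩]
      obtain ⟨i1, i2⟩ := h t ⟨ht.1, htT.le⟩
      have hXt : (F.Φ q t).1 ≠ 0 := fun hX => hne t ht.1 hX hVt
      refine Or.inr (mul_neg_of_neg_of_pos ?_ (lt_of_le_of_ne i1 hXt.symm))
      by_contra hn
      exact absurd i2 (not_le.2 (energy_neg_of_turning hXt hVt (not_lt.1 hn)))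
    · exact Or.inl hVt

end Limits

lemma exists_switch {P : ℝ → Prop} {e₁ e₂ η : ℝ} (h12 : e₁ ≤ e₂) (h1 : P e₁) (h2 : ¬ P e₂)
    (hη : 0 < η) :
    ∃ e' ∈ Set.Icc e₁ e₂, ∃ e ∈ Set.Icc e₁ e₂, P e' ∧ ¬ P e ∧ |e' - e| < η := by
  set A := {e | e ∈ Set.Icc e₁ e₂ ∧ P e} with hA
  have hA1 : e₁ ∈ A := ⟨⟨le_rfl, h12⟩, h1⟩
  have hbd : BddAbove A := ⟨e₂, fun e he => he.1.2⟩
  obtain ⟨e', he', hlt⟩ := exists_lt_of_lt_csSup ⟨e₁, hA1⟩ (by linarith : sSup A - η / 2 < sSup A)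
  have hle : e' ≤ sSup A := le_csSup hbd he'
  have h1c : e₁ ≤ sSup A := le_csSup hbd hA1
  have hc2 : sSup A ≤ e₂ := csSup_le ⟨e₁, hA1⟩ fun e he => he.1.2
  refine ⟨e', he'.1, min e₂ (sSup A + η / 4), ⟨le_min h12 (by linarith), min_le_left _ _⟩, he'.2,
    ?_, ?_⟩
  · rcases min_choice e₂ (sSup A + η / 4) with h | h
    · rwa [h]
    · rw [h]
      intro hP
      have : sSup A + η / 4 ∈ A := ⟨⟨by linarith, by rw [← h]; exact min_le_left _ _⟩, hP⟩
      linarith [le_csSup hbd this]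
  · have i1 : min e₂ (sSup A + η / 4) ≤ sSup A + η / 4 := min_le_right _ _
    have i2 : sSup A ≤ min e₂ (sSup A + η / 4) := le_min hc2 (by linarith)
    rw [abs_lt]
    constructor <;> linarith

section Limits

variable {μ κ b e₁ e₂ : ℝ} (F : TrappedFlow μ κ b e₁ e₂)

lemma TrappedFlow.exists_homoclinic_of_seq (hμ : 0 < μ) (ha : 0 < κ - μ / 2) (hb : 0 < b)
    (he₁ : 0 < e₁) {δ : ℝ} (hδ : 0 < δ) (hδX : 2 * δ ≤ eqX μ κ b 0) {ε e' e : ℕ → ℝ}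
    (hε : ∀ n, 0 < ε n) (hεδ : ∀ n, ε n < δ) (hε1 : ∀ n, ε n ≤ 1)
    (hεlim : Tendsto ε atTop (𝓝 0)) (he' : ∀ n, e' n ∈ Set.Icc e₁ e₂)
    (he : ∀ n, e n ∈ Set.Icc e₁ e₂) (hfall : ∀ n, F.FallsFrom (ε n) (e' n))
    (hnot : ∀ n, ¬ F.FallsFrom (ε n) (e n))
    (hd : ∀ n, |e' n - e n| * Real.exp (F.K * (δ / (ε n * min 1 (3 / (4 * (e₂ * μ)))))) ≤ ε n) :
    ∃ q : ScaledState, 0 < q.2.2.2 ∧ (∀ t, ‖F.Φ q t‖ ≤ F.R) ∧ q.1 ≠ 0 ∧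
      Tendsto (F.Φ q) atBot (𝓝 (0, 0, 0, q.2.2.2)) ∧
      Tendsto (F.Φ q) atTop (𝓝 (0, 0, 0, q.2.2.2)) := by
  have hκ : 0 < κ := by linarith
  have he'0 : ∀ n, 0 < e' n := fun n => he₁.trans_le (he' n).1
  have he0 : ∀ n, 0 < e n := fun n => he₁.trans_le (he n).1
  have hδe : ∀ x, 0 ≤ x → 2 * δ ≤ eqX μ κ b x := fun x hx =>
    hδX.trans (eqX_zero_le hμ hκ hb hx)
  have hS := fun n => F.sol_shot (hε n).le (hε1 n) (he' n)
  have hYR : ∀ n, ∀ t ≥ 0, ‖F.Φ (shot (ε n) (e' n)) t‖ ≤ F.R := fun n t ht =>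
    F.trapped (ε n) (e' n) (hε n).le (hε1 n) (he' n).1 (he' n).2 t ht
  choose a τ₀ τ₁ s T ha0 haτ hττ hτs hsT hXa hXT hVT hJ hA hB hC hD hE using fun n =>
    Falls.exists_times hμ hb (he'0 n) (hε n) ha (eqX_sq hμ hκ hb (he'0 n).le) (hεδ n)
      (hδe _ (he'0 n).le) (hS n) (by simp [F.zero, shot]) (by simp [F.zero, shot])
      (by simp [F.zero, shot]) (hfall n)
  have haM : ∀ n, a n ≤ δ / (ε n * min 1 (3 / (4 * (e₂ * μ)))) := fun n =>
    time_le_of_le hμ hκ hb (he'0 n) (he' n).2 (hε n) hδ (ha0 n).le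
      (eqX_sq hμ hκ hb (he'0 n).le) (hδe _ (he'0 n).le)
      ((hS n).mono (I' := Set.Icc 0 (a n)) fun t ht => ht.1) (by simp [F.zero, shot])
      (by simp [F.zero, shot]) (by simp [F.zero, shot]) fun t ht => (hA n t ht).1
  set U : Ultrafilter ℕ := hyperfilter ℕ with hU
  have hUle : (U : Filter ℕ) ≤ atTop := by
    rw [← Nat.cofinite_eq_atTop]
    exact hyperfilter_le_cofinite
  have hεU : Tendsto ε U (𝓝 0) := hεlim.mono_left hUle
  obtain ⟨E, hEmem, hElim⟩ : ∃ E ∈ Set.Icc e₁ e₂, Tendsto e' U (𝓝 E) := by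
    refine isCompact_Icc.ultrafilter_le_nhds (U.map e') ?_
    rw [le_principal_iff]
    exact Eventually.of_forall (f := (U : Filter ℕ)) he'
  have hE0 : 0 < E := he₁.trans_le hEmem.1
  have hatop : Tendsto a U atTop := by
    rcases Ultrafilter.tendsto_or_atTop U (f := a) (fun n => (ha0 n).le) with ⟨L, -, hL⟩ | h
    · exfalso
      have hp : Tendsto (fun n => F.Φ (shot (ε n) (e' n)) 0) U (𝓝 (0, 0, 0, E)) := by
        simp only [F.zero]
        exact hεU.prodMk_nhds (hεU.prodMk_nhds (tendsto_const_nhds.prodMk_nhds hElim))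
      have h1 := (continuous_fst.tendsto _).comp (F.tendsto_shift hp hL)
      rw [F.fixed] at h1
      have h2 : Tendsto (fun _ : ℕ => δ) U (𝓝 0) := by
        refine h1.congr fun n => ?_
        simp only [Function.comp, zero_add]
        exact hXa n
      exact hδ.ne (tendsto_nhds_unique h2 tendsto_const_nhds)
    · exact h
  obtain ⟨q, -, hq⟩ : ∃ q ∈ Metric.closedBall (0 : ScaledState) F.R,
      Tendsto (fun n => F.Φ (shot (ε n) (e' n)) (a n)) U (𝓝 q) := by
    refine (isCompact_closedBall (0 : ScaledState) F.R).ultrafilter_le_nhds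
      (U.map fun n => F.Φ (shot (ε n) (e' n)) (a n)) ?_
    rw [le_principal_iff]
    exact Eventually.of_forall (f := (U : Filter ℕ)) fun n =>
      mem_closedBall_zero_iff.2 (hYR n _ (ha0 n).le)
  have hqE : q.2.2.2 = E := by
    have h1 : Tendsto (fun n => (F.Φ (shot (ε n) (e' n)) (a n)).2.2.2) U (𝓝 q.2.2.2) :=
      ((by fun_prop : Continuous fun z : ScaledState => z.2.2.2).tendsto q).comp hq
    simp only [F.param] at h1
    exact tendsto_nhds_unique h1 hElim
  have hqX : q.1 = δ := by
    have h1 : Tendsto (fun n => (F.Φ (shot (ε n) (e' n)) (a n)).1) U (𝓝 q.1) :=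
      (continuous_fst.tendsto q).comp hq
    simp only [hXa] at h1
    exact tendsto_nhds_unique h1 tendsto_const_nhds
  have hshift : ∀ t, Tendsto (fun n => F.Φ (shot (ε n) (e' n)) (a n + t)) U (𝓝 (F.Φ q t)) :=
    fun t => F.tendsto_shift (s := fun _ => t) hq tendsto_const_nhds
  have hRq : ∀ t, ‖F.Φ q t‖ ≤ F.R := by
    intro t
    refine le_of_tendsto (hshift t).norm ?_
    filter_upwards [hatop.eventually_ge_atTop (-t)] with n hn
    exact hYR n _ (by linarith)
  have hqe : 0 < q.2.2.2 := by rwa [hqE]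
  refine ⟨q, hqe, hRq, by rw [hqX]; exact hδ.ne', ?_, ?_⟩
  · refine F.tendsto_atBot_saddle hμ hκ hb hqe hRq
      (by linarith [hδe _ hqe.le] : δ < eqX μ κ b q.2.2.2) fun t ht => ?_
    have hcl : IsClosed {z : ScaledState | 0 ≤ z.1 ∧ z.1 ≤ δ ∧ 0 ≤ z.2.1} :=
      (isClosed_le (by fun_prop) (by fun_prop)).and
        ((isClosed_le (by fun_prop) (by fun_prop)).and (isClosed_le (by fun_prop) (by fun_prop)))
    refine hcl.mem_of_tendsto (hshift t) ?_
    filter_upwards [hatop.eventually_ge_atTop (-t)] with n hn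
    have h1 : a n + t ∈ Set.Icc 0 (a n) := ⟨by linarith, by linarith⟩
    have hle : a n ≤ T n := (haτ n).trans ((hττ n).trans ((hτs n).trans (hsT n)))
    exact ⟨(hJ n _ ⟨h1.1, h1.2.trans hle⟩).1, (hA n _ h1).1, (hA n _ h1).2⟩
  have hJt : ∀ n t, 0 ≤ t → t ≤ s n → 0 ≤ stateEnergy μ (F.Φ (shot (ε n) (e' n)) t) := by
    intro n t h1 h2
    have := (hJ n t ⟨h1, h2.trans (hsT n)⟩).2
    simpa only [stateEnergy, F.param, shot] using this
  have hpar : ∀ n t, (F.Φ (shot (ε n) (e' n)) t).2.2.2 = e' n := fun n t => F.param _ t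
  have hτ0 : ∀ n, 0 ≤ τ₀ n := fun n => (ha0 n).le.trans (haτ n)
  have hτ1 : ∀ n, 0 ≤ τ₁ n := fun n => (hτ0 n).trans (hττ n)
  obtain ⟨L₁, h₁, hL₁⟩ := F.tendsto_duration U (p := fun n => shot (ε n) (e' n))
    (isClosed_past_le F.R δ) (fun z hz => hz.1) haτ
    (fun n t ht => ⟨hYR n t ((ha0 n).le.trans ht.1), by rw [hpar]; exact (he' n).1,
      hJt n t ((ha0 n).le.trans ht.1) (ht.2.trans ((hττ n).trans (hτs n))), (hB n t ht).1,
      by rw [hpar]; exact (hB n t ht).2⟩)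
    (fun q => F.not_past_le hμ hκ hb he₁ hδ)
  obtain ⟨L₂, h₂, hL₂⟩ := F.tendsto_duration U (p := fun n => shot (ε n) (e' n))
    (isClosed_past_ge F.R) (fun z hz => hz.1) hττ
    (fun n t ht => ⟨hYR n t ((hτ0 n).trans ht.1), by rw [hpar]; exact (he' n).1,
      hJt n t ((hτ0 n).trans ht.1) (ht.2.trans (hτs n)), by rw [hpar]; exact hC n t ht⟩)
    (fun q => F.not_past_ge hμ hκ hb he₁)
  obtain ⟨L₃, h₃, hL₃⟩ := F.tendsto_duration U (p := fun n => shot (ε n) (e' n))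
    (isClosed_past_le F.R δ) (fun z hz => hz.1) hτs
    (fun n t ht => ⟨hYR n t ((hτ1 n).trans ht.1), by rw [hpar]; exact (he' n).1,
      hJt n t ((hτ1 n).trans ht.1) ht.2, (hD n t ht).1,
      by rw [hpar]; exact (hD n t ht).2⟩)
    (fun q => F.not_past_le hμ hκ hb he₁ hδ)
  have hsa : Tendsto (fun n => s n - a n) U (𝓝 (L₁ + L₂ + L₃)) :=
    ((hL₁.add hL₂).add hL₃).congr fun n => by ring
  have haT : ∀ n, a n ≤ T n := fun n => (haτ n).trans ((hττ n).trans ((hτs n).trans (hsT n)))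
  rcases Ultrafilter.tendsto_or_atTop U (f := fun n => T n - a n)
    (fun n => sub_nonneg.2 (haT n)) with ⟨L, hL0, hL⟩ | hTinf
  · exfalso
    have hcross : ∀ t ∈ Set.Icc 0 L, 0 ≤ (F.Φ q t).1 ∧ 0 ≤ stateEnergy μ (F.Φ q t) := by
      intro t ht
      have hc := continuous_stateEnergy μ
      have hcl : IsClosed {z : ScaledState | 0 ≤ z.1 ∧ 0 ≤ stateEnergy μ z} :=
        (isClosed_le (by fun_prop) (by fun_prop)).and (isClosed_le (by fun_prop) (by fun_prop))
      have hmin : Tendsto (fun n => min t (T n - a n)) U (𝓝 t) := by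
        have := (tendsto_const_nhds (x := t) (f := (U : Filter ℕ))).min hL
        rwa [min_eq_left ht.2] at this
      refine hcl.mem_of_tendsto (F.tendsto_shift hq hmin) (Eventually.of_forall fun n => ?_)
      have h0 : 0 ≤ min t (T n - a n) := le_min ht.1 (sub_nonneg.2 (haT n))
      have h1 := hJ n (a n + min t (T n - a n))
        ⟨by linarith [ha0 n], by linarith [min_le_right t (T n - a n)]⟩
      refine ⟨h1.1, ?_⟩
      simpa only [stateEnergy, F.param, shot] using h1.2
    have hend := F.tendsto_shift hq hL
    simp only [add_sub_cancel] at hend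
    have hXL : (F.Φ q L).1 = 0 := by
      have h1 : Tendsto (fun n => (F.Φ (shot (ε n) (e' n)) (T n)).1) U (𝓝 (F.Φ q L).1) :=
        (continuous_fst.tendsto _).comp hend
      simp only [hXT] at h1
      exact tendsto_nhds_unique h1 tendsto_const_nhds
    have hVL : (F.Φ q L).2.1 ≤ 0 := by
      refine le_of_tendsto (((continuous_fst.comp continuous_snd).tendsto _).comp hend) ?_
      exact Eventually.of_forall hVT
    obtain ⟨T', hT', hXT', hreg⟩ := F.exists_crossing hμ hqe hRq hL0
      (by rw [hqX]; exact hδ.ne') hcross hXL hVL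
    have hdist : ∀ n, ∀ t ∈ Set.Icc 0 (a n),
        dist (F.Φ (shot (ε n) (e n)) t) (F.Φ (shot (ε n) (e' n)) t) ≤ ε n := by
      intro n t ht
      refine (F.dist_le _ _ _).trans ?_
      have h1 : dist (shot (ε n) (e n)) (shot (ε n) (e' n)) = |e' n - e n| := by
        simp [shot, Prod.dist_eq, Real.dist_eq, abs_sub_comm]
      rw [h1, abs_of_nonneg ht.1]
      refine le_trans ?_ (hd n)
      have := F.K_nonneg
      gcongr
      exact ht.2.trans (haM n)
    have hq' : Tendsto (fun n => F.Φ (shot (ε n) (e n)) (a n)) U (𝓝 q) := by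
      refine hq.congr_dist ?_
      refine squeeze_zero (fun n => dist_nonneg) (fun n => ?_) hεU
      rw [dist_comm]
      exact hdist n (a n) ⟨(ha0 n).le, le_rfl⟩
    have hev := F.eventually_fallsFrom (l := (U : Filter ℕ)) hμ hκ hb he₁ hε hε1 he
      (fun n => (ha0 n).le) hq' (Eventually.of_forall fun n t ht => ?_) hT' hXT' hreg
    · obtain ⟨n, hn⟩ := hev.exists
      exact hnot n hn
    · have h1 := (Real.dist_eq _ _).symm.trans_le
        ((le_max_left _ _).trans ((Prod.dist_eq).symm.trans_le (hdist n t ht)))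
      have h2 := (abs_le.1 h1).2
      have h3 := (hA n t ht).1
      linarith [hδe _ (he0 n).le, hεδ n]
  · refine F.tendsto_atTop_saddle (γ := L₁ + L₂ + L₃ + 1) hμ hκ hb hqe hRq fun t ht => ?_
    have hc := continuous_eqX μ κ b
    have hcl : IsClosed {z : ScaledState | 0 ≤ z.1 ∧ z.1 ≤ eqX μ κ b z.2.2.2 / 2 ∧ z.2.1 ≤ 0} :=
      (isClosed_le (by fun_prop) (by fun_prop)).and
        ((isClosed_le (by fun_prop) (by fun_prop)).and (isClosed_le (by fun_prop) (by fun_prop)))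
    have hres := hcl.mem_of_tendsto (hshift t) ?_
    · simpa only [Set.mem_ofPred_eq, F.param] using hres
    filter_upwards [hTinf.eventually_ge_atTop t,
      hsa.eventually_lt_const (by linarith : L₁ + L₂ + L₃ < t)] with n h1 h2
    have h3 : a n + t ∈ Set.Icc (s n) (T n) := ⟨by linarith, by linarith⟩
    have h4 : 0 ≤ s n := (hτ1 n).trans (hτs n)
    refine ⟨(hJ n _ ⟨h4.trans h3.1, h3.2⟩).1, ?_, (hE n _ h3).2⟩
    rw [hpar]
    exact (hE n _ h3).1

lemma TrappedFlow.exists_homoclinic (hμ : 0 < μ) (ha : 0 < κ - μ / 2) (hb : 0 < b)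
    (he₁ : 0 < e₁) (h12 : e₁ ≤ e₂) {ε₀ : ℝ} (hε₀ : 0 < ε₀) (hε₀1 : ε₀ ≤ 1)
    (h1 : ∀ ε, 0 < ε → ε ≤ ε₀ → F.FallsFrom ε e₁)
    (h2 : ∀ ε, 0 < ε → ε ≤ ε₀ → ¬ F.FallsFrom ε e₂) :
    ∃ q : ScaledState, 0 < q.2.2.2 ∧ (∀ t, ‖F.Φ q t‖ ≤ F.R) ∧ q.1 ≠ 0 ∧
      Tendsto (F.Φ q) atBot (𝓝 (0, 0, 0, q.2.2.2)) ∧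
      Tendsto (F.Φ q) atTop (𝓝 (0, 0, 0, q.2.2.2)) := by
  have hκ : 0 < κ := by linarith
  have hX₀ := eqX_pos (e := 0) hμ hκ hb le_rfl
  set δ := eqX μ κ b 0 / 2 with hδ
  have hδ0 : 0 < δ := by positivity
  have hm : 0 < min ε₀ (δ / 2) := by positivity
  set ε : ℕ → ℝ := fun n => min ε₀ (δ / 2) / (n + 1) with hε
  have hε0 : ∀ n, 0 < ε n := fun n => by positivity
  have hεle : ∀ n, ε n ≤ min ε₀ (δ / 2) := fun n =>
    div_le_self hm.le (by linarith [n.cast_nonneg (α := ℝ)])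
  have hεε₀ : ∀ n, ε n ≤ ε₀ := fun n => (hεle n).trans (min_le_left _ _)
  have hlim : Tendsto ε atTop (𝓝 0) := by
    have := (tendsto_one_div_add_atTop_nhds_zero_nat (𝕜 := ℝ)).const_mul (min ε₀ (δ / 2))
    simpa [hε, div_eq_mul_inv] using this
  choose e' he' e he hP hQ hd using fun n => exists_switch (P := F.FallsFrom (ε n)) h12
    (h1 _ (hε0 n) (hεε₀ n)) (h2 _ (hε0 n) (hεε₀ n))
    (η := ε n / Real.exp (F.K * (δ / (ε n * min 1 (3 / (4 * (e₂ * μ)))))))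
    (div_pos (hε0 n) (Real.exp_pos _))
  refine F.exists_homoclinic_of_seq hμ ha hb he₁ hδ0 (by linarith) hε0
    (fun n => ((hεle n).trans (min_le_right _ _)).trans_lt (by linarith))
    (fun n => (hεε₀ n).trans hε₀1) hlim he' he hP hQ fun n => ?_
  have := (hd n).le
  rwa [le_div_iff₀ (Real.exp_pos _)] at this

end Limits

/-- The rescaled Lorenz system has a homoclinic orbit for some value of its parameter. -/
lemma exists_scaled_homoclinic {σ b : ℝ} (hσ : 0 < σ) (hb : 0 < b) (h : 2 * b + 1 < 3 * σ) :
    ∃ e X V W, 0 < e ∧ ScaledSol (σ + 1) (2 * σ - b) b e X V W Set.univ ∧ X 0 ≠ 0 ∧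
      Tendsto (fun t => (X t, V t, W t)) atTop (𝓝 (0, 0, 0)) ∧
      Tendsto (fun t => (X t, V t, W t)) atBot (𝓝 (0, 0, 0)) := by
  set μ := σ + 1 with hμ'
  set κ := 2 * σ - b with hκ'
  have hμ : 0 < μ := by positivity
  have ha : 0 < κ - μ / 2 := by linarith
  have hκ : 0 < κ := by linarith
  obtain ⟨e₁, he₁, k1, k2, k3⟩ : ∃ e, 0 < e ∧ e * μ ≤ 1 / 50 ∧ e * (2000000 * κ) ≤ 1 / 10 ∧
      e * (b * (2000000 * κ)) ≤ (κ - μ / 2) / 100 := by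
    have hev : ∀ m c : ℝ, 0 < c → ∀ᶠ e in 𝓝[>] (0 : ℝ), e * m ≤ c := by
      intro m c hc
      have hcont : Continuous fun e : ℝ => e * m := by fun_prop
      have h1 : ∀ᶠ e in 𝓝 (0 : ℝ), e * m < c :=
        hcont.continuousAt.eventually_lt_const (by simpa using hc)
      exact (h1.filter_mono nhdsWithin_le_nhds).mono fun e he => he.le
    have hpos : ∀ᶠ e in 𝓝[>] (0 : ℝ), 0 < e := self_mem_nhdsWithin
    exact (hpos.and ((hev _ _ (by norm_num)).and ((hev _ _ (by norm_num)).and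
      (hev _ _ (by positivity))))).exists
  set e₂ := e₁ + 1 + 4 * κ * (1 + μ) / (μ * b ^ 2) with he₂'
  have hq0 : 0 < 4 * κ * (1 + μ) / (μ * b ^ 2) := by positivity
  have h12 : e₁ ≤ e₂ := by linarith
  have he₂ : 0 < e₂ := he₁.trans_le h12
  set S := (1 + e₂ * μ) * b / (b + κ) with hS'
  have hS0 : 0 < S := by positivity
  have hSe : S * (b + κ) = (1 + e₂ * μ) * b := by
    rw [hS']
    field_simp
  have hlarge : 4 * κ * S ≤ e₂ ^ 2 * μ * b ^ 2 := by
    have i1 : S ≤ 1 + e₂ * μ := by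
      rw [hS', div_le_iff₀ (by positivity)]
      have : 0 < (1 + e₂ * μ) * κ := by positivity
      linarith
    have i2 : 1 + e₂ * μ ≤ e₂ * (1 + μ) := by linarith
    have i3 : 4 * κ * (1 + μ) ≤ e₂ * (μ * b ^ 2) := by
      rw [← div_le_iff₀ (by positivity)]
      linarith
    calc 4 * κ * S ≤ 4 * κ * (e₂ * (1 + μ)) := by
          gcongr
          linarith
      _ = e₂ * (4 * κ * (1 + μ)) := by ring
      _ ≤ e₂ * (e₂ * (μ * b ^ 2)) := by gcongr
      _ = _ := by ring
  set ε₀ := min 1 (min S (b * (e₂ * μ) / (b + 2 * κ))) with hε₀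
  have hε₀0 : 0 < ε₀ := by positivity
  obtain ⟨F⟩ := exists_trappedFlow (e₂ := e₂) hσ hb he₁
  have hfall : ∀ ε, 0 < ε → ε ≤ ε₀ → F.FallsFrom ε e₁ := by
    intro ε hε hεε
    have hε1 : ε ≤ 1 := hεε.trans (min_le_left _ _)
    exact (F.sol_shot hε.le hε1 ⟨le_rfl, h12⟩).falls_of_small hμ hb he₁ hε hε1 ha k1 k2 k3
      (by simp [F.zero, shot]) (by simp [F.zero, shot]) (by simp [F.zero, shot])
  have hnot : ∀ ε, 0 < ε → ε ≤ ε₀ → ¬ F.FallsFrom ε e₂ := by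
    intro ε hε hεε
    have hε1 : ε ≤ 1 := hεε.trans (min_le_left _ _)
    have hεS : ε ≤ S := hεε.trans ((min_le_right _ _).trans (min_le_left _ _))
    have hεb : ε ≤ b * (e₂ * μ) / (b + 2 * κ) :=
      hεε.trans ((min_le_right _ _).trans (min_le_right _ _))
    rw [le_div_iff₀ (by positivity)] at hεb
    have hsq : ε ^ 2 ≤ ε := by nlinarith
    refine (F.sol_shot hε.le hε1 ⟨h12, le_rfl⟩).not_falls_of_large hμ hκ hb he₂ hε hSe hlarge
      (by linarith) ?_ (by simp [F.zero, shot]) (by simp [F.zero, shot]) (by simp [F.zero, shot])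
    have : ε ^ 2 * (b + 2 * κ) ≤ ε * (b + 2 * κ) := by gcongr
    have : 0 < b * (e₂ * μ) := by positivity
    linarith
  obtain ⟨q, hqe, hqR, hqX, hbot, htop⟩ := F.exists_homoclinic hμ ha hb he₁ h12 hε₀0
    (min_le_left _ _) hfall hnot
  have hS := F.sol q Set.univ fun t _ => hqR t
  have hc : Continuous fun z : ScaledState => (z.1, z.2.1, z.2.2.1) := by fun_prop
  exact ⟨q.2.2.2, _, _, _, hqe, hS, by simpa only [F.zero] using hqX,
    (hc.tendsto _).comp htop, (hc.tendsto _).comp hbot⟩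

/-- A homoclinic orbit of the rescaled system yields one of the Lorenz system. -/
lemma lorenz_homoclinic_of_scaled {σ b e : ℝ} {X V W : ℝ → ℝ} (hσ : 0 < σ) (he : 0 < e)
    (hS : ScaledSol (σ + 1) (2 * σ - b) b e X V W Set.univ) (hX : X 0 ≠ 0)
    (htop : Tendsto (fun t => (X t, V t, W t)) atTop (𝓝 (0, 0, 0)))
    (hbot : Tendsto (fun t => (X t, V t, W t)) atBot (𝓝 (0, 0, 0))) :
    ∃ r : ℝ, 1 < r ∧ ∃ u : ℝ → ℝ × ℝ × ℝ,
      (∀ t : ℝ, HasDerivAt u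
        (-σ * ((u t).1 - (u t).2.1),
         r * (u t).1 - (u t).2.1 - (u t).1 * (u t).2.2,
         -b * (u t).2.2 + (u t).1 * (u t).2.1) t) ∧
      (∃ t s : ℝ, u t ≠ u s) ∧
      Tendsto u atTop (𝓝 ((0, 0, 0) : ℝ × ℝ × ℝ)) ∧
      Tendsto u atBot (𝓝 ((0, 0, 0) : ℝ × ℝ × ℝ)) := by
  set g : ℝ × ℝ × ℝ → ℝ × ℝ × ℝ := fun p =>
    (√2 / e * p.1, √2 / e * (p.1 + p.2.1 / (e * σ)), (p.1 ^ 2 + p.2.2) / (e ^ 2 * σ)) with hg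
  have hgc : Continuous g := by
    rw [hg]
    fun_prop
  have hg0 : g (0, 0, 0) = (0, 0, 0) := by simp [hg]
  have h2 : √2 ^ 2 = 2 := Real.sq_sqrt (by norm_num)
  have hutop : Tendsto (fun t => g (X (t / e), V (t / e), W (t / e))) atTop (𝓝 (0, 0, 0)) := by
    rw [← hg0]
    exact (hgc.tendsto _).comp (htop.comp (tendsto_id.atTop_div_const he))
  have hubot : Tendsto (fun t => g (X (t / e), V (t / e), W (t / e))) atBot (𝓝 (0, 0, 0)) := by
    rw [← hg0]
    exact (hgc.tendsto _).comp (hbot.comp (tendsto_id.atBot_div_const he))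
  refine ⟨1 + (1 + e * (σ + 1)) / (e ^ 2 * σ), by
    have : 0 < (1 + e * (σ + 1)) / (e ^ 2 * σ) := by positivity
    linarith, fun t => g (X (t / e), V (t / e), W (t / e)), fun t => ?_, ?_, hutop, hubot⟩
  · have hscale : HasDerivAt (fun t : ℝ => t / e) (1 / e) t := (hasDerivAt_id t).div_const e
    have dX : HasDerivAt (fun t => X (t / e)) _ t := (hS.hX (t / e) (Set.mem_univ _)).comp t hscale
    have dV : HasDerivAt (fun t => V (t / e)) _ t := (hS.hV (t / e) (Set.mem_univ _)).comp t hscale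
    have dW : HasDerivAt (fun t => W (t / e)) _ t := (hS.hW (t / e) (Set.mem_univ _)).comp t hscale
    refine ((dX.const_mul (√2 / e)).prodMk (((dX.fun_add (dV.div_const (e * σ))).const_mul
      (√2 / e)).prodMk (((dX.fun_pow 2).fun_add dW).div_const (e ^ 2 * σ)))).congr_deriv ?_
    simp only [hg]
    refine Prod.ext ?_ (Prod.ext ?_ ?_)
    · simp only
      field_simp
      ring
    · simp only
      field_simp
      ring
    · simp only
      push_cast
      field_simp
      rw [h2]
      ring
  · by_contra! hcon
    have h3 : Tendsto (fun _ : ℝ => g (X (0 / e), V (0 / e), W (0 / e))) atTop (𝓝 (0, 0, 0)) :=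
      hutop.congr fun t => hcon t 0
    have h4 := congrArg Prod.fst (tendsto_nhds_unique h3 tendsto_const_nhds)
    simp only [hg, zero_div] at h4
    have : √2 / e ≠ 0 := by positivity
    exact hX ((mul_eq_zero.1 h4.symm).resolve_left this)

/-- **Homoclinic orbits in the Lorenz system (Fishing principle).**
For σ > 0 and b ∈ (0,4] fixed, there exists r = r_h ∈ (1,+∞) for which the Lorenz
system ẋ = −σ(x−y), ẏ = rx − y − xz, ż = −bz + xy possesses a homoclinic orbit of
the saddle equilibrium S₀ = (0,0,0) if and only if 3σ > 2b + 1. -/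
theorem lorenz_homoclinic_iff
    (σ b : ℝ) (hσ : 0 < σ) (hb : 0 < b) (hb4 : b ≤ 4) :
    (∃ r : ℝ, 1 < r ∧ ∃ u : ℝ → ℝ × ℝ × ℝ,
      (∀ t : ℝ, HasDerivAt u
        (-σ * ((u t).1 - (u t).2.1),
         r * (u t).1 - (u t).2.1 - (u t).1 * (u t).2.2,
         -b * (u t).2.2 + (u t).1 * (u t).2.1) t) ∧
      (∃ t s : ℝ, u t ≠ u s) ∧
      Tendsto u atTop (𝓝 ((0, 0, 0) : ℝ × ℝ × ℝ)) ∧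
      Tendsto u atBot (𝓝 ((0, 0, 0) : ℝ × ℝ × ℝ)))
    ↔ 3 * σ > 2 * b + 1 := by
  constructor
  · rintro ⟨r, hr, u, hu, ⟨t, s, hts⟩, htop, hbot⟩
    by_contra h
    have hzero := no_homoclinic_of_le hσ hb hr (not_lt.1 h) hu htop hbot
    exact hts ((hzero t).trans (hzero s).symm)
  · intro h
    obtain ⟨e, X, V, W, he, hS, hX, htop, hbot⟩ := exists_scaled_homoclinic hσ hb h
    exact lorenz_homoclinic_of_scaled hσ he hS hX htop hbot
end

section
/- Consider the Lorenz system ẋ = −σ(x−y), ẏ = rx − y − xz, ż = −bz + xy. If σ > b + 1 and r > σ(σ+b+3)/(σ−b−1), then the Jacobian matrix of the right-hand side evaluated at each of the equilibria S± = (±√(b(r−1)), ±√(b(r−1)), r−1) has an eigenvalue with positive real part (so S± are unstable). -/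
open Filter Topology

/-- A monic real quadratic with negative linear coefficient has a complex root with positive
real part. -/
theorem exists_quadratic_root_re_pos {p q : ℝ} (hp : p < 0) :
    ∃ z : ℂ, 0 < z.re ∧ z ^ 2 + p * z + q = 0 := by
  obtain ⟨w, hw, hre⟩ : ∃ w : ℂ, w ^ 2 = (p : ℂ) ^ 2 - 4 * q ∧ 0 ≤ w.re := by
    obtain ⟨w, hw⟩ := IsAlgClosed.exists_pow_nat_eq ((p : ℂ) ^ 2 - 4 * q) two_pos
    rcases le_total 0 w.re with h | h
    · exact ⟨w, hw, h⟩
    · exact ⟨-w, by rw [neg_sq, hw], by simpa using h⟩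
  refine ⟨((1 / 2 : ℝ) : ℂ) * (w - p), ?_, ?_⟩
  · rw [Complex.re_ofReal_mul, Complex.sub_re, Complex.ofReal_re]
    linarith
  · push_cast
    linear_combination (1 / 4 : ℂ) * hw

/-- A monic real cubic violating the Routh-Hurwitz inequality `C ≤ A * B` has a complex root
with positive real part. -/
theorem exists_cubic_root_re_pos {A B C : ℝ} (hA : 0 ≤ A) (hB : 0 ≤ B) (hC : A * B < C) :
    ∃ z : ℂ, 0 < z.re ∧ z ^ 3 + A * z ^ 2 + B * z + C = 0 := by
  have hC0 : 0 < C := (mul_nonneg hA hB).trans_lt hC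
  obtain ⟨x, ⟨-, hx⟩, h0⟩ : ∃ x ∈ Set.Ico (-(A + C + 1)) (-A),
      x ^ 3 + A * x ^ 2 + B * x + C = 0 := by
    refine intermediate_value_Ico (f := fun x : ℝ => x ^ 3 + A * x ^ 2 + B * x + C)
      (by linarith) (by fun_prop) ⟨?_, ?_⟩
    · have h1 : 1 ≤ (A + C + 1) ^ 2 := one_le_pow₀ (by linarith)
      have h2 : 0 ≤ B * (A + C + 1) := by positivity
      nlinarith [mul_le_mul_of_nonneg_right h1 (by linarith : 0 ≤ C + 1)]
    · change 0 < (-A) ^ 3 + A * (-A) ^ 2 + B * (-A) + C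
      linarith
  obtain ⟨z, hz, hq⟩ := exists_quadratic_root_re_pos (p := A + x) (q := B + x * (A + x))
    (by linarith)
  refine ⟨z, hz, ?_⟩
  have h0' : (x : ℂ) ^ 3 + A * x ^ 2 + B * x + C = 0 := mod_cast h0
  push_cast at hq
  linear_combination (z - x) * hq + h0'

/-- **Instability of the nontrivial equilibria S± of the Lorenz system.**
If σ > b + 1 and r > σ(σ+b+3)/(σ−b−1), then the Jacobian matrix of the Lorenz
vector field at each of the equilibria S± = (±√(b(r−1)), ±√(b(r−1)), r−1) has an
eigenvalue with positive real part. -/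
theorem lorenz_Spm_unstable
    (σ b r : ℝ) (hσ : 0 < σ) (hb : 0 < b) (hb4 : b ≤ 4) (hr : 1 < r)
    (h1 : b + 1 < σ) (h2 : σ * (σ + b + 3) / (σ - b - 1) < r) :
    ∀ s : ℝ, (s = Real.sqrt (b * (r - 1)) ∨ s = -Real.sqrt (b * (r - 1))) →
      ∃ μ : ℂ, 0 < μ.re ∧
        Module.End.HasEigenvalue
          (Matrix.toLin'
            (!![(-σ : ℂ), (σ : ℂ), 0;
                ((r : ℂ) - ((r : ℂ) - 1)), -1, (-s : ℂ);
                (s : ℂ), (s : ℂ), (-b : ℂ)])) μ := by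
  intro s hs
  have hs2 : s ^ 2 = b * (r - 1) := by
    have h := Real.sq_sqrt (mul_nonneg hb.le (sub_nonneg.2 hr.le))
    rcases hs with rfl | rfl
    · exact h
    · rw [neg_sq, h]
  rw [div_lt_iff₀ (by linarith)] at h2
  obtain ⟨z, hz, hroot⟩ := exists_cubic_root_re_pos (A := σ + b + 1) (B := b * (σ + r))
    (C := 2 * b * σ * (r - 1)) (by positivity) (by positivity) (by nlinarith)
  refine ⟨z, hz, ?_⟩
  rw [Module.End.hasEigenvalue_iff_mem_spectrum, Matrix.spectrum_toLin',
    Matrix.mem_spectrum_iff_isRoot_charpoly, Polynomial.IsRoot, Matrix.eval_charpoly,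
    Matrix.det_fin_three]
  have hs2' : (s : ℂ) ^ 2 = b * (r - 1) := mod_cast hs2
  push_cast at hroot
  simp [Matrix.scalar_apply]
  linear_combination hroot + (z + 2 * σ) * hs2'
end

section
/- Consider the complex Lorenz system in real coordinates: ẋ₁ = σ(x₃−x₁), ẋ₂ = σ(x₄−x₂), ẋ₃ = r₁x₁ − r₂x₂ − x₃ − e x₄ − x₁x₅, ẋ₄ = r₂x₁ + r₁x₂ + e x₃ − x₄ − x₂x₅, ẋ₅ = −bx₅ + x₁x₃ + x₂x₄. If r₂ + e ≠ 0, or (r₂ + e = 0 and r₁ ≤ 1), then the only point of ℝ⁵ at which the right-hand side vanishes is the origin S₀ = (0,0,0,0,0). -/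
/-- **Uniqueness of the zero equilibrium of the complex Lorenz system (real form).**
If r₂ + e ≠ 0, or (r₂ + e = 0 and r₁ ≤ 1), then the only point of ℝ⁵ at which the
right-hand side of the complex Lorenz system in real coordinates vanishes is the
origin S₀ = (0,0,0,0,0). -/
theorem complex_lorenz_unique_equilibrium
    (σ b r₁ r₂ e : ℝ) (hσ : 0 < σ) (hb : 0 < b)
    (hcond : r₂ + e ≠ 0 ∨ (r₂ + e = 0 ∧ r₁ ≤ 1)) :
    ∀ x₁ x₂ x₃ x₄ x₅ : ℝ,
      (σ * (x₃ - x₁) = 0 ∧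
       σ * (x₄ - x₂) = 0 ∧
       r₁ * x₁ - r₂ * x₂ - x₃ - e * x₄ - x₁ * x₅ = 0 ∧
       r₂ * x₁ + r₁ * x₂ + e * x₃ - x₄ - x₂ * x₅ = 0 ∧
       -b * x₅ + x₁ * x₃ + x₂ * x₄ = 0)
      ↔ (x₁ = 0 ∧ x₂ = 0 ∧ x₃ = 0 ∧ x₄ = 0 ∧ x₅ = 0) := by
  intro x₁ x₂ x₃ x₄ x₅
  constructor
  · rintro ⟨h₁, h₂, h₃, h₄, h₅⟩
    obtain rfl : x₃ = x₁ := sub_eq_zero.mp ((mul_eq_zero.mp h₁).resolve_left hσ.ne')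
    obtain rfl : x₄ = x₂ := sub_eq_zero.mp ((mul_eq_zero.mp h₂).resolve_left hσ.ne')
    have hx₅ : b * x₅ = x₃ ^ 2 + x₄ ^ 2 := by linarith
    have hN : x₃ ^ 2 + x₄ ^ 2 = 0 := by
      rcases hcond with he | ⟨-, hr⟩
      · have h : (r₂ + e) * (x₃ ^ 2 + x₄ ^ 2) = 0 := by
          linear_combination x₃ * h₄ - x₄ * h₃
        exact (mul_eq_zero.mp h).resolve_left he
      · have h : (r₁ - 1 - x₅) * (x₃ ^ 2 + x₄ ^ 2) = 0 := by
          linear_combination x₃ * h₃ + x₄ * h₄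
        rcases mul_eq_zero.mp h with h | h
        · have : b * x₅ ≤ 0 := mul_nonpos_of_nonneg_of_nonpos hb.le (by linarith)
          linarith [sq_nonneg x₃, sq_nonneg x₄]
        · exact h
    have hx₃ : x₃ = 0 := by
      rw [← sq_eq_zero_iff]
      linarith [sq_nonneg x₃, sq_nonneg x₄]
    have hx₄ : x₄ = 0 := by
      rw [← sq_eq_zero_iff]
      linarith [sq_nonneg x₃, sq_nonneg x₄]
    exact ⟨hx₃, hx₄, hx₃, hx₄, (mul_eq_zero.mp (hx₅.trans hN)).resolve_left hb.ne'⟩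
  · rintro ⟨rfl, rfl, rfl, rfl, rfl⟩
    simp
end

section
/- Consider the complex Lorenz system in real coordinates: ẋ₁ = σ(x₃−x₁), ẋ₂ = σ(x₄−x₂), ẋ₃ = r₁x₁ − r₂x₂ − x₃ − e x₄ − x₁x₅, ẋ₄ = r₂x₁ + r₁x₂ + e x₃ − x₄ − x₂x₅, ẋ₅ = −bx₅ + x₁x₃ + x₂x₄. If r₂ + e = 0 and r₁ > 1, then the set of points where the right-hand side vanishes is exactly {(0,0,0,0,0)} ∪ {(ρ cos θ, ρ sin θ, ρ cos θ, ρ sin θ, r₁ − 1) : θ ∈ [0,2π)}, where ρ = √(b(r₁−1)); equivalently, the nonzero equilibria are exactly the points with x₁² + x₂² = b(r₁−1), x₃ = x₁, x₄ = x₂, x₅ = r₁ − 1. -/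
open Real

/-- Polar coordinates on the circle of squared radius `R`, with the angle in `[0, 2π)`. -/
theorem exists_Ico_polar_of_sq_add_sq_eq {x y R : ℝ} (h : x ^ 2 + y ^ 2 = R) :
    ∃ θ ∈ Set.Ico (0 : ℝ) (2 * π), x = √R * cos θ ∧ y = √R * sin θ := by
  have hnorm : ‖(⟨x, y⟩ : ℂ)‖ = √R := by
    rw [Complex.norm_eq_sqrt_sq_add_sq, h]
  refine ⟨toIcoMod two_pi_pos 0 (Complex.arg ⟨x, y⟩), ?_, ?_, ?_⟩
  · simpa using toIcoMod_mem_Ico two_pi_pos 0 (Complex.arg ⟨x, y⟩)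
  · rw [← self_sub_toIcoDiv_zsmul, zsmul_eq_mul, cos_sub_int_mul_two_pi, ← hnorm,
      Complex.norm_mul_cos_arg]
  · rw [← self_sub_toIcoDiv_zsmul, zsmul_eq_mul, sin_sub_int_mul_two_pi, ← hnorm,
      Complex.norm_mul_sin_arg]

/-- **The circle of equilibria of the complex Lorenz system (real form).**
If r₂ + e = 0 and r₁ > 1, then the set of equilibria is exactly the origin together
with the circle {(ρ cos θ, ρ sin θ, ρ cos θ, ρ sin θ, r₁−1) : θ ∈ [0,2π)},
ρ = √(b(r₁−1)); equivalently, the nonzero equilibria are exactly the points with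
x₁² + x₂² = b(r₁−1), x₃ = x₁, x₄ = x₂, x₅ = r₁−1. -/
theorem complex_lorenz_circle_of_equilibria
    (σ b r₁ r₂ e : ℝ) (hσ : 0 < σ) (hb : 0 < b)
    (him : r₂ + e = 0) (hre : 1 < r₁) :
    ({p : ℝ × ℝ × ℝ × ℝ × ℝ |
        σ * (p.2.2.1 - p.1) = 0 ∧
        σ * (p.2.2.2.1 - p.2.1) = 0 ∧
        r₁ * p.1 - r₂ * p.2.1 - p.2.2.1 - e * p.2.2.2.1 - p.1 * p.2.2.2.2 = 0 ∧
        r₂ * p.1 + r₁ * p.2.1 + e * p.2.2.1 - p.2.2.2.1 - p.2.1 * p.2.2.2.2 = 0 ∧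
        -b * p.2.2.2.2 + p.1 * p.2.2.1 + p.2.1 * p.2.2.2.1 = 0}
      = {((0 : ℝ), (0 : ℝ), (0 : ℝ), (0 : ℝ), (0 : ℝ))} ∪
        {p : ℝ × ℝ × ℝ × ℝ × ℝ | ∃ θ ∈ Set.Ico (0 : ℝ) (2 * π),
          p = (Real.sqrt (b * (r₁ - 1)) * Real.cos θ,
               Real.sqrt (b * (r₁ - 1)) * Real.sin θ,
               Real.sqrt (b * (r₁ - 1)) * Real.cos θ,
               Real.sqrt (b * (r₁ - 1)) * Real.sin θ,
               r₁ - 1)}) ∧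
    ({p : ℝ × ℝ × ℝ × ℝ × ℝ |
        σ * (p.2.2.1 - p.1) = 0 ∧
        σ * (p.2.2.2.1 - p.2.1) = 0 ∧
        r₁ * p.1 - r₂ * p.2.1 - p.2.2.1 - e * p.2.2.2.1 - p.1 * p.2.2.2.2 = 0 ∧
        r₂ * p.1 + r₁ * p.2.1 + e * p.2.2.1 - p.2.2.2.1 - p.2.1 * p.2.2.2.2 = 0 ∧
        -b * p.2.2.2.2 + p.1 * p.2.2.1 + p.2.1 * p.2.2.2.1 = 0}
      = {((0 : ℝ), (0 : ℝ), (0 : ℝ), (0 : ℝ), (0 : ℝ))} ∪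
        {p : ℝ × ℝ × ℝ × ℝ × ℝ |
          p.1 ^ 2 + p.2.1 ^ 2 = b * (r₁ - 1) ∧ p.2.2.1 = p.1 ∧
          p.2.2.2.1 = p.2.1 ∧ p.2.2.2.2 = r₁ - 1}) := by
  have hR : 0 ≤ b * (r₁ - 1) := mul_nonneg hb.le (by linarith)
  obtain rfl : e = -r₂ := by linarith
  rw [and_iff_right_of_imp]
  · ext ⟨x, y, u, v, w⟩
    simp only [Set.mem_ofPred_eq, Set.mem_union, Set.mem_singleton_iff, Prod.mk.injEq]
    constructor
    · rintro ⟨h1, h2, h3, h4, h5⟩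
      obtain rfl : u = x := sub_eq_zero.mp ((mul_eq_zero.mp h1).resolve_left hσ.ne')
      obtain rfl : v = y := sub_eq_zero.mp ((mul_eq_zero.mp h2).resolve_left hσ.ne')
      by_cases hw : w = r₁ - 1
      · subst hw
        exact Or.inr ⟨by linarith, rfl, rfl, rfl⟩
      · have hw' : r₁ - 1 - w ≠ 0 := fun h => hw (by linarith)
        obtain rfl : u = 0 :=
          (mul_eq_zero.mp (show (r₁ - 1 - w) * u = 0 by linarith)).resolve_left hw'
        obtain rfl : v = 0 :=
          (mul_eq_zero.mp (show (r₁ - 1 - w) * v = 0 by linarith)).resolve_left hw'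
        have hw0 : w = 0 :=
          (mul_eq_zero.mp (show b * w = 0 by linarith)).resolve_left hb.ne'
        exact Or.inl ⟨rfl, rfl, rfl, rfl, hw0⟩
    · rintro (⟨rfl, rfl, rfl, rfl, rfl⟩ | ⟨h, rfl, rfl, rfl⟩)
      · simp
      · refine ⟨by ring, by ring, by ring, by ring, by linarith⟩
  · intro h
    rw [h]
    congr 1
    ext ⟨x, y, u, v, w⟩
    simp only [Set.mem_ofPred_eq, Prod.mk.injEq]
    constructor
    · rintro ⟨hxy, rfl, rfl, rfl⟩
      obtain ⟨θ, hθ, hx, hy⟩ := exists_Ico_polar_of_sq_add_sq_eq hxy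
      exact ⟨θ, hθ, hx, hy, hx, hy, rfl⟩
    · rintro ⟨θ, -, rfl, rfl, rfl, rfl, rfl⟩
      refine ⟨?_, rfl, rfl, rfl⟩
      rw [mul_pow, mul_pow, ← mul_add, cos_sq_add_sin_sq, mul_one, sq_sqrt hR]
end
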